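/- Existence of local solutions of the conformal Laplace equation near a boundary point (Lemma B.1, part 2): Let n ≥ 3, k ∈ ℕ with k ≥ 2, and α ∈ (0,1). Let g be a metric of class C^{k+α} on an open neighborhood Ω of 0 in ℝⁿ. For ε > 0 set D_ε = B̄(0,ε) ∩ {x ∈ ℝⁿ : xⁿ ≥ 0} and Γ_ε = D_ε ∩ {x ∈ ℝⁿ : xⁿ = 0}. Then there exist ε > 0 with D_ε ⊆ Ω and a function fⁿ of class C^{k+α} on an open neighborhood of D_ε such that L_g fⁿ = 0 on D_ε, fⁿ = 0 on Γ_ε, and ∇fⁿ(0) = eₙ (the n-th standard basis vector). Moreover, there exist ε > 0 and a function f of class C^{k+α} on an open neighborhood of D_ε such that L_g f = 0 on D_ε, f > 0 on D_ε, and f = 1 on Γ_ε. -/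

import Mathlib

noncomputable section

open Set Matrix Matrix

/-- Points of `ℝⁿ`. -/
abbrev Pt (n : ℕ) := Fin n → ℝ

/-- A metric in coordinates: a matrix-valued map. -/
abbrev Met (n : ℕ) := Pt n → Matrix (Fin n) (Fin n) ℝ

/-- Partial derivative of `f` in the `a`-th coordinate direction. -/
def pd {n : ℕ} (a : Fin n) (f : Pt n → ℝ) (x : Pt n) : ℝ :=
  fderiv ℝ f x (Pi.single a 1)

/-- `g` is a metric (pointwise symmetric positive definite) on `U`. -/
def IsMetricOn {n : ℕ} (g : Met n) (U : Set (Pt n)) : Prop :=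
  ∀ x ∈ U, (g x).IsSymm ∧ (g x).PosDef

/-- Christoffel symbols `Γ^c_{ab}` of `g`. -/
def christoffel {n : ℕ} (g : Met n) (c a b : Fin n) (x : Pt n) : ℝ :=
  (1 / 2) * ∑ d, (g x)⁻¹ c d *
    (pd a (fun y => g y b d) x + pd b (fun y => g y a d) x - pd d (fun y => g y a b) x)

/-- Ricci tensor `R_{ab}` of `g`. -/
def ricci {n : ℕ} (g : Met n) (a b : Fin n) (x : Pt n) : ℝ :=
  (∑ c, pd c (christoffel g c a b) x) - (∑ c, pd a (christoffel g c c b) x)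
    + (∑ c, ∑ d, christoffel g c a b x * christoffel g d d c x)
    - (∑ c, ∑ d, christoffel g d c b x * christoffel g c a d x)

/-- Scalar curvature `R(g)`. -/
def scalarCurv {n : ℕ} (g : Met n) (x : Pt n) : ℝ :=
  ∑ a, ∑ b, (g x)⁻¹ a b * ricci g a b x

/-- Laplace–Beltrami operator `Δ_g`. -/
def laplaceBeltrami {n : ℕ} (g : Met n) (u : Pt n → ℝ) (x : Pt n) : ℝ :=
  -(Real.sqrt (g x).det)⁻¹ *
    ∑ a, pd a (fun y => Real.sqrt (g y).det * ∑ b, (g y)⁻¹ a b * pd b u y) x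

/-- Conformal Laplacian `L_g`. -/
def confLap {n : ℕ} (g : Met n) (u : Pt n → ℝ) (x : Pt n) : ℝ :=
  laplaceBeltrami g u x + (((n : ℝ) - 2) / (4 * ((n : ℝ) - 1))) * scalarCurv g x * u x

/-- `f` is of class `C^{k+α}` on `s`: it is `C^k` there and its `k`-th order derivatives are
locally `α`-Hölder continuous. -/
def CHolderOn {n : ℕ} (k : ℕ) (α : ℝ) (s : Set (Pt n)) (f : Pt n → ℝ) : Prop :=
  ContDiffOn ℝ k f s ∧
    ∀ x ∈ s, ∃ C : NNReal, ∃ t ∈ nhdsWithin x s,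
      HolderOnWith C (Real.toNNReal α) (iteratedFDerivWithin ℝ k f s) t

/-- All entries of `g` are of class `C^{k+α}` on `s`. -/
def MetCHolderOn {n : ℕ} (k : ℕ) (α : ℝ) (s : Set (Pt n)) (g : Met n) : Prop :=
  ∀ a b, CHolderOn k α s fun x => g x a b

/-- Contracted Christoffel symbol `Γ^a = g^{bc} Γ^a_{bc}`. -/
def gammaUp {n : ℕ} (g : Met n) (a : Fin n) (x : Pt n) : ℝ :=
  ∑ b, ∑ c, (g x)⁻¹ b c * christoffel g a b c x

/-- Contracted Christoffel symbol `Γ_a = g_{ab} Γ^b`. -/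
def gammaLow {n : ℕ} (g : Met n) (a : Fin n) (x : Pt n) : ℝ :=
  ∑ b, g x a b * gammaUp g b x

/-- `g` satisfies the conformal harmonic gauge on `U`. -/
def ConfHarmonicGauge {n : ℕ} (g : Met n) (U : Set (Pt n)) : Prop :=
  ∃ f : Pt n → ℝ, ContDiffOn ℝ 2 f U ∧ (∀ x ∈ U, 0 < f x) ∧
    (∀ x ∈ U, confLap g f x = 0) ∧
    ∀ a : Fin n, ∀ x ∈ U, gammaLow g a x = 2 * pd a (fun y => Real.log (f y)) x

/-- Determinant-normalized metric `ĝ = (det g)^{-1/n} g`. -/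
def dnorm {n : ℕ} (g : Met n) : Met n :=
  fun x => ((g x).det ^ (-(1 : ℝ) / (n : ℝ))) • g x

/-- Jacobian matrix of a map `Z : ℝⁿ → ℝⁿ`. -/
def jac {n : ℕ} (Z : Pt n → Pt n) (x : Pt n) : Matrix (Fin n) (Fin n) ℝ :=
  Matrix.of fun i j => pd j (fun y => Z y i) x

/-- Riemann curvature tensor `R_{abc}{}^{d}`. -/
def riemannUp {n : ℕ} (g : Met n) (a b c d : Fin n) (x : Pt n) : ℝ :=
  pd a (christoffel g d b c) x - pd b (christoffel g d a c) x
    + (∑ e, christoffel g e b c x * christoffel g d a e x)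
    - (∑ e, christoffel g e a c x * christoffel g d b e x)

/-- Riemann curvature tensor `R_{abcd} = R_{abc}{}^{e} g_{ed}`. -/
def riemannLow {n : ℕ} (g : Met n) (a b c d : Fin n) (x : Pt n) : ℝ :=
  ∑ e, riemannUp g a b c e x * g x e d

/-- Schouten tensor `P_{ab}`. -/
def schouten {n : ℕ} (g : Met n) (a b : Fin n) (x : Pt n) : ℝ :=
  (1 / ((n : ℝ) - 2)) * (ricci g a b x - (scalarCurv g x / (2 * ((n : ℝ) - 1))) * g x a b)

/-- Weyl tensor `W_{abcd}`. -/
def weyl {n : ℕ} (g : Met n) (a b c d : Fin n) (x : Pt n) : ℝ :=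
  riemannLow g a b c d x + schouten g a c x * g x b d - schouten g b c x * g x a d
    + schouten g b d x * g x a c - schouten g a d x * g x b c

/-- Weyl tensor with raised last index, `W_{abc}{}^{d} = g^{de} W_{abce}`. -/
def weylUp {n : ℕ} (g : Met n) (a b c d : Fin n) (x : Pt n) : ℝ :=
  ∑ e, (g x)⁻¹ d e * weyl g a b c e x

/-- Covariant derivative of a 2-tensor: `(∇T)_{cab} = ∇_c T_{ab}`. -/
def cov2 {n : ℕ} (g : Met n) (T : Fin n → Fin n → Pt n → ℝ) (c a b : Fin n) (x : Pt n) : ℝ :=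
  pd c (T a b) x - (∑ d, christoffel g d c a x * T d b x)
    - ∑ d, christoffel g d c b x * T a d x

/-- Covariant derivative of a 3-tensor: `(∇T)_{dabc} = ∇_d T_{abc}`. -/
def cov3 {n : ℕ} (g : Met n) (T : Fin n → Fin n → Fin n → Pt n → ℝ) (d a b c : Fin n)
    (x : Pt n) : ℝ :=
  pd d (T a b c) x - (∑ e, christoffel g e d a x * T e b c x)
    - (∑ e, christoffel g e d b x * T a e c x)
    - ∑ e, christoffel g e d c x * T a b e x

/-- Cotton tensor `C_{abc} = ∇_a P_{bc} - ∇_b P_{ac}`. -/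
def cotton {n : ℕ} (g : Met n) (a b c : Fin n) (x : Pt n) : ℝ :=
  cov2 g (schouten g) a b c x - cov2 g (schouten g) b a c x

/-- Bach tensor `B_{ab}`. -/
def bach {n : ℕ} (g : Met n) (a b : Fin n) (x : Pt n) : ℝ :=
  (∑ c, ∑ d, (g x)⁻¹ c d *
      (cov3 g (cov2 g (schouten g)) d a b c x - cov3 g (cov2 g (schouten g)) d c a b x))
    + ∑ c, ∑ d, ∑ e, ∑ f, (g x)⁻¹ c e * (g x)⁻¹ d f * schouten g e f x * weyl g a c d b x


/-! ### Partial derivatives -/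

lemma pd_congr {n : ℕ} {f g : Pt n → ℝ} {x : Pt n} (a : Fin n) (h : f =ᶠ[nhds x] g) :
    pd a f x = pd a g x := by
  unfold pd; rw [h.fderiv_eq]

lemma pd_add {n : ℕ} {f g : Pt n → ℝ} {x : Pt n} (a : Fin n) (hf : DifferentiableAt ℝ f x)
    (hg : DifferentiableAt ℝ g x) : pd a (fun y => f y + g y) x = pd a f x + pd a g x := by
  unfold pd; rw [fderiv_fun_add hf hg]; rfl

lemma pd_mul {n : ℕ} {f g : Pt n → ℝ} {x : Pt n} (a : Fin n) (hf : DifferentiableAt ℝ f x)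
    (hg : DifferentiableAt ℝ g x) :
    pd a (fun y => f y * g y) x = pd a f x * g x + f x * pd a g x := by
  unfold pd; rw [fderiv_fun_mul hf hg]; simp; ring

lemma pd_const_mul {n : ℕ} {f : Pt n → ℝ} {x : Pt n} (a : Fin n) (c : ℝ)
    (hf : DifferentiableAt ℝ f x) : pd a (fun y => c * f y) x = c * pd a f x := by
  unfold pd; rw [fderiv_const_mul hf]; rfl

lemma pd_const {n : ℕ} (a : Fin n) (c : ℝ) (x : Pt n) : pd a (fun _ => c) x = 0 := by
  unfold pd; simp

lemma pd_sum {n : ℕ} {ι : Type*} {t : Finset ι} {f : ι → Pt n → ℝ} {x : Pt n} (a : Fin n)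
    (hf : ∀ i ∈ t, DifferentiableAt ℝ (f i) x) :
    pd a (fun y => ∑ i ∈ t, f i y) x = ∑ i ∈ t, pd a (f i) x := by
  unfold pd; rw [fderiv_fun_sum hf]; simp

lemma fderiv_apply_eq_sum_pd {n : ℕ} (f : Pt n → ℝ) (x v : Pt n) :
    fderiv ℝ f x v = ∑ i, v i * pd i f x := by
  have hv : v = ∑ i, v i • (Pi.single i (1 : ℝ) : Pt n) := by
    ext j; simp [Finset.sum_apply, Pi.single_apply]
  conv_lhs => rw [hv]
  rw [map_sum]; simp [pd]

lemma norm_fderiv_le_of_pd {n : ℕ} {f : Pt n → ℝ} {x : Pt n} {C : ℝ}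
    (h : ∀ i, |pd i f x| ≤ C) (hC : 0 ≤ C) : ‖fderiv ℝ f x‖ ≤ n * C := by
  refine ContinuousLinearMap.opNorm_le_bound _ (by positivity) fun v => ?_
  rw [fderiv_apply_eq_sum_pd]
  calc ‖∑ i, v i * pd i f x‖ ≤ ∑ i, ‖v i * pd i f x‖ := norm_sum_le _ _
    _ ≤ ∑ _i : Fin n, ‖v‖ * C := by
        refine Finset.sum_le_sum fun i _ => ?_
        rw [norm_mul]
        exact mul_le_mul (norm_le_pi_norm v i) (h i) (norm_nonneg _) (norm_nonneg _)
    _ = n * C * ‖v‖ := by simp; ring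

lemma abs_sub_le_of_pd {n : ℕ} {f : Pt n → ℝ} {s : Set (Pt n)} (hs : Convex ℝ s) {C : ℝ}
    (hC : 0 ≤ C) (hd : ∀ x ∈ s, DifferentiableAt ℝ f x) (h : ∀ x ∈ s, ∀ i, |pd i f x| ≤ C)
    {x y : Pt n} (hx : x ∈ s) (hy : y ∈ s) : |f x - f y| ≤ n * C * ‖x - y‖ :=
  hs.norm_image_sub_le_of_norm_fderiv_le hd
    (fun z hz => norm_fderiv_le_of_pd (h z hz) hC) hy hx

/-- A function that is bounded and Lipschitz is Hölder continuous. -/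
lemma holder_of_bounded_of_lipschitz {a b K d α : ℝ} (hα : α ∈ Ioo (0 : ℝ) 1) (hd : 0 ≤ d)
    (ha : 0 ≤ a) (hK : 0 ≤ K) (h1 : b ≤ a) (h2 : b ≤ K * d) : b ≤ (a + K) * d ^ α := by
  rcases le_total d 1 with h | h
  · have : d ≤ d ^ α := by
      conv_lhs => rw [← Real.rpow_one d]
      exact Real.rpow_le_rpow_of_exponent_ge' hd h hα.1.le hα.2.le
    have h3 : 0 ≤ d ^ α := Real.rpow_nonneg hd _
    nlinarith
  · have : 1 ≤ d ^ α := Real.one_le_rpow h hα.1.le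
    nlinarith

/-! ### Quantitative Hölder classes -/

/-- `f` has partial derivatives up to order `m` on `s`, all bounded by `C`, and those of
order `m` are `α`-Hölder continuous on `s` with constant `C`. -/
def HolderBdd {n : ℕ} (α : ℝ) : ℕ → ℝ → Set (Pt n) → (Pt n → ℝ) → Prop
  | 0, C, s, f => (∀ x ∈ s, |f x| ≤ C) ∧ ∀ x ∈ s, ∀ y ∈ s, |f x - f y| ≤ C * ‖x - y‖ ^ α
  | m + 1, C, s, f => (∀ x ∈ s, |f x| ≤ C) ∧ (∀ x ∈ s, DifferentiableAt ℝ f x) ∧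
      ∀ i, HolderBdd α m C s (pd i f)

namespace HolderBdd

variable {n : ℕ} {α : ℝ} {m : ℕ} {C C' : ℝ} {s t : Set (Pt n)} {f g : Pt n → ℝ}

lemma bound (h : HolderBdd α m C s f) : ∀ x ∈ s, |f x| ≤ C := by
  cases m with
  | zero => exact h.1
  | succ m => exact h.1

lemma mono_const (h : HolderBdd α m C s f) (hC : C ≤ C') : HolderBdd α m C' s f := by
  induction m generalizing f with
  | zero =>
    refine ⟨fun x hx => (h.1 x hx).trans hC, fun x hx y hy => (h.2 x hx y hy).trans ?_⟩
    exact mul_le_mul_of_nonneg_right hC (Real.rpow_nonneg (norm_nonneg _) _)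
  | succ m ih =>
    exact ⟨fun x hx => (h.1 x hx).trans hC, h.2.1, fun i => ih (h.2.2 i)⟩

lemma mono_set (h : HolderBdd α m C s f) (hst : t ⊆ s) : HolderBdd α m C t f := by
  induction m generalizing f with
  | zero => exact ⟨fun x hx => h.1 x (hst hx), fun x hx y hy => h.2 x (hst hx) y (hst hy)⟩
  | succ m ih =>
    exact ⟨fun x hx => h.1 x (hst hx), fun x hx => h.2.1 x (hst hx), fun i => ih (h.2.2 i)⟩

lemma congr (h : HolderBdd α m C s f) (hs : IsOpen s) (hfg : EqOn g f s) :
    HolderBdd α m C s g := by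
  induction m generalizing f g with
  | zero =>
    refine ⟨fun x hx => hfg hx ▸ h.1 x hx, fun x hx y hy => ?_⟩
    rw [hfg hx, hfg hy]; exact h.2 x hx y hy
  | succ m ih =>
    have hev : ∀ x ∈ s, g =ᶠ[nhds x] f := fun x hx =>
      Filter.eventuallyEq_of_mem (hs.mem_nhds hx) hfg
    exact ⟨fun x hx => hfg hx ▸ h.1 x hx,
      fun x hx => (hev x hx).differentiableAt_iff.mpr (h.2.1 x hx),
      fun i => ih (h.2.2 i) fun x hx => pd_congr i (hev x hx)⟩

lemma continuousOn (h : HolderBdd α m C s f) (hα : 0 < α) : ContinuousOn f s := by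
  cases m with
  | succ m => exact fun x hx => (h.2.1 x hx).continuousAt.continuousWithinAt
  | zero =>
    intro x hx
    rw [ContinuousWithinAt, tendsto_iff_norm_sub_tendsto_zero]
    have h1 : Filter.Tendsto (fun y => C * ‖y - x‖ ^ α) (nhdsWithin x s) (nhds 0) := by
      have : ContinuousWithinAt (fun y => C * ‖y - x‖ ^ α) s x := by
        refine ContinuousAt.continuousWithinAt ?_
        refine continuousAt_const.mul (ContinuousAt.rpow_const (by fun_prop) (Or.inr hα.le))
      simpa [ContinuousWithinAt, Real.zero_rpow hα.ne'] using this
    refine squeeze_zero' (Filter.Eventually.of_forall fun _ => norm_nonneg _) ?_ h1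
    filter_upwards [self_mem_nhdsWithin] with y hy using h.2 y hy x hx

lemma const_nonneg (h : HolderBdd α m C s f) {x : Pt n} (hx : x ∈ s) : 0 ≤ C :=
  (abs_nonneg _).trans (h.bound x hx)

lemma pd_bound (h : HolderBdd α (m + 1) C s f) (i : Fin n) : ∀ x ∈ s, |pd i f x| ≤ C :=
  (h.2.2 i).bound

lemma of_succ (h : HolderBdd α (m + 1) C s f) (hα : α ∈ Ioo (0 : ℝ) 1) (hs : Convex ℝ s)
    (hC : 0 ≤ C) : HolderBdd α m ((n + 2) * C) s f := by
  have hle : C ≤ (n + 2) * C := by nlinarith [mul_nonneg (Nat.cast_nonneg (α := ℝ) n) hC]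
  induction m generalizing f with
  | zero =>
    refine ⟨fun x hx => (h.1 x hx).trans hle, fun x hx y hy => ?_⟩
    have h1 : |f x - f y| ≤ 2 * C := by
      have := abs_sub (f x) (f y)
      linarith [h.1 x hx, h.1 y hy]
    have h2 := abs_sub_le_of_pd hs hC h.2.1 (fun x hx i => h.pd_bound i x hx) hx hy
    refine (holder_of_bounded_of_lipschitz hα (norm_nonneg _) (by positivity) (by positivity)
      h1 h2).trans (le_of_eq (by ring))
  | succ m ih =>
    exact ⟨fun x hx => (h.1 x hx).trans hle, h.2.1, fun i => ih (h.2.2 i)⟩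

lemma add (h : HolderBdd α m C s f) (h' : HolderBdd α m C' s g) (hs : IsOpen s) :
    HolderBdd α m (C + C') s (fun x => f x + g x) := by
  induction m generalizing f g with
  | zero =>
    refine ⟨fun x hx => (abs_add_le _ _).trans (add_le_add (h.1 x hx) (h'.1 x hx)),
      fun x hx y hy => ?_⟩
    rw [add_sub_add_comm, add_mul]
    exact (abs_add_le _ _).trans (add_le_add (h.2 x hx y hy) (h'.2 x hx y hy))
  | succ m ih =>
    refine ⟨fun x hx => (abs_add_le _ _).trans (add_le_add (h.1 x hx) (h'.1 x hx)),
      fun x hx => (h.2.1 x hx).add (h'.2.1 x hx), fun i => ?_⟩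
    exact (ih (h.2.2 i) (h'.2.2 i)).congr hs
      fun x hx => pd_add i (h.2.1 x hx) (h'.2.1 x hx)

lemma const_mul (h : HolderBdd α m C s f) (hs : IsOpen s) (a : ℝ) :
    HolderBdd α m (|a| * C) s (fun x => a * f x) := by
  induction m generalizing f with
  | zero =>
    refine ⟨fun x hx => ?_, fun x hx y hy => ?_⟩
    · rw [abs_mul]; exact mul_le_mul_of_nonneg_left (h.1 x hx) (abs_nonneg _)
    · rw [← mul_sub, abs_mul, mul_assoc]
      exact mul_le_mul_of_nonneg_left (h.2 x hx y hy) (abs_nonneg _)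
  | succ m ih =>
    refine ⟨fun x hx => ?_, fun x hx => (h.2.1 x hx).const_mul a, fun i => ?_⟩
    · rw [abs_mul]; exact mul_le_mul_of_nonneg_left (h.1 x hx) (abs_nonneg _)
    · exact (ih (h.2.2 i)).congr hs fun x hx => pd_const_mul i a (h.2.1 x hx)

lemma neg (h : HolderBdd α m C s f) (hs : IsOpen s) :
    HolderBdd α m C s (fun x => - f x) := by
  simpa using h.const_mul hs (-1)

lemma sub (h : HolderBdd α m C s f) (h' : HolderBdd α m C' s g) (hs : IsOpen s) :
    HolderBdd α m (C + C') s (fun x => f x - g x) := by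
  simpa [sub_eq_add_neg] using h.add (h'.neg hs) hs

lemma const (a : ℝ) (ha : |a| ≤ C) : HolderBdd α m C s (fun _ => a) := by
  have hC : 0 ≤ C := (abs_nonneg _).trans ha
  induction m generalizing a with
  | zero =>
    refine ⟨fun x _ => ha, fun x _ y _ => ?_⟩
    simp only [sub_self, abs_zero]; positivity
  | succ m ih =>
    refine ⟨fun x _ => ha, fun x _ => differentiableAt_const _, fun i => ?_⟩
    have : pd i (fun _ : Pt n => a) = fun _ => 0 := funext fun x => pd_const i a x
    rw [this]; exact ih 0 (by simpa using hC)

lemma sum {ι : Type*} (T : Finset ι) {F : ι → Pt n → ℝ} {K : ι → ℝ} (hs : IsOpen s)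
    (h : ∀ i ∈ T, HolderBdd α m (K i) s (F i)) :
    HolderBdd α m (∑ i ∈ T, K i) s (fun x => ∑ i ∈ T, F i x) := by
  classical
  induction T using Finset.induction_on with
  | empty => simpa using HolderBdd.const (n := n) (α := α) (m := m) (s := s) 0 (by simp)
  | insert a T ha ih =>
    simp only [Finset.sum_insert ha]
    exact (h a (by simp)).add (ih fun i hi => h i (by simp [hi])) hs

lemma exists_mul (n : ℕ) {α : ℝ} (hα : α ∈ Ioo (0 : ℝ) 1) (m : ℕ) : ∃ K : ℝ, 0 ≤ K ∧
    ∀ (s : Set (Pt n)), IsOpen s → Convex ℝ s → ∀ (C C' : ℝ) (f g : Pt n → ℝ), 0 ≤ C → 0 ≤ C' →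
      HolderBdd α m C s f → HolderBdd α m C' s g →
      HolderBdd α m (K * C * C') s (fun x => f x * g x) := by
  induction m with
  | zero =>
    refine ⟨2, by norm_num, fun s _ _ C C' f g hC hC' h h' => ⟨fun x hx => ?_, fun x hx y hy => ?_⟩⟩
    · rw [abs_mul]
      have := mul_le_mul (h.1 x hx) (h'.1 x hx) (abs_nonneg _) hC
      nlinarith [mul_nonneg hC hC']
    · have e : f x * g x - f y * g y = f x * (g x - g y) + (f x - f y) * g y := by ring
      rw [e]
      refine (abs_add_le _ _).trans ?_
      rw [abs_mul, abs_mul]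
      have h1 := mul_le_mul (h.1 x hx) (h'.2 x hx y hy) (abs_nonneg _) hC
      have h2 := mul_le_mul (h.2 x hx y hy) (h'.1 y hy) (abs_nonneg _)
        (mul_nonneg hC (Real.rpow_nonneg (norm_nonneg _) _))
      linarith
  | succ m ih =>
    obtain ⟨K, hK, H⟩ := ih
    refine ⟨2 * (n + 2) * K + 1, by positivity, fun s hs hc C C' f g hC hC' h h' =>
      ⟨fun x hx => ?_, fun x hx => (h.2.1 x hx).mul (h'.2.1 x hx), fun i => ?_⟩⟩
    · rw [abs_mul]
      have := mul_le_mul (h.1 x hx) (h'.1 x hx) (abs_nonneg _) hC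
      have h2 : 0 ≤ 2 * (n + 2) * K * C * C' := by positivity
      nlinarith
    · have h1 := H s hs hc _ _ _ _ hC (by positivity) (h.2.2 i) (h'.of_succ hα hc hC')
      have h2 := H s hs hc _ _ _ _ (by positivity) hC' (h.of_succ hα hc hC) (h'.2.2 i)
      refine ((h1.add h2 hs).mono_const ?_).congr hs
        fun x hx => pd_mul i (h.2.1 x hx) (h'.2.1 x hx)
      have h2 : 0 ≤ C * C' := by positivity
      nlinarith

end HolderBdd

lemma contDiff_pd {n : ℕ} {f : Pt n → ℝ} (hf : ContDiff ℝ (⊤ : ℕ∞) f) (i : Fin n) :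
    ContDiff ℝ (⊤ : ℕ∞) (pd i f) := by
  unfold pd
  exact (hf.fderiv_right (m := (⊤ : ℕ∞)) (by simp)).clm_apply contDiff_const

lemma hasCompactSupport_pd {n : ℕ} {f : Pt n → ℝ} (hf : HasCompactSupport f) (i : Fin n) :
    HasCompactSupport (pd i f) := hf.fderiv_apply ℝ _

lemma pd_comm {n : ℕ} {f : Pt n → ℝ} (hf : ContDiff ℝ (⊤ : ℕ∞) f) (i j : Fin n) :
    pd i (pd j f) = pd j (pd i f) := by
  funext x
  have hd : DifferentiableAt ℝ (fderiv ℝ f) x :=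
    (hf.fderiv_right (m := (⊤ : ℕ∞)) (by simp)).differentiable (by simp) x
  have e : ∀ a b : Fin n, pd a (pd b f) x =
      fderiv ℝ (fderiv ℝ f) x (Pi.single a 1) (Pi.single b 1) := by
    intro a b
    change fderiv ℝ (fun y => fderiv ℝ f y (Pi.single b 1)) x (Pi.single a 1) = _
    rw [fderiv_clm_apply hd (by fun_prop)]; simp
  rw [e, e]
  have hs : IsSymmSndFDerivAt ℝ f x := hf.contDiffAt.isSymmSndFDerivAt (by
    simp only [minSmoothness_of_isRCLikeNormedField]
    exact WithTop.coe_le_coe.mpr (le_top : (2 : ℕ∞) ≤ ⊤))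
  exact hs _ _

lemma exists_bound_of_compactSupport {n : ℕ} {f : Pt n → ℝ} (hf : Continuous f)
    (hs : HasCompactSupport f) : ∃ C, 0 ≤ C ∧ ∀ x, |f x| ≤ C := by
  obtain ⟨C, hC⟩ := hs.exists_bound_of_continuous hf
  exact ⟨C, (norm_nonneg _).trans (hC 0), hC⟩

lemma HolderBdd.exists_of_class {n : ℕ} {α : ℝ} (hα : α ∈ Ioo (0 : ℝ) 1) {s : Set (Pt n)}
    (hs : Convex ℝ s) (P : (Pt n → ℝ) → Prop) (h1 : ∀ f, P f → Differentiable ℝ f)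
    (h2 : ∀ f, P f → ∀ i, P (pd i f)) (h3 : ∀ f, P f → ∃ C, 0 ≤ C ∧ ∀ x ∈ s, |f x| ≤ C)
    (m : ℕ) (f : Pt n → ℝ) (hf : P f) : ∃ C, 0 ≤ C ∧ HolderBdd α m C s f := by
  induction m generalizing f with
  | zero =>
    obtain ⟨C, hC, hb⟩ := h3 f hf
    choose D hD hDb using fun i => h3 _ (h2 f hf i)
    have hDi : ∀ i, D i ≤ ∑ j, D j := fun i =>
      Finset.single_le_sum (fun j _ => hD j) (Finset.mem_univ i)
    have hS : 0 ≤ ∑ j, D j := Finset.sum_nonneg fun j _ => hD j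
    have hnS : 0 ≤ n * ∑ j, D j := by positivity
    refine ⟨2 * C + n * ∑ j, D j, by positivity, fun x hx => (hb x hx).trans (by linarith),
      fun x hx y hy => ?_⟩
    refine holder_of_bounded_of_lipschitz hα (norm_nonneg _) (by positivity) hnS ?_
      (abs_sub_le_of_pd hs hS (fun x _ => h1 f hf x)
        (fun x hx i => (hDb i x hx).trans (hDi i)) hx hy)
    have := abs_sub (f x) (f y)
    linarith [hb x hx, hb y hy]
  | succ m ih =>
    obtain ⟨C, hC, hb⟩ := h3 f hf
    choose D hD hDb using fun i => ih _ (h2 f hf i)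
    have hDi : ∀ i, D i ≤ ∑ j, D j := fun i =>
      Finset.single_le_sum (fun j _ => hD j) (Finset.mem_univ i)
    have hS : 0 ≤ ∑ j, D j := Finset.sum_nonneg fun j _ => hD j
    exact ⟨C + ∑ j, D j, by positivity, fun x hx => (hb x hx).trans (by linarith),
      fun x _ => h1 f hf x, fun i => (hDb i).mono_const ((hDi i).trans (by linarith))⟩

lemma HolderBdd.exists_of_compactSupport {n : ℕ} {α : ℝ} (hα : α ∈ Ioo (0 : ℝ) 1) (m : ℕ)
    {f : Pt n → ℝ} (hf : ContDiff ℝ (⊤ : ℕ∞) f) (hs : HasCompactSupport f) :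
    ∃ C, 0 ≤ C ∧ HolderBdd α m C univ f := by
  refine HolderBdd.exists_of_class hα convex_univ
    (fun f => ContDiff ℝ (⊤ : ℕ∞) f ∧ HasCompactSupport f)
    (fun f h => h.1.differentiable (by simp))
    (fun f h i => ⟨contDiff_pd h.1 i, hasCompactSupport_pd h.2 i⟩) (fun f h => ?_) m f ⟨hf, hs⟩
  obtain ⟨C, hC, hb⟩ := exists_bound_of_compactSupport h.1.continuous h.2
  exact ⟨C, hC, fun x _ => hb x⟩

lemma HolderBdd.exists_of_contDiff {n : ℕ} {α : ℝ} (hα : α ∈ Ioo (0 : ℝ) 1) (m : ℕ)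
    {f : Pt n → ℝ} (hf : ContDiff ℝ (⊤ : ℕ∞) f) (r : ℝ) :
    ∃ C, 0 ≤ C ∧ HolderBdd α m C (Metric.ball 0 r) f := by
  refine HolderBdd.exists_of_class hα (convex_ball 0 r)
    (fun f => ContDiff ℝ (⊤ : ℕ∞) f) (fun f h => h.differentiable (by simp))
    (fun f h i => contDiff_pd h i) (fun f h => ?_) m f hf
  obtain ⟨C, hC⟩ := (isCompact_closedBall (0 : Pt n) r).exists_bound_of_continuousOn
    h.continuous.continuousOn
  exact ⟨max C 0, le_max_right _ _,
    fun x hx => (hC x (Metric.ball_subset_closedBall hx)).trans (le_max_left _ _)⟩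

/-- Multiplication by a cutoff function turns a function on `s ∩ B(0,2)` into one on `s`. -/
lemma HolderBdd.exists_cutoff {n : ℕ} {α : ℝ} (hα : α ∈ Ioo (0 : ℝ) 1) (m : ℕ)
    (χ : Pt n → ℝ) (hχ : ContDiff ℝ (⊤ : ℕ∞) χ) (hsupp : tsupport χ ⊆ Metric.closedBall 0 (3 / 2)) :
    ∃ K : ℝ, 0 ≤ K ∧ ∀ (s : Set (Pt n)), IsOpen s → Convex ℝ s → ∀ (C : ℝ) (f : Pt n → ℝ),
      0 ≤ C → HolderBdd α m C (s ∩ Metric.ball 0 2) f →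
        HolderBdd α m (K * C) s (fun x => χ x * f x) := by
  have hcs : ∀ {χ : Pt n → ℝ}, tsupport χ ⊆ Metric.closedBall 0 (3 / 2) →
      HasCompactSupport χ := fun h =>
    (isCompact_closedBall (0 : Pt n) (3 / 2)).of_isClosed_subset (isClosed_tsupport _) h
  have hz : ∀ {χ : Pt n → ℝ}, tsupport χ ⊆ Metric.closedBall 0 (3 / 2) → ∀ {x : Pt n},
      3 / 2 < ‖x‖ → χ x = 0 := by
    intro χ h x hx
    by_contra hne
    have := h (subset_tsupport _ (Function.mem_support.mpr hne))
    rw [mem_closedBall_zero_iff] at this; linarith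
  induction m generalizing χ with
  | zero =>
    obtain ⟨A, hA, hAχ⟩ := HolderBdd.exists_of_compactSupport hα 0 hχ (hcs hsupp)
    obtain ⟨K, hK, H⟩ := HolderBdd.exists_mul n hα 0
    have h2 : (0 : ℝ) < (1 / 2) ^ α := by positivity
    set L := A / (1 / 2) ^ α with hL
    have hL0 : 0 ≤ L := by positivity
    refine ⟨K * A + A + L, by positivity, fun s hs hc C f hC hf => ?_⟩
    have hmul := H (s ∩ Metric.ball 0 2) (hs.inter Metric.isOpen_ball)
      (hc.inter (convex_ball _ _)) A C χ f hA hC (hAχ.mono_set (subset_univ _)) hf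
    have key : ∀ x ∈ s, |χ x * f x| ≤ A * C := by
      intro x hx
      by_cases hx2 : ‖x‖ < 2
      · rw [abs_mul]
        exact mul_le_mul (hAχ.1 x trivial) (hf.1 x ⟨hx, by simpa using hx2⟩) (abs_nonneg _) hA
      · rw [hz hsupp (x := x) (by linarith)]; simp; positivity
    have cross : ∀ x ∈ s, ∀ y : Pt n, ‖x‖ < 2 → ¬ ‖y‖ < 2 →
        |χ x * f x - χ y * f y| ≤ (K * A + A + L) * C * ‖x - y‖ ^ α := by
      intro x hx y hx2 hy2
      have hy : χ y = 0 := hz hsupp (by linarith)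
      have hr : 0 ≤ ‖x - y‖ ^ α := Real.rpow_nonneg (norm_nonneg _) _
      by_cases hx3 : 3 / 2 < ‖x‖
      · rw [hz hsupp hx3, hy]; simp; positivity
      · have h4 : 1 / 2 ≤ ‖x - y‖ := by
          have := norm_sub_norm_le y x
          rw [norm_sub_rev] at this; linarith
        have h5 : (1 / 2 : ℝ) ^ α ≤ ‖x - y‖ ^ α :=
          Real.rpow_le_rpow (by norm_num) h4 hα.1.le
        rw [hy, zero_mul, sub_zero]
        refine (key x hx).trans ?_
        have e : A * C = L * C * (1 / 2) ^ α := by rw [hL]; field_simp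
        rw [e]
        refine mul_le_mul ?_ h5 h2.le (by positivity)
        refine mul_le_mul_of_nonneg_right ?_ hC
        have : 0 ≤ K * A := by positivity
        linarith
    refine ⟨fun x hx => (key x hx).trans ?_, fun x hx y hy => ?_⟩
    · refine mul_le_mul_of_nonneg_right ?_ hC
      have : 0 ≤ K * A := by positivity
      linarith
    · have hr : 0 ≤ ‖x - y‖ ^ α := Real.rpow_nonneg (norm_nonneg _) _
      by_cases hx2 : ‖x‖ < 2 <;> by_cases hy2 : ‖y‖ < 2
      · refine (hmul.2 x ⟨hx, by simpa using hx2⟩ y ⟨hy, by simpa using hy2⟩).trans ?_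
        refine mul_le_mul_of_nonneg_right (mul_le_mul_of_nonneg_right ?_ hC) hr
        linarith
      · exact cross x hx y hx2 hy2
      · rw [abs_sub_comm, norm_sub_rev]; exact cross y hy x hy2 hx2
      · beta_reduce
        rw [hz hsupp (x := x) (by linarith), hz hsupp (x := y) (by linarith)]; simp; positivity
  | succ m ih =>
    obtain ⟨A, hA, hAχ⟩ := HolderBdd.exists_of_compactSupport hα 0 hχ (hcs hsupp)
    obtain ⟨K0, hK0, H0⟩ := ih χ hχ hsupp
    have hsp : ∀ i, tsupport (pd i χ) ⊆ Metric.closedBall 0 (3 / 2) := fun i =>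
      (tsupport_fderiv_apply_subset ℝ _).trans hsupp
    choose K1 hK1 H1 using fun i => ih (pd i χ) (contDiff_pd hχ i) (hsp i)
    have hDi : ∀ i, K1 i ≤ ∑ j, K1 j := fun i =>
      Finset.single_le_sum (fun j _ => hK1 j) (Finset.mem_univ i)
    have hS : 0 ≤ ∑ j, K1 j := Finset.sum_nonneg fun j _ => hK1 j
    refine ⟨A + K0 + (∑ j, K1 j) * (n + 2), by positivity, fun s hs hc C f hC hf => ?_⟩
    have hev : ∀ x : Pt n, ¬ ‖x‖ < 2 → ∀ᶠ y in nhds x, χ y = 0 := by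
      intro x hx
      have : ∀ᶠ y in nhds x, 3 / 2 < ‖y‖ :=
        continuous_norm.continuousAt.eventually_const_lt (by linarith)
      exact this.mono fun y hy => hz hsupp hy
    have hdχ : Differentiable ℝ χ := hχ.differentiable (by simp)
    refine ⟨fun x hx => ?_, fun x hx => ?_, fun i => ?_⟩
    · by_cases hx2 : ‖x‖ < 2
      · rw [abs_mul]
        refine (mul_le_mul (hAχ.1 x trivial) (hf.1 x ⟨hx, by simpa using hx2⟩)
          (abs_nonneg _) hA).trans ?_
        refine mul_le_mul_of_nonneg_right ?_ hC
        have : 0 ≤ (∑ j, K1 j) * (n + 2) := by positivity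
        linarith
      · beta_reduce
        rw [hz hsupp (x := x) (by linarith)]; simp; positivity
    · by_cases hx2 : ‖x‖ < 2
      · exact (hdχ x).mul (hf.2.1 x ⟨hx, by simpa using hx2⟩)
      · have : (fun y => χ y * f y) =ᶠ[nhds x] fun _ => 0 :=
          (hev x hx2).mono fun y hy => by simp [hy]
        exact this.differentiableAt_iff.mpr (differentiableAt_const _)
    · have hop := hs.inter (Metric.isOpen_ball (x := (0 : Pt n)) (ε := 2))
      have hcv := hc.inter (convex_ball (0 : Pt n) 2)
      have e1 := H1 i s hs hc _ f (by positivity) (hf.of_succ hα hcv hC)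
      have e2 := H0 s hs hc C (pd i f) hC (hf.2.2 i)
      refine ((e1.add e2 hs).mono_const ?_).congr hs fun x hx => ?_
      · have h6 : K1 i * ((n + 2) * C) ≤ (∑ j, K1 j) * ((n + 2) * C) :=
          mul_le_mul_of_nonneg_right (hDi i) (by positivity)
        have h7 : 0 ≤ A * C := by positivity
        nlinarith
      · by_cases hx2 : ‖x‖ < 2
        · exact pd_mul i (hdχ x) (hf.2.1 x ⟨hx, by simpa using hx2⟩)
        · have : (fun y => χ y * f y) =ᶠ[nhds x] fun _ => 0 :=
            (hev x hx2).mono fun y hy => by simp [hy]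
          have h0 : χ =ᶠ[nhds x] fun _ => 0 := hev x hx2
          change pd i (fun y => χ y * f y) x = pd i χ x * f x + χ x * pd i f x
          rw [pd_congr i this, pd_const, pd_congr i h0, pd_const, (hev x hx2).self_of_nhds]
          simp

lemma HolderBdd.tsum {n : ℕ} {α : ℝ} {m : ℕ} {s : Set (Pt n)} (hs : IsOpen s)
    (hc : Convex ℝ s) {F : ℕ → Pt n → ℝ} {u : ℕ → ℝ} (hu : Summable u) (hu0 : ∀ j, 0 ≤ u j)
    (h : ∀ j, HolderBdd α m (u j) s (F j)) :
    HolderBdd α m (∑' j, u j) s (fun x => ∑' j, F j x) := by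
  have hsum : ∀ {m : ℕ} {F : ℕ → Pt n → ℝ} (_ : ∀ j, HolderBdd α m (u j) s (F j)),
      ∀ x ∈ s, Summable fun j => F j x := fun h x hx =>
    Summable.of_norm_bounded hu fun j => (h j).bound x hx
  have hbd : ∀ {m : ℕ} {F : ℕ → Pt n → ℝ} (_ : ∀ j, HolderBdd α m (u j) s (F j)),
      ∀ x ∈ s, |∑' j, F j x| ≤ ∑' j, u j := fun {m F} h x hx => by
    rw [← Real.norm_eq_abs]
    exact tsum_of_norm_bounded hu.hasSum fun j => (h j).bound x hx
  induction m generalizing F with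
  | zero =>
    refine ⟨hbd h, fun x hx y hy => ?_⟩
    beta_reduce
    rw [← (hsum h x hx).tsum_sub (hsum h y hy), ← tsum_mul_right,
      ← Real.norm_eq_abs]
    exact tsum_of_norm_bounded (hu.mul_right _).hasSum fun j => (h j).2 x hx y hy
  | succ m ih =>
    rcases s.eq_empty_or_nonempty with rfl | ⟨x₀, hx₀⟩
    · have : ∀ (m : ℕ) (C : ℝ) (f : Pt n → ℝ), HolderBdd α m C ∅ f := by
        intro m
        induction m with
        | zero => intro C f; simp [HolderBdd]
        | succ m ih => intro C f; simp [HolderBdd, ih]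
      exact this _ _ _
    have hder : ∀ x ∈ s, HasFDerivAt (fun y => ∑' j, F j y) (∑' j, fderiv ℝ (F j) x) x := by
      intro x hx
      exact hasFDerivAt_tsum_of_isPreconnected (u := fun j => n * u j) (hu.mul_left _) hs
        hc.isPreconnected (fun j y hy => ((h j).2.1 y hy).hasFDerivAt)
        (fun j y hy => norm_fderiv_le_of_pd (fun i => (h j).pd_bound i y hy) (hu0 j)) hx₀
        (hsum h x₀ hx₀) hx
    refine ⟨hbd h, fun x hx => (hder x hx).differentiableAt, fun i => ?_⟩
    refine (ih fun j => (h j).2.2 i).congr hs fun x hx => ?_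
    change fderiv ℝ _ x _ = _
    rw [(hder x hx).fderiv]
    have hsm : Summable fun j => fderiv ℝ (F j) x :=
      Summable.of_norm_bounded (hu.mul_left (n : ℝ)) fun j =>
        norm_fderiv_le_of_pd (fun i => (h j).pd_bound i x hx) (hu0 j)
    exact (ContinuousLinearMap.apply ℝ ℝ (Pi.single i (1 : ℝ) : Pt n)).map_tsum hsm

/-! ### A compactly supported kernel adapted to the Laplacian -/

/-- Reflection in the hyperplane `x ν = 0`. -/
def reflect {n : ℕ} (ν : Fin n) (x : Pt n) : Pt n := Function.update x ν (-x ν)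

lemma reflect_self {n : ℕ} (ν : Fin n) (x : Pt n) : reflect ν x ν = -x ν := by simp [reflect]

lemma reflect_of_ne {n : ℕ} {ν i : Fin n} (h : i ≠ ν) (x : Pt n) : reflect ν x i = x i := by
  simp [reflect, h]

lemma reflect_reflect {n : ℕ} (ν : Fin n) (x : Pt n) : reflect ν (reflect ν x) = x := by
  ext i
  by_cases h : i = ν
  · subst h; simp [reflect_self]
  · simp [reflect_of_ne h]

lemma exists_laplace_kernel {n : ℕ} (ν : Fin n) : ∃ η φ : Pt n → ℝ,
    ContDiff ℝ (⊤ : ℕ∞) η ∧ ContDiff ℝ (⊤ : ℕ∞) φ ∧ HasCompactSupport η ∧ HasCompactSupport φ ∧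
    (∀ i z, pd i η z = z i * φ z) ∧ (∀ z, η (reflect ν z) = η z) ∧ ∫ z, φ z = 1 := by
  set E : ℝ → ℝ := fun r => Real.smoothTransition (2 - r) with hE
  have hEs : ContDiff ℝ (⊤ : ℕ∞) E := Real.smoothTransition.contDiff.comp (by fun_prop)
  have hEd : Differentiable ℝ E := hEs.differentiable (by simp)
  have hE's : ContDiff ℝ (⊤ : ℕ∞) (deriv E) := by
    have := contDiff_infty_iff_deriv.mp hEs
    exact this.2
  have hanti : Antitone E := fun a b h => Real.smoothTransition.monotone (by linarith)
  have hE' : ∀ r, deriv E r ≤ 0 := fun r => hanti.deriv_nonpos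
  set q : Pt n → ℝ := fun z => ∑ i, z i ^ 2 with hq
  have hqs : ContDiff ℝ (⊤ : ℕ∞) q := by
    refine ContDiff.sum fun i _ => ContDiff.pow ?_ 2
    exact contDiff_apply ℝ ℝ i
  have hq2 : ∀ z : Pt n, z ∉ Metric.closedBall (0 : Pt n) 2 → 2 < q z := by
    intro z hz
    rw [mem_closedBall_zero_iff, pi_norm_le_iff_of_nonneg (by norm_num)] at hz
    push Not at hz
    obtain ⟨i, hi⟩ := hz
    have h1 : z i ^ 2 ≤ q z := Finset.single_le_sum (f := fun j => z j ^ 2)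
      (fun j _ => sq_nonneg _) (Finset.mem_univ i)
    rw [Real.norm_eq_abs] at hi
    nlinarith [sq_abs (z i)]
  have hE0 : ∀ r, 2 < r → E r = 0 := fun r hr =>
    Real.smoothTransition.zero_of_nonpos (by linarith)
  have hE'0 : ∀ r, 2 < r → deriv E r = 0 := fun r hr => by
    have : E =ᶠ[nhds r] fun _ => 0 := by
      filter_upwards [lt_mem_nhds hr] with t ht using hE0 t ht
    rw [this.deriv_eq]; simp
  set η : Pt n → ℝ := fun z => E (q z)
  set φ : Pt n → ℝ := fun z => 2 * deriv E (q z) with hφ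
  have hηs : ContDiff ℝ (⊤ : ℕ∞) η := hEs.comp hqs
  have hφs : ContDiff ℝ (⊤ : ℕ∞) φ := contDiff_const.mul (hE's.comp hqs)
  have hηc : HasCompactSupport η := HasCompactSupport.intro (isCompact_closedBall (0 : Pt n) 2)
    fun z hz => hE0 _ (hq2 z hz)
  have hφc : HasCompactSupport φ := HasCompactSupport.intro (isCompact_closedBall (0 : Pt n) 2)
    fun z hz => by simp [hφ, hE'0 _ (hq2 z hz)]
  have hpd : ∀ i z, pd i η z = z i * φ z := by
    intro i z
    have h1 : HasFDerivAt q (∑ j, (2 * z j) • ContinuousLinearMap.proj (R := ℝ)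
        (φ := fun _ : Fin n => ℝ) j) z := by
      refine HasFDerivAt.fun_sum fun j _ => ?_
      have := ((ContinuousLinearMap.proj (R := ℝ) (φ := fun _ : Fin n => ℝ) j).hasFDerivAt
        (x := z)).pow 2
      simpa using this
    have h2 := (hEd (q z)).hasDerivAt.comp_hasFDerivAt z h1
    change fderiv ℝ (E ∘ q) z _ = _
    rw [h2.fderiv]
    simp [Pi.single_apply, hφ]; ring
  have heven : ∀ z, η (reflect ν z) = η z := by
    intro z
    have : q (reflect ν z) = q z := by
      refine Finset.sum_congr rfl fun i _ => ?_
      by_cases h : i = ν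
      · subst h; rw [reflect_self]; ring
      · rw [reflect_of_ne h]
    change E _ = E _
    rw [this]
  have hne : ∫ z, φ z ≠ 0 := by
    obtain ⟨r, hr, hr'⟩ := exists_deriv_eq_slope E (a := 0) (b := 3) (by norm_num)
      hEs.continuous.continuousOn hEd.differentiableOn
    have h0 : E 0 = 1 := Real.smoothTransition.one_of_one_le (by norm_num)
    rw [h0, hE0 3 (by norm_num)] at hr'
    have hz : q (Pi.single ν (Real.sqrt r)) = r := by
      simp only [hq]
      rw [Finset.sum_eq_single ν]
      · simp [Real.sq_sqrt hr.1.le]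
      · intro j _ hj; simp [hj]
      · simp
    have hpos : 0 < ∫ z, -φ z := by
      refine hφs.continuous.neg.integral_pos_of_hasCompactSupport_nonneg_nonzero (x :=
        Pi.single ν (Real.sqrt r)) hφc.neg (fun z => ?_) ?_
      · have := hE' (q z)
        simp only [hφ, Pi.zero_apply]; linarith
      · simp only [hφ, hz, hr']; norm_num
    rw [MeasureTheory.integral_neg] at hpos
    exact fun h => by rw [h] at hpos; simp at hpos
  set c := (∫ z, φ z)⁻¹
  refine ⟨fun z => c * η z, fun z => c * φ z, contDiff_const.mul hηs, contDiff_const.mul hφs,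
    hηc.mul_left, hφc.mul_left, fun i z => ?_, fun z => by beta_reduce; rw [heven], ?_⟩
  · rw [pd_const_mul i c (hηs.differentiable (by simp) z), hpd]; ring
  · rw [MeasureTheory.integral_const_mul]; exact inv_mul_cancel₀ hne

/-! ### Averaging operators -/

open MeasureTheory in
/-- The average of `F` around `x` at scale `s` with weight `ψ`. -/
def avg {n : ℕ} (ψ : Pt n → ℝ) (s : ℝ) (F : Pt n → ℝ) (x : Pt n) : ℝ :=
  ∫ z, ψ z * F (x - s • z)

/-- Smooth compactly supported weights. -/
structure IsWeight {n : ℕ} (ψ : Pt n → ℝ) : Prop where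
  smooth : ContDiff ℝ (⊤ : ℕ∞) ψ
  supp : HasCompactSupport ψ

/-- Bounded measurable functions. -/
structure BddMeas {n : ℕ} (M : ℝ) (F : Pt n → ℝ) : Prop where
  meas : Measurable F
  bound : ∀ x, |F x| ≤ M

section Averages

open MeasureTheory

variable {n : ℕ} {ψ θ : Pt n → ℝ} {F : Pt n → ℝ} {M C s α : ℝ}

lemma IsWeight.pd_weight (h : IsWeight ψ) (i : Fin n) : IsWeight (pd i ψ) :=
  ⟨contDiff_pd h.smooth i, hasCompactSupport_pd h.supp i⟩

lemma IsWeight.integrable (h : IsWeight ψ) : Integrable ψ :=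
  h.smooth.continuous.integrable_of_hasCompactSupport h.supp

lemma IsWeight.differentiable (h : IsWeight ψ) : Differentiable ℝ ψ :=
  h.smooth.differentiable (by simp)

lemma IsWeight.integrable_mul (h : IsWeight ψ) {G : Pt n → ℝ} (hG : BddMeas M G) :
    Integrable (fun z => ψ z * G z) :=
  h.integrable.mul_bdd (c := M) hG.meas.aestronglyMeasurable
    (Filter.Eventually.of_forall hG.bound)

lemma BddMeas.comp (h : BddMeas M F) {e : Pt n → Pt n} (he : Measurable e) :
    BddMeas M (fun z => F (e z)) := ⟨h.meas.comp he, fun _ => h.bound _⟩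

lemma BddMeas.nonneg (h : BddMeas M F) : 0 ≤ M := (abs_nonneg _).trans (h.bound 0)

lemma abs_avg_le (hψ : IsWeight ψ) (hF : BddMeas M F) (s : ℝ) (x : Pt n) :
    |avg ψ s F x| ≤ (∫ z, |ψ z|) * M := by
  rw [avg, ← integral_mul_const]
  refine norm_integral_le_of_norm_le (μ := volume) (f := fun z => ψ z * F (x - s • z))
    (hψ.integrable.abs.mul_const M)
    (Filter.Eventually.of_forall fun z => ?_)
  rw [Real.norm_eq_abs, abs_mul]
  exact mul_le_mul_of_nonneg_left (hF.bound _) (abs_nonneg _)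

lemma avg_eq (hs : 0 < s) (x : Pt n) :
    avg ψ s F x = s⁻¹ ^ n * ∫ y, ψ (s⁻¹ • (x - y)) * F y := by
  have h1 : ∫ y, ψ (s⁻¹ • (x - y)) * F y = ∫ y, ψ (s⁻¹ • y) * F (x - y) := by
    rw [← integral_sub_left_eq_self (fun y => ψ (s⁻¹ • y) * F (x - y)) volume x]
    simp
  have h2 : ∫ y, ψ (s⁻¹ • y) * F (x - y) =
      ∫ y, (fun z => ψ z * F (x - s • z)) (s⁻¹ • y) := by
    refine integral_congr_ae (Filter.Eventually.of_forall fun y => ?_)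
    simp [smul_smul, hs.ne']
  rw [h1, h2, Measure.integral_comp_smul volume (fun z => ψ z * F (x - s • z)), avg]
  have : |(s⁻¹ ^ n)⁻¹| = s ^ n := by rw [inv_pow, inv_inv, abs_of_pos (by positivity)]
  rw [Module.finrank_pi, Fintype.card_fin, this, smul_eq_mul, ← mul_assoc, inv_pow,
    inv_mul_cancel₀ (by positivity), one_mul]

lemma hasFDerivAt_weight_integral (hψ : IsWeight ψ) (hF : BddMeas M F) (x₀ : Pt n) {σ₀ : ℝ}
    (hσ : 0 < σ₀) : ∃ D : (Pt n × ℝ) →L[ℝ] ℝ,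
      HasFDerivAt (fun p : Pt n × ℝ => ∫ y, ψ (p.2 • (p.1 - y)) * F y) D (x₀, σ₀) ∧
      ∀ v, D v = ∫ y, fderiv ℝ ψ (σ₀ • (x₀ - y)) (σ₀ • v.1 + v.2 • (x₀ - y)) * F y := by
  obtain ⟨R, hR⟩ : ∃ R, ∀ z, R < ‖z‖ → fderiv ℝ ψ z = 0 := by
    obtain ⟨R, hR⟩ := (hψ.supp.fderiv (𝕜 := ℝ)).isBounded.subset_closedBall (0 : Pt n)
    refine ⟨R, fun z hz => ?_⟩
    by_contra h
    have := hR (subset_tsupport _ h)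
    rw [mem_closedBall_zero_iff] at this
    linarith
  obtain ⟨B, hB⟩ := (hψ.supp.fderiv (𝕜 := ℝ)).exists_bound_of_continuous
    (hψ.smooth.continuous_fderiv (by simp))
  have hB0 : 0 ≤ B := (norm_nonneg _).trans (hB 0)
  have hM := hF.nonneg
  set G : Pt n × ℝ → Pt n → ℝ := fun p y => ψ (p.2 • (p.1 - y)) * F y with hG
  set L : Pt n × ℝ → Pt n → (Pt n × ℝ) →L[ℝ] Pt n := fun p y =>
    p.2 • ContinuousLinearMap.fst ℝ (Pt n) ℝ +
      (ContinuousLinearMap.snd ℝ (Pt n) ℝ).smulRight (p.1 - y) with hL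
  set G' : Pt n × ℝ → Pt n → (Pt n × ℝ) →L[ℝ] ℝ := fun p y =>
    F y • (fderiv ℝ ψ (p.2 • (p.1 - y))).comp (L p y) with hG'
  have hdiff : ∀ p y, HasFDerivAt (fun p => G p y) (G' p y) p := by
    intro p y
    have h1 : HasFDerivAt (fun p : Pt n × ℝ => p.2 • (p.1 - y)) (L p y) p := by
      have := (hasFDerivAt_snd (𝕜 := ℝ) (E := Pt n) (F := ℝ) (p := p)).smul
        ((hasFDerivAt_fst (𝕜 := ℝ) (E := Pt n) (F := ℝ) (p := p)).sub_const y)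
      exact this
    have h2 := ((hψ.differentiable _).hasFDerivAt.comp p h1).mul_const (F y)
    exact h2
  have hLn : ∀ p y, ‖L p y‖ ≤ |p.2| + ‖p.1 - y‖ := by
    intro p y
    refine (norm_add_le _ _).trans (add_le_add ?_ ?_)
    · rw [norm_smul]
      exact mul_le_of_le_one_right (norm_nonneg _) (ContinuousLinearMap.norm_fst_le ℝ (Pt n) ℝ)
    · rw [ContinuousLinearMap.norm_smulRight_apply]
      exact mul_le_of_le_one_left (norm_nonneg _) (ContinuousLinearMap.norm_snd_le ℝ (Pt n) ℝ)
  set Q := 2 * |R| / σ₀ with hQ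
  have hQ0 : 0 ≤ Q := by positivity
  set bd : Pt n → ℝ := (Metric.closedBall x₀ (Q + σ₀)).indicator
    (fun _ => M * (B * (2 * σ₀ + Q))) with hbd
  have hbound : ∀ y, ∀ p ∈ Metric.ball ((x₀, σ₀) : Pt n × ℝ) (σ₀ / 2), ‖G' p y‖ ≤ bd y := by
    intro y p hp
    rw [Metric.mem_ball, Prod.dist_eq, max_lt_iff, Real.dist_eq, abs_lt, dist_eq_norm] at hp
    obtain ⟨hp1, hp2, hp3⟩ := hp
    simp only at hp1 hp2 hp3
    have hpos : σ₀ / 2 < p.2 := by linarith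
    have hbd0 : 0 ≤ bd y := indicator_nonneg (fun _ _ => by positivity) y
    by_cases hz : R < ‖p.2 • (p.1 - y)‖
    · simp only [hG', hR _ hz]; simpa using hbd0
    · rw [norm_smul, Real.norm_eq_abs, abs_of_pos (by linarith)] at hz
      have h3 : ‖p.1 - y‖ ≤ Q := by
        rw [hQ, le_div_iff₀ hσ]
        have := le_abs_self R
        nlinarith [norm_nonneg (p.1 - y)]
      have hy : y ∈ Metric.closedBall x₀ (Q + σ₀) := by
        rw [mem_closedBall_iff_norm']
        calc ‖x₀ - y‖ = ‖(p.1 - y) - (p.1 - x₀)‖ := by congr 1; abel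
          _ ≤ _ := (norm_sub_le _ _).trans (by linarith)
      simp only [hbd, indicator_of_mem hy, hG', norm_smul]
      refine mul_le_mul (hF.bound y) ?_ (norm_nonneg _) hM
      refine (ContinuousLinearMap.opNorm_comp_le _ _).trans
        (mul_le_mul (hB _) ((hLn p y).trans ?_) (norm_nonneg _) hB0)
      rw [abs_of_pos (by linarith)]; linarith
  have hmeas : ∀ p, AEStronglyMeasurable (G p) volume := by
    intro p
    refine Measurable.aestronglyMeasurable ?_
    exact (hψ.smooth.continuous.measurable.comp (by fun_prop)).mul hF.meas
  have h_int : Integrable (G (x₀, σ₀)) := by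
    have := hψ.integrable_mul (hF.comp (e := fun z => x₀ - σ₀⁻¹ • z) (by fun_prop))
    have h2 := (this.comp_smul hσ.ne').comp_sub_left x₀
    refine h2.congr (Filter.Eventually.of_forall fun y => ?_)
    simp [hG, smul_smul, hσ.ne']
  have hmeas' : AEStronglyMeasurable (G' (x₀, σ₀)) volume := by
    refine hF.meas.aestronglyMeasurable.smul (Continuous.aestronglyMeasurable ?_)
    have : Continuous (fderiv ℝ ψ) := hψ.smooth.continuous_fderiv (by simp)
    refine Continuous.clm_comp (this.comp (by fun_prop)) ?_
    simp only [hL]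
    refine continuous_const.add ?_
    exact ((ContinuousLinearMap.smulRightL ℝ (Pt n × ℝ) (Pt n)
      (ContinuousLinearMap.snd ℝ (Pt n) ℝ)).continuous.comp (by fun_prop :
        Continuous fun y : Pt n => x₀ - y))
  have hbi : Integrable bd := by
    refine (integrable_indicator_iff Metric.isClosed_closedBall.measurableSet).mpr ?_
    exact integrableOn_const (isCompact_closedBall _ _).measure_lt_top.ne
  have main := hasFDerivAt_integral_of_dominated_of_fderiv_le (𝕜 := ℝ) (μ := volume)
    (F := G) (F' := G') (x₀ := (x₀, σ₀)) (s := Metric.ball (x₀, σ₀) (σ₀ / 2)) (bound := bd)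
    (Metric.ball_mem_nhds _ (by positivity)) (Filter.Eventually.of_forall hmeas) h_int hmeas'
    (Filter.Eventually.of_forall hbound) hbi
    (Filter.Eventually.of_forall fun y p _ => hdiff p y)
  refine ⟨_, main, fun v => ?_⟩
  have hG'i : Integrable (G' (x₀, σ₀)) :=
    Integrable.mono' hbi hmeas' (Filter.Eventually.of_forall fun y =>
      hbound y _ (Metric.mem_ball_self (by positivity)))
  rw [ContinuousLinearMap.integral_apply hG'i]
  refine integral_congr_ae (Filter.Eventually.of_forall fun y => ?_)
  simp [hG', hL, mul_comm]; ring

lemma avg_differentiableAt (hψ : IsWeight ψ) (hF : BddMeas M F) (hs : 0 < s) (x : Pt n) :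
    DifferentiableAt ℝ (avg ψ s F) x ∧ ∀ i, pd i (avg ψ s F) x = s⁻¹ * avg (pd i ψ) s F x := by
  obtain ⟨D, hD, hD'⟩ := hasFDerivAt_weight_integral hψ hF x (inv_pos.mpr hs)
  have h1 : HasFDerivAt (fun x : Pt n => ((x, s⁻¹) : Pt n × ℝ))
      (ContinuousLinearMap.inl ℝ (Pt n) ℝ) x := hasFDerivAt_prodMk_left x s⁻¹
  have h2 := (hD.comp x h1).const_mul (s⁻¹ ^ n)
  have h3 : HasFDerivAt (avg ψ s F) _ x :=
    h2.congr_of_eventuallyEq (Filter.Eventually.of_forall fun y => avg_eq hs y)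
  refine ⟨h3.differentiableAt, fun i => ?_⟩
  rw [avg_eq hs, pd, h3.fderiv]
  simp only [FunLike.coe_smul, Pi.smul_apply, ContinuousLinearMap.coe_comp,
    Function.comp_apply, hD', smul_eq_mul, ContinuousLinearMap.inl_apply, zero_smul, add_zero,
    map_smul]
  rw [mul_left_comm, ← integral_const_mul s⁻¹]
  simp only [mul_assoc]; rfl

lemma avg_hasDerivAt (hψ : IsWeight ψ) (hF : BddMeas M F) (hs : 0 < s) (x : Pt n) :
    HasDerivAt (fun t => avg ψ t F x)
      (-s⁻¹ * avg (fun z => n * ψ z + ∑ i, z i * pd i ψ z) s F x) s := by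
  obtain ⟨D, hD, hD'⟩ := hasFDerivAt_weight_integral hψ hF x (inv_pos.mpr hs)
  have h1 : HasDerivAt (fun t : ℝ => ((x, t⁻¹) : Pt n × ℝ)) (0, -(s ^ 2)⁻¹) s :=
    (hasDerivAt_const s x).prodMk (hasDerivAt_inv hs.ne')
  have h2 := ((hasDerivAt_inv hs.ne').fun_pow n).fun_mul (hD.comp_hasDerivAt s h1)
  have h3 : HasDerivAt (fun t => avg ψ t F x) _ s := h2.congr_of_eventuallyEq
    (by filter_upwards [lt_mem_nhds hs] with t ht; exact avg_eq ht x)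
  convert h3 using 1
  rw [avg_eq hs, hD']
  simp only [Function.comp_apply, smul_zero, zero_add, map_smul, smul_eq_mul]
  have hi0 : ∀ {ψ : Pt n → ℝ}, Continuous ψ → HasCompactSupport ψ →
      Integrable fun y => ψ (s⁻¹ • (x - y)) * F y := by
    intro ψ hc hψ
    have h4 := (hc.integrable_of_hasCompactSupport (μ := volume) hψ).mul_bdd (c := M)
      (hF.comp (e := fun z => x - s • z) (by fun_prop)).meas.aestronglyMeasurable
      (Filter.Eventually.of_forall fun z => hF.bound (x - s • z))
    refine ((h4.comp_smul (inv_pos.mpr hs).ne').comp_sub_left x).congr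
      (Filter.Eventually.of_forall fun y => ?_)
    simp [smul_smul, hs.ne']
  have e1 : ∀ y, fderiv ℝ ψ (s⁻¹ • (x - y)) (x - y) = s * ∑ i, (s⁻¹ • (x - y)) i *
      pd i ψ (s⁻¹ • (x - y)) := by
    intro y
    rw [fderiv_apply_eq_sum_pd, Finset.mul_sum]
    refine Finset.sum_congr rfl fun i _ => ?_
    simp only [Pi.smul_apply, smul_eq_mul]; field_simp
  have hi1 := hi0 hψ.smooth.continuous hψ.supp
  have hi2 := hi0 (ψ := fun z => ∑ i, z i * pd i ψ z)
    (continuous_finsetSum _ fun i _ => (continuous_apply i).mul (hψ.pd_weight i).smooth.continuous)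
    (by
      have : (fun z => ∑ i, z i * pd i ψ z) = fun z => fderiv ℝ ψ z z := by
        ext z; rw [fderiv_apply_eq_sum_pd]
      rw [this]
      refine (hψ.supp.fderiv (𝕜 := ℝ)).mono fun z hz => ?_
      contrapose! hz
      simp only [Function.mem_support, not_not] at hz ⊢
      rw [hz]; simp)
  simp only [e1]
  have e2 : ∫ y, ((n : ℝ) * ψ (s⁻¹ • (x - y)) + ∑ i, (s⁻¹ • (x - y)) i *
      pd i ψ (s⁻¹ • (x - y))) * F y = n * (∫ y, ψ (s⁻¹ • (x - y)) * F y) +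
        ∫ y, (∑ i, (s⁻¹ • (x - y)) i * pd i ψ (s⁻¹ • (x - y))) * F y := by
    rw [← integral_const_mul, ← integral_add (hi1.const_mul _) hi2]
    refine integral_congr_ae (Filter.Eventually.of_forall fun y => ?_)
    simp only; ring
  have e3 : ∫ y, -(s ^ 2)⁻¹ * (s * ∑ i, (s⁻¹ • (x - y)) i * pd i ψ (s⁻¹ • (x - y))) * F y =
      -s⁻¹ * ∫ y, (∑ i, (s⁻¹ • (x - y)) i * pd i ψ (s⁻¹ • (x - y))) * F y := by
    rw [← integral_const_mul]
    refine integral_congr_ae (Filter.Eventually.of_forall fun y => ?_)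
    simp only; field_simp
  rw [e2, e3]
  rcases n with _ | n
  · simp
  · push_cast; simp only [pow_succ]; field_simp; ring

end Averages

section AverageEstimates

open MeasureTheory

variable {n : ℕ} {ψ θ : Pt n → ℝ} {F : Pt n → ℝ} {M C s α : ℝ}

/-- The absolute moment of order `α` of a weight. -/
def moment {n : ℕ} (α : ℝ) (ψ : Pt n → ℝ) : ℝ := ∫ z, |ψ z| * ‖z‖ ^ α

lemma moment_nonneg (α : ℝ) (ψ : Pt n → ℝ) : 0 ≤ moment α ψ :=
  integral_nonneg fun _ => by positivity

lemma IsWeight.integrable_moment (h : IsWeight ψ) (hα : 0 ≤ α) :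
    Integrable fun z => |ψ z| * ‖z‖ ^ α := by
  refine Continuous.integrable_of_hasCompactSupport ?_ ?_
  · exact h.smooth.continuous.abs.mul (continuous_norm.rpow_const fun _ => Or.inr hα)
  · exact (h.supp.comp_left (g := fun t : ℝ => |t|) abs_zero).mul_right

lemma avg_pd_eq_zero (hψ : IsWeight ψ) (hF : BddMeas M F) (hs : 0 < s) (i : Fin n)
    (h : ∀ z t, F (z + Pi.single i t) = F z) (x : Pt n) : avg (pd i ψ) s F x = 0 := by
  obtain ⟨h1, h2⟩ := avg_differentiableAt hψ hF hs x
  have h3 : HasDerivAt (fun t : ℝ => avg ψ s F (x + t • Pi.single i 1)) (pd i (avg ψ s F) x) 0 := by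
    have h4 : HasDerivAt (fun t : ℝ => x + t • (Pi.single i (1 : ℝ) : Pt n)) (Pi.single i 1) 0 := by
      simpa using ((hasDerivAt_id (0 : ℝ)).smul_const (Pi.single i (1 : ℝ) : Pt n)).const_add x
    have h5 : HasFDerivAt (avg ψ s F) (fderiv ℝ (avg ψ s F) x)
      (x + (0 : ℝ) • (Pi.single i (1 : ℝ) : Pt n)) := by simpa using h1.hasFDerivAt
    exact h5.comp_hasDerivAt (0 : ℝ) h4
  have h6 : (fun t : ℝ => avg ψ s F (x + t • Pi.single i 1)) = fun _ => avg ψ s F x := by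
    ext t
    refine integral_congr_ae (Filter.Eventually.of_forall fun z => ?_)
    have : x + t • Pi.single i 1 - s • z = (x - s • z) + Pi.single i t := by
      rw [← Pi.single_smul]; simp; abel
    simp only [this, h]
  rw [h6] at h3
  have h7 := h3.unique (hasDerivAt_const (0 : ℝ) (avg ψ s F x))
  rw [h2 i] at h7
  exact (mul_eq_zero.mp h7).resolve_left (inv_pos.mpr hs).ne'

lemma IsWeight.integral_pd (hψ : IsWeight ψ) (i : Fin n) : ∫ z, pd i ψ z = 0 := by
  have := avg_pd_eq_zero (F := fun _ => (1 : ℝ)) (M := 1) hψ ⟨measurable_const, by simp⟩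
    one_pos i (fun _ _ => rfl) 0
  simpa [avg] using this

lemma abs_avg_pd_le_of_dir (hθ : IsWeight θ) (hF : BddMeas M F) (hs : 0 < s) (i : Fin n)
    (hα : 0 ≤ α) (h : ∀ x t, |F (x + Pi.single i t) - F x| ≤ C * |t| ^ α) (x : Pt n) :
    |avg (pd i θ) s F x| ≤ moment α (pd i θ) * C * s ^ α := by
  have hC : 0 ≤ C := by simpa using (abs_nonneg _).trans (h 0 1)
  set G : Pt n → ℝ := fun y => F (Function.update y i (x i)) with hG
  have hu : Measurable fun y : Pt n => Function.update y i (x i) :=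
    measurable_update_left
  have hGb : BddMeas M G := hF.comp hu
  have h0 : avg (pd i θ) s G x = 0 := avg_pd_eq_zero hθ hGb hs i (fun z t => by
    simp only [hG]
    congr 1
    ext j
    by_cases hj : j = i
    · subst hj; simp
    · simp [hj]) x
  have e : avg (pd i θ) s F x =
      ∫ z, pd i θ z * (F (x - s • z) - G (x - s • z)) := by
    have h1 := (hθ.pd_weight i).integrable_mul (hF.comp (e := fun z => x - s • z) (by fun_prop))
    have h2 := (hθ.pd_weight i).integrable_mul (hGb.comp (e := fun z => x - s • z) (by fun_prop))
    rw [← sub_zero (avg (pd i θ) s F x), ← h0, avg, avg, ← integral_sub h1 h2]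
    refine integral_congr_ae (Filter.Eventually.of_forall fun z => ?_)
    simp only; ring
  rw [e, moment, mul_assoc, ← integral_mul_const]
  rw [← Real.norm_eq_abs]
  refine norm_integral_le_of_norm_le (μ := volume)
    (((hθ.pd_weight i).integrable_moment hα).mul_const _) (Filter.Eventually.of_forall fun z => ?_)
  rw [Real.norm_eq_abs, abs_mul, mul_assoc]
  refine mul_le_mul_of_nonneg_left ?_ (abs_nonneg _)
  have h3 : F (x - s • z) =
      F (Function.update (x - s • z) i (x i) + (Pi.single i (-(s * z i)) : Pt n)) := by
    congr 1
    ext j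
    by_cases hj : j = i
    · subst hj; simp; ring
    · simp [hj]
  rw [h3, hG]
  refine (h _ _).trans ?_
  rw [abs_neg, abs_mul, abs_of_pos hs, Real.mul_rpow hs.le (abs_nonneg _), ← mul_assoc,
    mul_comm (‖z‖ ^ α)]
  exact mul_le_mul_of_nonneg_left
    (Real.rpow_le_rpow (abs_nonneg _) (norm_le_pi_norm z i) hα) (by positivity)

lemma abs_avg_sub_le (hψ : IsWeight ψ) (hF : BddMeas M F) (hs : 0 < s) (hα : 0 ≤ α) {x : Pt n}
    (h : ∀ w, |F (x + w) - F x| ≤ C * ‖w‖ ^ α) :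
    |avg ψ s F x - (∫ z, ψ z) * F x| ≤ moment α ψ * C * s ^ α := by
  have h1 := hψ.integrable_mul (hF.comp (e := fun z => x - s • z) (by fun_prop))
  rw [avg, ← integral_mul_const, ← integral_sub h1 (hψ.integrable.mul_const _), moment, mul_assoc,
    ← integral_mul_const]
  rw [← Real.norm_eq_abs]
  refine norm_integral_le_of_norm_le (μ := volume)
    ((hψ.integrable_moment hα).mul_const _) (Filter.Eventually.of_forall fun z => ?_)
  rw [Real.norm_eq_abs, ← mul_sub, abs_mul, mul_assoc]
  refine mul_le_mul_of_nonneg_left ?_ (abs_nonneg _)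
  have := h (-(s • z))
  rw [← sub_eq_add_neg, norm_neg, norm_smul, Real.norm_eq_abs, abs_of_pos hs,
    Real.mul_rpow hs.le (norm_nonneg _)] at this
  linarith

lemma measurable_avg (hψ : IsWeight ψ) (hF : BddMeas M F) (x : Pt n) :
    Measurable fun s => avg ψ s F x := by
  have : StronglyMeasurable (Function.uncurry fun (s : ℝ) (z : Pt n) => ψ z * F (x - s • z)) := by
    refine Measurable.stronglyMeasurable ?_
    exact (hψ.smooth.continuous.measurable.comp measurable_snd).mul
      (hF.meas.comp (by fun_prop))
  exact this.integral_prod_right.measurable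

lemma DifferentiableAt.hasFDerivAt_sum_proj {f : Pt n → ℝ} {x : Pt n}
    (h : DifferentiableAt ℝ f x) :
    HasFDerivAt f (∑ j, pd j f x • ContinuousLinearMap.proj (R := ℝ)
        (φ := fun _ : Fin n => ℝ) j) x := by
  refine h.hasFDerivAt.congr_fderiv (ContinuousLinearMap.ext fun v => ?_)
  rw [fderiv_apply_eq_sum_pd]
  simp [mul_comm]

lemma pd_eq_of_hasFDerivAt_sum_proj {f : Pt n → ℝ} {x : Pt n} {c : Fin n → ℝ}
    (h : HasFDerivAt f (∑ j, c j • ContinuousLinearMap.proj (R := ℝ)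
        (φ := fun _ : Fin n => ℝ) j) x) (i : Fin n) : pd i f x = c i := by
  rw [pd, h.fderiv]; simp [Pi.single_apply]

/-- The weighted integral over scales `s ≤ S` of the averages of `F`. -/
def radial {n : ℕ} (w : ℝ → ℝ) (ψ : Pt n → ℝ) (S : ℝ) (F : Pt n → ℝ) (x : Pt n) : ℝ :=
  ∫ s in Ioc 0 S, w s * avg ψ s F x

lemma abs_radial_le {w b : ℝ → ℝ} {S : ℝ} {x : Pt n} (hb : IntegrableOn b (Ioc 0 S))
    (h : ∀ s ∈ Ioc 0 S, |w s * avg ψ s F x| ≤ b s) :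
    |radial w ψ S F x| ≤ ∫ s in Ioc 0 S, b s := by
  rw [← Real.norm_eq_abs]
  exact norm_integral_le_of_norm_le hb ((ae_restrict_iff' measurableSet_Ioc).mpr
    (Filter.Eventually.of_forall h))

lemma integrableOn_radial {w b : ℝ → ℝ} (hw : Measurable w) {S : ℝ} {x : Pt n}
    (hψ : IsWeight ψ) (hF : BddMeas M F) (hb : IntegrableOn b (Ioc 0 S))
    (h : ∀ s ∈ Ioc 0 S, |w s * avg ψ s F x| ≤ b s) :
    IntegrableOn (fun s => w s * avg ψ s F x) (Ioc 0 S) :=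
  Integrable.mono' hb (hw.mul (measurable_avg hψ hF x)).aestronglyMeasurable
    ((ae_restrict_iff' measurableSet_Ioc).mpr (Filter.Eventually.of_forall h))

lemma radial_differentiableAt {w b b' : ℝ → ℝ} (hw : Measurable w) {S : ℝ} {x₀ : Pt n}
    {U : Set (Pt n)} (hU : U ∈ nhds x₀) (hψ : IsWeight ψ) (hF : BddMeas M F)
    (hb : IntegrableOn b (Ioc 0 S)) (h : ∀ s ∈ Ioc 0 S, |w s * avg ψ s F x₀| ≤ b s)
    (hb' : IntegrableOn b' (Ioc 0 S))
    (h' : ∀ x ∈ U, ∀ j, ∀ s ∈ Ioc 0 S, |w s * s⁻¹ * avg (pd j ψ) s F x| ≤ b' s) :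
    DifferentiableAt ℝ (radial w ψ S F) x₀ ∧
      ∀ j, pd j (radial w ψ S F) x₀ = radial (fun s => w s * s⁻¹) (pd j ψ) S F x₀ := by
  set G' : Pt n → ℝ → Pt n →L[ℝ] ℝ := fun x s => ∑ j, (w s * s⁻¹ * avg (pd j ψ) s F x) •
    ContinuousLinearMap.proj (R := ℝ) (φ := fun _ : Fin n => ℝ) j with hG'
  have hx₀ : x₀ ∈ U := mem_of_mem_nhds hU
  have hmj : ∀ j, Measurable fun s => w s * s⁻¹ * avg (pd j ψ) s F x₀ := fun j =>
    (hw.mul measurable_inv).mul (measurable_avg (hψ.pd_weight j) hF x₀)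
  have hij : ∀ j, IntegrableOn (fun s => w s * s⁻¹ * avg (pd j ψ) s F x₀) (Ioc 0 S) := fun j =>
    integrableOn_radial (hw.mul measurable_inv) (hψ.pd_weight j) hF hb' (h' x₀ hx₀ j)
  have hproj : ∀ j : Fin n, ‖ContinuousLinearMap.proj (R := ℝ) (φ := fun _ : Fin n => ℝ) j‖ ≤ 1 :=
    fun j => ContinuousLinearMap.opNorm_le_bound _ zero_le_one fun v => by
      simpa using norm_le_pi_norm v j
  have main := hasFDerivAt_integral_of_dominated_of_fderiv_le (𝕜 := ℝ)
    (μ := volume.restrict (Ioc 0 S)) (F := fun x s => w s * avg ψ s F x) (F' := G') (x₀ := x₀)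
    (s := U) (bound := fun s => n * b' s) hU
    (Filter.Eventually.of_forall fun x => (hw.mul (measurable_avg hψ hF x)).aestronglyMeasurable)
    (integrableOn_radial hw hψ hF hb h)
    (by
      refine Measurable.aestronglyMeasurable ?_
      simp only [hG']
      refine Finset.measurable_fun_sum _ fun j _ => ?_
      exact (hmj j).smul_const _)
    ((ae_restrict_iff' measurableSet_Ioc).mpr (Filter.Eventually.of_forall fun s hs x hx => by
      refine (norm_sum_le _ _).trans ((Finset.sum_le_sum (g := fun _ => b' s) fun j _ => ?_).trans
        (by simp))
      rw [norm_smul]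
      have h0 := h' x hx j s hs
      exact (mul_le_mul h0 (hproj j) (norm_nonneg _) ((abs_nonneg _).trans h0)).trans
        (by simp)))
    (hb'.const_mul _)
    ((ae_restrict_iff' measurableSet_Ioc).mpr (Filter.Eventually.of_forall fun s hs x hx => by
      obtain ⟨h1, h2⟩ := avg_differentiableAt hψ hF hs.1 x
      have := h1.hasFDerivAt_sum_proj.const_mul (w s)
      refine this.congr_fderiv ?_
      simp only [hG', Finset.smul_sum, smul_smul, h2, mul_assoc]))
  have e : ∫ s in Ioc 0 S, G' x₀ s = ∑ j, (radial (fun s => w s * s⁻¹) (pd j ψ) S F x₀) •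
      ContinuousLinearMap.proj (R := ℝ) (φ := fun _ : Fin n => ℝ) j := by
    simp only [hG']
    rw [integral_finsetSum _ fun j _ => (hij j).smul_const _]
    refine Finset.sum_congr rfl fun j _ => ?_
    rw [integral_smul_const]; rfl
  rw [e] at main
  exact ⟨main.differentiableAt, fun j => pd_eq_of_hasFDerivAt_sum_proj main j⟩

lemma integrableOn_rpow_sub_one {γ : ℝ} (hγ : 0 < γ) (S : ℝ) (hS : 0 ≤ S) :
    IntegrableOn (fun s : ℝ => s ^ (γ - 1)) (Ioc 0 S) := by
  have := intervalIntegral.intervalIntegrable_rpow' (a := 0) (b := S) (r := γ - 1) (by linarith)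
  exact (intervalIntegrable_iff_integrableOn_Ioc_of_le hS).mp this

lemma integral_rpow_sub_one {γ : ℝ} (hγ : 0 < γ) (S : ℝ) (hS : 0 ≤ S) :
    ∫ s in Ioc 0 S, s ^ (γ - 1) = S ^ γ / γ := by
  rw [← intervalIntegral.integral_of_le hS, integral_rpow (Or.inl (by linarith))]
  simp [hγ.ne.symm]

/-- Hölder continuity of a scale integral from matching bounds on the averages and their
gradients. -/
lemma abs_radial_sub_le {w : ℝ → ℝ} (hw : Measurable w) {S B : ℝ} (hα : α ∈ Ioo (0 : ℝ) 1)
    (hψ : IsWeight ψ) (hF : BddMeas M F) (hB : 0 ≤ B) (hS : 0 ≤ S)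
    (h : ∀ x, ∀ s ∈ Ioc 0 S, |w s * avg ψ s F x| ≤ B * s ^ (α - 1))
    (h' : ∀ x, ∀ j, ∀ s ∈ Ioc 0 S, |w s * s⁻¹ * avg (pd j ψ) s F x| ≤ B * s ^ (α - 2))
    (x y : Pt n) : |radial w ψ S F x - radial w ψ S F y| ≤
      (2 / α + n / (1 - α)) * B * ‖x - y‖ ^ α := by
  have hα0 := hα.1
  have hα1 : 0 < 1 - α := by linarith [hα.2]
  rcases eq_or_ne x y with rfl | hxy
  · simp only [sub_self, abs_zero, norm_zero]; positivity
  set d := ‖x - y‖ with hd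
  have hd0 : 0 < d := norm_pos_iff.mpr (sub_ne_zero.mpr hxy)
  have hb := (integrableOn_rpow_sub_one hα0 S hS).const_mul B
  have hix := integrableOn_radial hw hψ hF hb (h x)
  have hiy := integrableOn_radial hw hψ hF hb (h y)
  set g : ℝ → ℝ := fun s => (Ioc 0 d).indicator (fun s => 2 * B * s ^ (α - 1)) s +
    (Ioi d).indicator (fun s => n * B * d * s ^ (α - 2)) s with hg
  have hg1 : Integrable ((Ioc 0 d).indicator (fun s => 2 * B * s ^ (α - 1))) :=
    (integrable_indicator_iff measurableSet_Ioc).mpr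
      ((integrableOn_rpow_sub_one hα0 d hd0.le).const_mul _)
  have hg2 : Integrable ((Ioi d).indicator (fun s => n * B * d * s ^ (α - 2))) :=
    (integrable_indicator_iff measurableSet_Ioi).mpr
      ((integrableOn_Ioi_rpow_of_lt (by linarith) hd0).const_mul _)
  have hg0 : ∀ s, 0 ≤ g s := fun s => add_nonneg
    (indicator_nonneg (fun s hs => by have := hs.1; positivity) s)
    (indicator_nonneg (fun s hs => by have : 0 < s := hd0.trans hs; positivity) s)
  have hle : |∫ s in Ioc 0 S, (w s * avg ψ s F x - w s * avg ψ s F y)| ≤ ∫ s in Ioc 0 S, g s := by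
    rw [← Real.norm_eq_abs]
    refine norm_integral_le_of_norm_le (hg1.add hg2).integrableOn
      ((ae_restrict_iff' measurableSet_Ioc).mpr (Filter.Eventually.of_forall fun s hs => ?_))
    rw [Real.norm_eq_abs]
    simp only [hg]
    by_cases hsd : s ≤ d
    · rw [indicator_of_mem (show s ∈ Ioc 0 d from ⟨hs.1, hsd⟩),
        indicator_of_notMem (show s ∉ Ioi d from not_lt.mpr hsd)]
      have := abs_sub (w s * avg ψ s F x) (w s * avg ψ s F y)
      linarith [h x s hs, h y s hs]
    · push Not at hsd
      rw [indicator_of_mem (show s ∈ Ioi d from hsd),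
        indicator_of_notMem (show s ∉ Ioc 0 d from fun h => not_lt.mpr h.2 hsd), zero_add]
      have hd1 := fun z => avg_differentiableAt hψ hF hs.1 z
      have h3 := abs_sub_le_of_pd (f := fun z => w s * avg ψ s F z) convex_univ
        (C := B * s ^ (α - 2)) (mul_nonneg hB (Real.rpow_nonneg hs.1.le _))
        (fun z _ => (hd1 z).1.const_mul _)
        (fun z _ j => by
          rw [pd_const_mul j _ (hd1 z).1, (hd1 z).2, ← mul_assoc]; exact h' z j s hs)
        (mem_univ x) (mem_univ y)
      refine h3.trans (le_of_eq ?_)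
      rw [← hd]; ring
  rw [integral_sub hix hiy] at hle
  refine hle.trans ?_
  calc ∫ s in Ioc 0 S, g s ≤ ∫ s, g s :=
        setIntegral_le_integral (hg1.add hg2) (Filter.Eventually.of_forall hg0)
    _ = 2 * B * (d ^ α / α) + n * B * d * (d ^ (α - 1) / (1 - α)) := by
        rw [hg, integral_add hg1 hg2, integral_indicator measurableSet_Ioc,
          integral_indicator measurableSet_Ioi, integral_const_mul, integral_const_mul,
          integral_rpow_sub_one hα0 d hd0.le, integral_Ioi_rpow_of_lt (by linarith) hd0]
        congr 2
        rw [show α - 2 + 1 = -(1 - α) by ring, neg_div_neg_eq, show -(1 - α) = α - 1 by ring]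
    _ = (2 / α + n / (1 - α)) * B * d ^ α := by
        have : d ^ α = d * d ^ (α - 1) := by
          rw [Real.rpow_sub_one hd0.ne']; field_simp
        rw [this]; field_simp
  
end AverageEstimates

/-! ### Odd extension across the boundary of a half-space -/

/-- The open half-space `0 < x ν`. -/
def upper {n : ℕ} (ν : Fin n) : Set (Pt n) := {x | 0 < x ν}

/-- Odd extension of a function on the half-space. -/
def oddExt {n : ℕ} (ν : Fin n) (f : Pt n → ℝ) (x : Pt n) : ℝ :=
  (upper ν).indicator f x - (upper ν).indicator f (reflect ν x)

section OddExt

open MeasureTheory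

variable {n : ℕ} {ν : Fin n} {f : Pt n → ℝ} {α C : ℝ} {x : Pt n}

lemma isOpen_upper : IsOpen (upper ν) := isOpen_lt continuous_const (continuous_apply ν)

lemma convex_upper : Convex ℝ (upper ν) := by
  intro x hx y hy a b ha hb hab
  simp only [upper, mem_ofPred_eq, Pi.add_apply, Pi.smul_apply, smul_eq_mul] at *
  rcases ha.lt_or_eq with h | h
  · have := mul_pos h hx
    have := mul_nonneg hb hy.le
    linarith
  · have : b = 1 := by linarith
    rw [← h, this]; linarith

lemma continuous_reflect : Continuous (reflect ν) := by
  unfold reflect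
  exact continuous_id.update ν (continuous_apply ν).neg

lemma measurePreserving_reflect : MeasurePreserving (reflect ν) := by
  have h := volume_preserving_pi (α' := fun _ : Fin n => ℝ) (β' := fun _ : Fin n => ℝ)
    (f := fun i t => if i = ν then -t else t) (fun i => by
      by_cases h : i = ν
      · simp only [h, if_true]; exact Measure.measurePreserving_neg volume
      · simp only [h, if_false]; exact MeasurePreserving.id volume)
  convert h using 1
  ext x i
  by_cases hi : i = ν
  · subst hi; simp [reflect_self]
  · simp [reflect_of_ne hi, hi]

lemma integral_comp_reflect (G : Pt n → ℝ) : ∫ z, G (reflect ν z) = ∫ z, G z :=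
  measurePreserving_reflect.integral_comp (continuous_reflect.measurableEmbedding
    (Function.LeftInverse.injective (reflect_reflect ν))) G

lemma oddExt_of_pos (hx : 0 < x ν) : oddExt ν f x = f x := by
  have h1 : x ∈ upper ν := hx
  have h2 : reflect ν x ∉ upper ν := by
    simp only [upper, mem_ofPred_eq, reflect_self]; linarith
  rw [oddExt, indicator_of_mem h1, indicator_of_notMem h2, sub_zero]

lemma oddExt_of_neg (hx : x ν < 0) : oddExt ν f x = -f (reflect ν x) := by
  have h1 : x ∉ upper ν := by simp only [upper, mem_ofPred_eq]; linarith
  have h2 : reflect ν x ∈ upper ν := by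
    simp only [upper, mem_ofPred_eq, reflect_self]; linarith
  rw [oddExt, indicator_of_notMem h1, indicator_of_mem h2, zero_sub]

lemma oddExt_of_zero (hx : x ν = 0) : oddExt ν f x = 0 := by
  have h1 : x ∉ upper ν := by simp [upper, hx]
  have h2 : reflect ν x ∉ upper ν := by simp [upper, reflect_self, hx]
  rw [oddExt, indicator_of_notMem h1, indicator_of_notMem h2, sub_zero]

lemma oddExt_reflect : oddExt ν f (reflect ν x) = -oddExt ν f x := by
  rw [oddExt, oddExt, reflect_reflect]; ring

lemma bddMeas_oddExt (hf : HolderBdd α 0 C (upper ν) f) (hα : 0 < α) (hC : 0 ≤ C) :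
    BddMeas C (oddExt ν f) := by
  refine ⟨?_, fun x => ?_⟩
  · have h : Measurable ((upper ν).indicator f) := by
      classical
      rw [← piecewise_eq_indicator]
      exact (hf.continuousOn hα).measurable_piecewise continuousOn_const isOpen_upper.measurableSet
    exact h.sub (h.comp continuous_reflect.measurable)
  · rcases lt_trichotomy (x ν) 0 with h | h | h
    · rw [oddExt_of_neg h, abs_neg]
      exact hf.bound _ (by simp only [upper, mem_ofPred_eq, reflect_self]; linarith)
    · rw [oddExt_of_zero h]; simpa
    · rw [oddExt_of_pos h]; exact hf.bound _ h

lemma oddExt_eq_zero {r : ℝ} (h : ∀ x ∈ upper ν, r < ‖x‖ → f x = 0) (hx : r < ‖x‖) :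
    oddExt ν f x = 0 := by
  have hn : ‖reflect ν x‖ = ‖x‖ := by
    have key : ∀ y : Pt n, ‖reflect ν y‖ ≤ ‖y‖ := fun y => by
      refine (pi_norm_le_iff_of_nonneg (norm_nonneg _)).mpr fun i => ?_
      by_cases hi : i = ν
      · subst hi; rw [reflect_self, norm_neg]; exact norm_le_pi_norm y i
      · rw [reflect_of_ne hi]; exact norm_le_pi_norm y i
    refine le_antisymm (key x) ?_
    simpa [reflect_reflect] using key (reflect ν x)
  rw [oddExt, indicator_apply_eq_zero.mpr fun h' => h x h' hx,
    indicator_apply_eq_zero.mpr fun h' => h _ h' (by rw [hn]; exact hx), sub_zero]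

lemma reflect_add_single {i : Fin n} (hi : i ≠ ν) (t : ℝ) :
    reflect ν (x + Pi.single i t) = reflect ν x + Pi.single i t := by
  ext j
  by_cases hj : j = ν
  · subst hj; simp [reflect_self, hi.symm]
  · simp [reflect_of_ne hj]

lemma add_single_apply_of_ne {i : Fin n} (hi : i ≠ ν) (x : Pt n) (t : ℝ) :
    (x + Pi.single i t : Pt n) ν = x ν := by simp [hi.symm]

lemma oddExt_dir (hf : HolderBdd α 0 C (upper ν) f) (hC : 0 ≤ C)
    {i : Fin n} (hi : i ≠ ν) (x : Pt n) (t : ℝ) :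
    |oddExt ν f (x + Pi.single i t) - oddExt ν f x| ≤ C * |t| ^ α := by
  have e := add_single_apply_of_ne hi x t
  have key : ∀ y : Pt n, 0 < y ν → |f (y + Pi.single i t) - f y| ≤ C * |t| ^ α := by
    intro y hy
    have := hf.2 (y + Pi.single i t) (by
      change 0 < (y + Pi.single i t : Pt n) ν
      rw [add_single_apply_of_ne hi]; exact hy) y hy
    simpa [Pi.norm_single] using this
  rcases lt_trichotomy (x ν) 0 with h | h | h
  · rw [oddExt_of_neg h, oddExt_of_neg (by rw [e]; exact h), reflect_add_single hi,
      neg_sub_neg, abs_sub_comm]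
    exact key _ (by rw [reflect_self]; linarith)
  · rw [oddExt_of_zero h, oddExt_of_zero (by rw [e]; exact h)]
    simp only [sub_self, abs_zero]; positivity
  · rw [oddExt_of_pos h, oddExt_of_pos (by rw [e]; exact h)]
    exact key _ h

lemma oddExt_local (hf : HolderBdd α 0 C (upper ν) f) (hα : 0 < α) (hC : 0 ≤ C) {δ : ℝ}
    (hδ : 0 < δ) (hx : δ < x ν) (w : Pt n) :
    |oddExt ν f (x + w) - oddExt ν f x| ≤ (C + 2 * C * δ⁻¹ ^ α) * ‖w‖ ^ α := by
  have hw : 0 ≤ ‖w‖ ^ α := Real.rpow_nonneg (norm_nonneg _) _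
  have hd : 0 ≤ δ⁻¹ ^ α := by positivity
  rcases lt_or_ge ‖w‖ δ with h | h
  · have h1 : |w ν| ≤ ‖w‖ := norm_le_pi_norm w ν
    have h2 : 0 < (x + w) ν := by
      rw [Pi.add_apply]; linarith [(abs_le.mp h1).1]
    rw [oddExt_of_pos h2, oddExt_of_pos (hδ.trans hx)]
    have := hf.2 (x + w) h2 x (hδ.trans hx)
    rw [add_sub_cancel_left] at this
    refine this.trans ?_
    nlinarith [mul_nonneg (mul_nonneg hC hd) hw]
  · have hb := (bddMeas_oddExt hf hα hC).bound
    have h1 := abs_sub (oddExt ν f (x + w)) (oddExt ν f x)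
    have h2 : 1 ≤ δ⁻¹ ^ α * ‖w‖ ^ α := by
      rw [← Real.mul_rpow (by positivity) (norm_nonneg _)]
      refine Real.one_le_rpow ?_ hα.le
      rw [inv_mul_eq_div, one_le_div hδ]; exact h
    nlinarith [hb x, hb (x + w), mul_nonneg hC hw]

lemma hasDerivAt_oddExt (hf : ∀ x ∈ upper ν, DifferentiableAt ℝ f x) {i : Fin n} (hi : i ≠ ν)
    (x : Pt n) (t : ℝ) :
    HasDerivAt (fun t => oddExt ν f (x + Pi.single i t))
      (oddExt ν (pd i f) (x + Pi.single i t)) t := by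
  have hs : ∀ y : Pt n, HasDerivAt (fun t : ℝ => y + (Pi.single i t : Pt n))
      (Pi.single i 1 : Pt n) t := by
    intro y
    have h := ((hasDerivAt_id t).smul_const (Pi.single i (1 : ℝ) : Pt n)).const_add y
    have e : (fun t : ℝ => y + (Pi.single i t : Pt n)) =
        fun t => y + id t • (Pi.single i 1 : Pt n) := by
      ext t j; simp [← Pi.single_smul]
    rw [e]; simpa using h
  have key : ∀ y : Pt n, 0 < y ν →
      HasDerivAt (fun t => f (y + Pi.single i t)) (pd i f (y + Pi.single i t)) t := fun y hy =>
    (hf (y + Pi.single i t) (by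
      change 0 < (y + Pi.single i t : Pt n) ν
      rw [add_single_apply_of_ne hi]; exact hy)).hasFDerivAt.comp_hasDerivAt t (hs y)
  have e := fun t => add_single_apply_of_ne hi x t
  rcases lt_trichotomy (x ν) 0 with h | h | h
  · have e1 : ∀ (f : Pt n → ℝ) t, oddExt ν f (x + Pi.single i t) =
        -f (reflect ν x + Pi.single i t) := fun f t => by
      rw [oddExt_of_neg (by rw [e]; exact h), reflect_add_single hi]
    simp only [e1]
    exact (key _ (by rw [reflect_self]; linarith)).neg
  · have e1 : ∀ (f : Pt n → ℝ) t, oddExt ν f (x + Pi.single i t) = 0 := fun f t =>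
      oddExt_of_zero (by rw [e]; exact h)
    simp only [e1]
    exact hasDerivAt_const _ _
  · have e1 : ∀ (f : Pt n → ℝ) t, oddExt ν f (x + Pi.single i t) =
        f (x + Pi.single i t) := fun f t => oddExt_of_pos (by rw [e]; exact h)
    simp only [e1]
    exact key _ h

/-- A tangential derivative may be moved from the weight to the function. -/
lemma avg_pd_oddExt {ψ : Pt n → ℝ} (hψ : IsWeight ψ) (hα : α ∈ Ioo (0 : ℝ) 1) (hC : 0 ≤ C)
    (hf : HolderBdd α 1 C (upper ν) f) {i : Fin n} (hi : i ≠ ν) {s : ℝ} (hs : 0 < s) (x : Pt n) :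
    s⁻¹ * avg (pd i ψ) s (oddExt ν f) x = avg ψ s (oddExt ν (pd i f)) x := by
  have hF := bddMeas_oddExt (hf.of_succ hα convex_upper hC) hα.1 (by positivity)
  have hF' := bddMeas_oddExt (hf.2.2 i) hα.1 hC
  obtain ⟨h1, h2⟩ := avg_differentiableAt hψ hF hs x
  rw [← h2 i]
  have h3 : HasDerivAt (fun t : ℝ => avg ψ s (oddExt ν f) (x + t • Pi.single i 1))
      (pd i (avg ψ s (oddExt ν f)) x) 0 := by
    have h4 : HasDerivAt (fun t : ℝ => x + t • (Pi.single i (1 : ℝ) : Pt n)) (Pi.single i 1) 0 := by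
      simpa using ((hasDerivAt_id (0 : ℝ)).smul_const (Pi.single i (1 : ℝ) : Pt n)).const_add x
    have h5 : HasFDerivAt (avg ψ s (oddExt ν f)) (fderiv ℝ (avg ψ s (oddExt ν f)) x)
      (x + (0 : ℝ) • (Pi.single i (1 : ℝ) : Pt n)) := by simpa using h1.hasFDerivAt
    exact h5.comp_hasDerivAt (0 : ℝ) h4
  have e : ∀ z (t : ℝ), x + t • Pi.single i 1 - s • z = (x - s • z) + (Pi.single i t : Pt n) := by
    intro z t; rw [← Pi.single_smul]; simp; abel
  have h6 := (hasDerivAt_integral_of_dominated_loc_of_deriv_le (𝕜 := ℝ) (μ := volume)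
    (F := fun t z => ψ z * oddExt ν f ((x - s • z) + (Pi.single i t : Pt n)))
    (F' := fun t z => ψ z * oddExt ν (pd i f) ((x - s • z) + (Pi.single i t : Pt n)))
    (x₀ := (0 : ℝ)) (s := univ) (bound := fun z => |ψ z| * C) Filter.univ_mem
    (Filter.Eventually.of_forall fun t =>
      (hψ.integrable_mul (hF.comp (e := fun z => (x - s • z) + (Pi.single i t : Pt n))
        (by fun_prop))).aestronglyMeasurable)
    (hψ.integrable_mul (hF.comp (e := fun z => (x - s • z) + (Pi.single i (0 : ℝ) : Pt n))
        (by fun_prop)))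
    (hψ.integrable_mul (hF'.comp (e := fun z => (x - s • z) + (Pi.single i (0 : ℝ) : Pt n))
        (by fun_prop))).aestronglyMeasurable
    (Filter.Eventually.of_forall fun z t _ => by
      rw [Real.norm_eq_abs, abs_mul]
      exact mul_le_mul_of_nonneg_left (hF'.bound _) (abs_nonneg _))
    (hψ.integrable.abs.mul_const C)
    (Filter.Eventually.of_forall fun z t _ =>
      (hasDerivAt_oddExt hf.2.1 hi (x - s • z) t).const_mul (ψ z))).2
  simp only [avg, e] at h3 ⊢
  have := h3.unique h6
  simpa using this

lemma avg_oddExt_of_zero {ψ : Pt n → ℝ} (hψ : ∀ z, ψ (reflect ν z) = ψ z) (s : ℝ)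
    (hx : x ν = 0) : avg ψ s (oddExt ν f) x = 0 := by
  have h : avg ψ s (oddExt ν f) x = -avg ψ s (oddExt ν f) x := by
    conv_lhs => rw [avg, ← integral_comp_reflect (ν := ν)]
    rw [avg, ← integral_neg]
    refine integral_congr_ae (Filter.Eventually.of_forall fun z => ?_)
    have e : x - s • reflect ν z = reflect ν (x - s • z) := by
      ext j
      by_cases hj : j = ν
      · subst hj; simp [reflect_self, hx]
      · simp [reflect_of_ne hj]
    simp only [hψ, e, oddExt_reflect, mul_neg]
  linarith

end OddExt

/-! ### The model solution operator on the half-space -/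

/-- `η` and `φ` are weights adapted to the Laplacian, even across `x ν = 0`. -/
structure LaplaceKernel {n : ℕ} (ν : Fin n) (η φ : Pt n → ℝ) : Prop where
  weight : IsWeight η
  weight' : IsWeight φ
  pd_eq : ∀ i z, pd i η z = z i * φ z
  even : ∀ z, η (reflect ν z) = η z
  integral_one : ∫ z, φ z = 1

/-- The model solution operator for the Dirichlet problem on the half-space. -/
def solOp {n : ℕ} (ν : Fin n) (η : Pt n → ℝ) (S : ℝ) (f : Pt n → ℝ) : Pt n → ℝ :=
  radial (fun s => s) η S (oddExt ν f)

section SolOp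

open MeasureTheory

variable {n : ℕ} {ν : Fin n} {f : Pt n → ℝ} {η φ ψ θ : Pt n → ℝ} {α C M S : ℝ} {x : Pt n}

/-- Averages at large scales are small. -/
lemma exists_holderBdd_avg {n : ℕ} (hn : 1 ≤ n) {α : ℝ} (hα : α ∈ Ioo (0 : ℝ) 1) (m : ℕ) :
    ∀ ψ : Pt n → ℝ, IsWeight ψ → ∃ K : ℝ, 0 ≤ K ∧ ∀ (S C : ℝ) (F : Pt n → ℝ), 1 ≤ S →
      BddMeas C F → (∀ x, 3 / 2 < ‖x‖ → F x = 0) →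
      HolderBdd α m (K * C * S⁻¹) univ (avg ψ S F) := by
  have sup : ∀ ψ : Pt n → ℝ, IsWeight ψ → ∃ K : ℝ, 0 ≤ K ∧ ∀ (S C : ℝ) (F : Pt n → ℝ), 1 ≤ S →
      BddMeas C F → (∀ x, 3 / 2 < ‖x‖ → F x = 0) → ∀ x, |avg ψ S F x| ≤ K * C * S⁻¹ := by
    intro ψ hψ
    obtain ⟨B, hB⟩ := hψ.supp.exists_bound_of_continuous hψ.smooth.continuous
    have hB0 : 0 ≤ B := (norm_nonneg _).trans (hB 0)
    set V : ℝ := (volume : Measure (Pt n)).real (Metric.closedBall 0 (3 / 2)) with hV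
    refine ⟨B * V, by positivity, fun S C F hS hF hF0 x => ?_⟩
    have hC := hF.nonneg
    have hS0 : 0 < S := by linarith
    rw [avg_eq hS0, abs_mul, abs_of_nonneg (by positivity)]
    have h1 : |∫ y, ψ (S⁻¹ • (x - y)) * F y| ≤
        ∫ y, (Metric.closedBall (0 : Pt n) (3 / 2)).indicator (fun _ => B * C) y := by
      rw [← Real.norm_eq_abs]
      refine norm_integral_le_of_norm_le ?_ (Filter.Eventually.of_forall fun y => ?_)
      · exact (integrable_indicator_iff Metric.isClosed_closedBall.measurableSet).mpr
          (integrableOn_const (isCompact_closedBall _ _).measure_lt_top.ne)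
      · by_cases hy : y ∈ Metric.closedBall (0 : Pt n) (3 / 2)
        · rw [indicator_of_mem hy, norm_mul]
          exact mul_le_mul (hB _) (hF.bound y) (norm_nonneg _) hB0
        · rw [indicator_of_notMem hy, hF0 y (by simpa using hy)]; simp
    rw [integral_indicator Metric.isClosed_closedBall.measurableSet, setIntegral_const,
      smul_eq_mul, ← hV] at h1
    have h2 : S⁻¹ ^ n ≤ S⁻¹ := by
      have : S⁻¹ ≤ 1 := inv_le_one_of_one_le₀ hS
      calc S⁻¹ ^ n ≤ S⁻¹ ^ 1 := pow_le_pow_of_le_one (by positivity) this hn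
        _ = S⁻¹ := pow_one _
    calc _ ≤ S⁻¹ * (V * (B * C)) := mul_le_mul h2 h1 (abs_nonneg _) (by positivity)
      _ = _ := by ring
  have step : ∀ (S A : ℝ), 1 ≤ S → 0 ≤ A → |S⁻¹| * A ≤ A := fun S A hS hA => by
    rw [abs_of_nonneg (by positivity)]
    exact mul_le_of_le_one_left hA (inv_le_one_of_one_le₀ hS)
  induction m with
  | zero =>
    intro ψ hψ
    obtain ⟨K, hK, h⟩ := sup ψ hψ
    choose K' hK' h' using fun i => sup (pd i ψ) (hψ.pd_weight i)
    have hsum : 0 ≤ ∑ i, K' i := Finset.sum_nonneg fun i _ => hK' i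
    refine ⟨(n + 2) * (K + ∑ i, K' i), by positivity, fun S C F hS hF hF0 => ?_⟩
    have hC := hF.nonneg
    have hS0 : 0 < S := by linarith
    set A := (K + ∑ i, K' i) * C * S⁻¹ with hA
    have hA0 : 0 ≤ A := by positivity
    have b1 : ∀ x, |avg ψ S F x| ≤ A := fun x => (h S C F hS hF hF0 x).trans (by
      rw [hA]; gcongr; linarith)
    have b2 : ∀ x i, |pd i (avg ψ S F) x| ≤ A := fun x i => by
      rw [(avg_differentiableAt hψ hF hS0 x).2, abs_mul]
      refine (mul_le_mul_of_nonneg_left ((h' i S C F hS hF hF0 x).trans ?_)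
        (abs_nonneg _)).trans (step S A hS hA0)
      rw [hA]; gcongr
      have := Finset.single_le_sum (fun j _ => hK' j) (Finset.mem_univ i)
      linarith
    have e : (n + 2) * (K + ∑ i, K' i) * C * S⁻¹ = (n + 2) * A := by rw [hA]; ring
    rw [e]
    refine ⟨fun x _ => (b1 x).trans (le_mul_of_one_le_left hA0 (by
      have := Nat.cast_nonneg (α := ℝ) n
      linarith)), fun x _ y _ => ?_⟩
    have h3 := abs_sub_le_of_pd convex_univ hA0
      (fun x _ => (avg_differentiableAt hψ hF hS0 x).1) (fun x _ => b2 x) (mem_univ x) (mem_univ y)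
    have h4 : |avg ψ S F x - avg ψ S F y| ≤ 2 * A := by
      have := abs_sub (avg ψ S F x) (avg ψ S F y)
      linarith [b1 x, b1 y]
    refine (holder_of_bounded_of_lipschitz hα (norm_nonneg _) (by positivity) (by positivity)
      h4 h3).trans (le_of_eq (by ring))
  | succ m ih =>
    intro ψ hψ
    obtain ⟨K, hK, h⟩ := sup ψ hψ
    choose K' hK' h' using fun i => ih (pd i ψ) (hψ.pd_weight i)
    have hsum : 0 ≤ ∑ i, K' i := Finset.sum_nonneg fun i _ => hK' i
    refine ⟨K + ∑ i, K' i, by positivity, fun S C F hS hF hF0 => ?_⟩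
    have hC := hF.nonneg
    have hS0 : 0 < S := by linarith
    have hd := avg_differentiableAt hψ hF hS0
    refine ⟨fun x _ => (h S C F hS hF hF0 x).trans (by gcongr; linarith),
      fun x _ => (hd x).1, fun i => ?_⟩
    have e : pd i (avg ψ S F) = fun x => S⁻¹ * avg (pd i ψ) S F x := funext fun x => (hd x).2 i
    rw [e]
    refine ((h' i S C F hS hF hF0).const_mul isOpen_univ S⁻¹).mono_const ?_
    refine (step S _ hS (by have := hK' i; positivity)).trans ?_
    gcongr
    have := Finset.single_le_sum (fun j _ => hK' j) (Finset.mem_univ i)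
    linarith

lemma pd_pd_comm_fun (hθ : IsWeight θ) (i j : Fin n) : pd i (pd j θ) = pd j (pd i θ) :=
  pd_comm hθ.smooth i j

lemma abs_w2_avg_pd_le (hθ : IsWeight θ) (hF : BddMeas M (oddExt ν f))
    (hf : HolderBdd α 0 C (upper ν) f) (hC : 0 ≤ C) (hα : α ∈ Ioo (0 : ℝ) 1)
    {t : Fin n} (ht : t ≠ ν) (x : Pt n) {s : ℝ} (hs : 0 < s) :
    |s * s⁻¹ * s⁻¹ * avg (pd t θ) s (oddExt ν f) x| ≤ moment α (pd t θ) * C * s ^ (α - 1) := by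
  have h := abs_avg_pd_le_of_dir hθ hF hs t hα.1.le (oddExt_dir hf hC ht) x
  rw [mul_inv_cancel₀ hs.ne', one_mul, abs_mul, abs_of_pos (inv_pos.mpr hs),
    Real.rpow_sub_one hs.ne', inv_mul_eq_div, mul_div_assoc']
  exact div_le_div_of_nonneg_right h hs.le

lemma exists_holderBdd_radial_pd (hθ : IsWeight θ) (hα : α ∈ Ioo (0 : ℝ) 1) (hS : 0 ≤ S)
    {t : Fin n} (ht : t ≠ ν) : ∃ K : ℝ, 0 ≤ K ∧ ∀ C f, 0 ≤ C → HolderBdd α 0 C (upper ν) f →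
      HolderBdd α 0 (K * C) univ
        (radial (fun s => s * s⁻¹ * s⁻¹) (pd t θ) S (oddExt ν f)) := by
  have hα0 := hα.1
  have hα1 : 0 < 1 - α := by linarith [hα.2]
  set B := moment α (pd t θ) + ∑ j, moment α (pd t (pd j θ)) with hB
  have hsum : 0 ≤ ∑ j, moment α (pd t (pd j θ)) := Finset.sum_nonneg fun j _ => moment_nonneg _ _
  have hm := moment_nonneg α (pd t θ)
  have hB0 : 0 ≤ B := by positivity
  refine ⟨(S ^ α / α + (2 / α + n / (1 - α))) * B, by positivity, fun C f hC hf => ?_⟩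
  have hF := bddMeas_oddExt hf hα.1 hC
  have hwm : Measurable fun s : ℝ => s * s⁻¹ * s⁻¹ :=
    (measurable_id.mul measurable_inv).mul measurable_inv
  have h1 : ∀ x, ∀ s ∈ Ioc 0 S, |s * s⁻¹ * s⁻¹ * avg (pd t θ) s (oddExt ν f) x| ≤
      B * C * s ^ (α - 1) := fun x s hs => by
    have := Real.rpow_nonneg hs.1.le (α - 1)
    refine (abs_w2_avg_pd_le hθ hF hf hC hα ht x hs.1).trans ?_
    gcongr
    linarith
  have h2 : ∀ x, ∀ j, ∀ s ∈ Ioc 0 S,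
      |s * s⁻¹ * s⁻¹ * s⁻¹ * avg (pd j (pd t θ)) s (oddExt ν f) x| ≤
      B * C * s ^ (α - 2) := fun x j s hs => by
    rw [pd_pd_comm_fun hθ j t, mul_right_comm, abs_mul, abs_of_pos (inv_pos.mpr hs.1)]
    have h3 := abs_w2_avg_pd_le (hθ.pd_weight j) hF hf hC hα ht x hs.1
    have e : s ^ (α - 2) = s ^ (α - 1) * s⁻¹ := by
      rw [show α - 2 = α - 1 - 1 by ring, Real.rpow_sub_one hs.1.ne', div_eq_mul_inv]
    rw [e, ← mul_assoc]
    refine mul_le_mul_of_nonneg_right (h3.trans ?_) (inv_pos.mpr hs.1).le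
    have := Real.rpow_nonneg hs.1.le (α - 1)
    gcongr
    have := Finset.single_le_sum (fun j _ => moment_nonneg α (pd t (pd j θ))) (Finset.mem_univ j)
    linarith
  have hA : 0 ≤ B * C := by positivity
  have hSa : 0 ≤ S ^ α := Real.rpow_nonneg hS _
  refine ⟨fun x _ => ?_, fun x _ y _ => ?_⟩
  · refine (abs_radial_le ((integrableOn_rpow_sub_one hα0 S hS).const_mul _) (h1 x)).trans ?_
    rw [integral_const_mul, integral_rpow_sub_one hα0 S hS]
    have : 0 ≤ (2 / α + n / (1 - α)) * (B * C) := by positivity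
    nlinarith
  · refine (abs_radial_sub_le hwm hα (hθ.pd_weight t) hF hA hS h1 h2 x y).trans ?_
    refine mul_le_mul_of_nonneg_right ?_ (Real.rpow_nonneg (norm_nonneg _) _)
    have : 0 ≤ S ^ α / α * (B * C) := by positivity
    nlinarith

lemma solOp_differentiableAt (hη : IsWeight η) (hF : BddMeas C (oddExt ν f)) (S : ℝ) (x : Pt n) :
    DifferentiableAt ℝ (solOp ν η S f) x ∧
      ∀ j, pd j (solOp ν η S f) x = radial (fun s => s * s⁻¹) (pd j η) S (oddExt ν f) x := by
  have hC := hF.nonneg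
  refine radial_differentiableAt (w := fun s => s) (b := fun _ => S * ((∫ z, |η z|) * C))
    (b' := fun _ => (∑ j, ∫ z, |pd j η z|) * C) measurable_id Filter.univ_mem hη hF
    (integrableOn_const (by simp)) (fun s hs => ?_) (integrableOn_const (by simp))
    (fun x _ j s hs => ?_)
  · rw [abs_mul, abs_of_pos hs.1]
    exact mul_le_mul hs.2 (abs_avg_le hη hF s x) (abs_nonneg _) (hs.1.le.trans hs.2)
  · rw [mul_inv_cancel₀ hs.1.ne', one_mul]
    refine (abs_avg_le (hη.pd_weight j) hF s x).trans (mul_le_mul_of_nonneg_right ?_ hC)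
    exact Finset.single_le_sum (f := fun j => ∫ z, |pd j η z|)
      (fun j _ => integral_nonneg fun z => abs_nonneg _) (Finset.mem_univ j)

lemma abs_w2_avg_le_local (hθ : IsWeight θ) (h0 : ∫ z, θ z = 0) (hα : α ∈ Ioo (0 : ℝ) 1)
    (hC : 0 ≤ C) (hf : HolderBdd α 0 C (upper ν) f) {δ : ℝ} (hδ : 0 < δ) (hx : δ < x ν)
    {s : ℝ} (hs : 0 < s) : |s * s⁻¹ * s⁻¹ * avg θ s (oddExt ν f) x| ≤
      moment α θ * (C + 2 * C * δ⁻¹ ^ α) * s ^ (α - 1) := by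
  have hF := bddMeas_oddExt hf hα.1 hC
  have h := abs_avg_sub_le hθ hF hs hα.1.le (oddExt_local hf hα.1 hC hδ hx)
  rw [h0, zero_mul, sub_zero] at h
  rw [mul_inv_cancel₀ hs.ne', one_mul, abs_mul, abs_of_pos (inv_pos.mpr hs),
    Real.rpow_sub_one hs.ne', inv_mul_eq_div, mul_div_assoc']
  exact div_le_div_of_nonneg_right h hs.le

lemma solOp_pd_differentiableAt (hη : IsWeight η) (hα : α ∈ Ioo (0 : ℝ) 1)
    (hC : 0 ≤ C) (hf : HolderBdd α 0 C (upper ν) f) (hS : 0 ≤ S) (hx : x ∈ upper ν) (i : Fin n) :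
    DifferentiableAt ℝ (pd i (solOp ν η S f)) x ∧ ∀ j, pd j (pd i (solOp ν η S f)) x =
      radial (fun s => s * s⁻¹ * s⁻¹) (pd j (pd i η)) S (oddExt ν f) x := by
  have hF := bddMeas_oddExt hf hα.1 hC
  have e : pd i (solOp ν η S f) = radial (fun s => s * s⁻¹) (pd i η) S (oddExt ν f) :=
    funext fun x => (solOp_differentiableAt hη hF S x).2 i
  rw [e]
  have hx' : 0 < x ν := hx
  have hθ := hη.pd_weight i
  set δ := x ν / 2 with hδ
  have hδ0 : 0 < δ := by positivity
  have hop : IsOpen {y : Pt n | δ < y ν} := isOpen_lt continuous_const (continuous_apply ν)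
  refine radial_differentiableAt (w := fun s => s * s⁻¹) (b := fun _ => (∫ z, |pd i η z|) * C)
    (b' := fun s => (∑ j, moment α (pd j (pd i η))) * (C + 2 * C * δ⁻¹ ^ α) * s ^ (α - 1))
    (measurable_id.mul measurable_inv)
    (hop.mem_nhds (show δ < x ν by rw [hδ]; linarith))
    hθ hF (integrableOn_const (by simp)) (fun s hs => ?_)
    ((integrableOn_rpow_sub_one hα.1 S hS).const_mul _)
    (fun y hy j s hs => ?_)
  · rw [mul_inv_cancel₀ hs.1.ne', one_mul]
    exact abs_avg_le hθ hF s x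
  · refine (abs_w2_avg_le_local (hθ.pd_weight j) (hθ.integral_pd j) hα hC hf hδ0 hy hs.1).trans ?_
    have h1 := Real.rpow_nonneg hs.1.le (α - 1)
    have h2 : 0 ≤ C + 2 * C * δ⁻¹ ^ α := by positivity
    gcongr
    exact Finset.single_le_sum (f := fun j => moment α (pd j (pd i η)))
      (fun j _ => moment_nonneg _ _) (Finset.mem_univ j)

lemma LaplaceKernel.sum_pd_pd (h : LaplaceKernel ν η φ) (z : Pt n) :
    ∑ i, pd i (pd i η) z = n * φ z + ∑ i, z i * pd i φ z := by
  have : ∀ i, pd i (pd i η) z = φ z + z i * pd i φ z := fun i => by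
    have e : pd i η = fun z => z i * φ z := funext fun z => h.pd_eq i z
    have hp : HasFDerivAt (fun z : Pt n => z i) (ContinuousLinearMap.proj (R := ℝ)
      (φ := fun _ : Fin n => ℝ) i) z := (ContinuousLinearMap.proj (R := ℝ)
      (φ := fun _ : Fin n => ℝ) i).hasFDerivAt
    rw [e, pd_mul i hp.differentiableAt (h.weight'.differentiable z)]
    have : pd i (fun z : Pt n => z i) z = 1 := by rw [pd, hp.fderiv]; simp
    rw [this, one_mul]
  simp only [this, Finset.sum_add_distrib]; simp

/-- The model operator solves the Poisson equation up to a smoothing error. -/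
lemma solOp_laplacian (h : LaplaceKernel ν η φ) (hα : α ∈ Ioo (0 : ℝ) 1)
    (hC : 0 ≤ C) (hf : HolderBdd α 0 C (upper ν) f) (hS : 0 < S) (hx : x ∈ upper ν) :
    ∑ i, pd i (pd i (solOp ν η S f)) x = f x - avg φ S (oddExt ν f) x := by
  have hF := bddMeas_oddExt hf hα.1 hC
  have hx' : 0 < x ν := hx
  have hδ0 : 0 < x ν / 2 := by positivity
  have hwm : Measurable fun s : ℝ => s * s⁻¹ * s⁻¹ :=
    (measurable_id.mul measurable_inv).mul measurable_inv
  have hi : ∀ i, IntegrableOn (fun s => s * s⁻¹ * s⁻¹ * avg (pd i (pd i η)) s (oddExt ν f) x)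
      (Ioc 0 S) := fun i =>
    integrableOn_radial hwm ((h.weight.pd_weight i).pd_weight i) hF
      ((integrableOn_rpow_sub_one hα.1 S hS.le).const_mul _)
      (fun s hs => abs_w2_avg_le_local ((h.weight.pd_weight i).pd_weight i)
        ((h.weight.pd_weight i).integral_pd i) hα hC hf hδ0
        (show x ν / 2 < x ν by linarith) hs.1)
  have e1 : ∑ i, pd i (pd i (solOp ν η S f)) x =
      ∫ s in Ioc 0 S, ∑ i, s * s⁻¹ * s⁻¹ * avg (pd i (pd i η)) s (oddExt ν f) x := by
    rw [integral_finsetSum _ fun i _ => hi i]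
    exact Finset.sum_congr rfl fun i _ =>
      (solOp_pd_differentiableAt h.weight hα hC hf hS.le hx i).2 i
  have e2 : ∀ s, 0 < s → ∑ i, s * s⁻¹ * s⁻¹ * avg (pd i (pd i η)) s (oddExt ν f) x =
      s⁻¹ * avg (fun z => n * φ z + ∑ i, z i * pd i φ z) s (oddExt ν f) x := by
    intro s hs
    simp only [mul_inv_cancel₀ hs.ne', one_mul]
    rw [← Finset.mul_sum]
    congr 1
    simp only [avg]
    rw [← integral_finsetSum _ fun i _ => ((h.weight.pd_weight i).pd_weight i).integrable_mul
      (hF.comp (e := fun z => x - s • z) (by fun_prop))]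
    refine integral_congr_ae (Filter.Eventually.of_forall fun z => ?_)
    simp only
    rw [← Finset.sum_mul, h.sum_pd_pd]
  have hder : ∀ s, 0 < s → HasDerivAt (fun s => avg φ s (oddExt ν f) x)
      (-∑ i, s * s⁻¹ * s⁻¹ * avg (pd i (pd i η)) s (oddExt ν f) x) s := fun s hs => by
    convert avg_hasDerivAt h.weight' hF hs x using 1
    rw [e2 s hs]; ring
  have h_int := (integrable_finsetSum Finset.univ fun i _ => hi i).neg
  have h0 : Filter.Tendsto (fun s => avg φ s (oddExt ν f) x) (nhdsWithin 0 (Ioi 0))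
      (nhds (f x)) := by
    rw [tendsto_iff_norm_sub_tendsto_zero]
    have hlim : Filter.Tendsto (fun s : ℝ => moment α φ * (C + 2 * C * (x ν / 2)⁻¹ ^ α) * s ^ α)
        (nhdsWithin 0 (Ioi 0)) (nhds 0) := by
      have h1 : Filter.Tendsto (fun s : ℝ => s ^ α) (nhdsWithin 0 (Ioi 0)) (nhds (0 ^ α)) :=
        ((Real.continuousAt_rpow_const 0 α (Or.inr hα.1.le)).tendsto).mono_left nhdsWithin_le_nhds
      rw [Real.zero_rpow hα.1.ne'] at h1
      simpa using h1.const_mul (moment α φ * (C + 2 * C * (x ν / 2)⁻¹ ^ α))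
    refine squeeze_zero' (Filter.Eventually.of_forall fun _ => norm_nonneg _) ?_ hlim
    filter_upwards [self_mem_nhdsWithin] with s hs
    have := abs_avg_sub_le h.weight' hF hs hα.1.le
      (oddExt_local hf hα.1 hC hδ0 (show x ν / 2 < x ν by linarith))
    rwa [h.integral_one, one_mul, oddExt_of_pos hx'] at this
  have hS' : Filter.Tendsto (fun s => avg φ s (oddExt ν f) x) (nhdsWithin S (Iio S))
      (nhds (avg φ S (oddExt ν f) x)) :=
    (hder S hS).continuousAt.tendsto.mono_left nhdsWithin_le_nhds
  have main := intervalIntegral.integral_eq_sub_of_hasDerivAt_of_tendsto hS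
    (fun s hs => hder s hs.1)
    ((intervalIntegrable_iff_integrableOn_Ioc_of_le hS.le).mpr h_int) h0 hS'
  rw [intervalIntegral.integral_of_le hS.le, integral_neg] at main
  rw [e1]
  linarith

lemma solOp_of_zero (h : LaplaceKernel ν η φ) (hx : x ν = 0) : solOp ν η S f x = 0 := by
  simp [solOp, radial, avg_oddExt_of_zero h.even _ hx]

/-- Tangential derivatives commute with the model operator. -/
lemma pd_solOp (hη : IsWeight η) (hα : α ∈ Ioo (0 : ℝ) 1) (hC : 0 ≤ C)
    (hf : HolderBdd α 1 C (upper ν) f) {i : Fin n} (hi : i ≠ ν) :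
    pd i (solOp ν η S f) = solOp ν η S (pd i f) := by
  have hF := bddMeas_oddExt (hf.of_succ hα convex_upper hC) hα.1 (by positivity)
  ext x
  rw [(solOp_differentiableAt hη hF S x).2 i, solOp, radial, radial]
  refine setIntegral_congr_fun measurableSet_Ioc fun s hs => ?_
  rw [mul_assoc, avg_pd_oddExt hη hα hC hf hi hs.1]

lemma exists_holderBdd_solOp_two (hn : 1 ≤ n) (h : LaplaceKernel ν η φ)
    (hα : α ∈ Ioo (0 : ℝ) 1) (hS : 1 ≤ S) : ∃ K : ℝ, 0 ≤ K ∧ ∀ C f, 0 ≤ C →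
      HolderBdd α 0 C (upper ν) f → (∀ x ∈ upper ν, 3 / 2 < ‖x‖ → f x = 0) →
      HolderBdd α 2 (K * C) (upper ν) (solOp ν η S f) := by
  have hS0 : 0 < S := by linarith
  have hη := h.weight
  have mixed : ∀ p : Fin n × Fin n, ∃ K : ℝ, 0 ≤ K ∧ (p.1 ≠ ν → ∀ C f, 0 ≤ C →
      HolderBdd α 0 C (upper ν) f → HolderBdd α 0 (K * C) univ
        (radial (fun s => s * s⁻¹ * s⁻¹) (pd p.1 (pd p.2 η)) S (oddExt ν f))) := by
    intro p
    by_cases hp : p.1 = ν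
    · exact ⟨0, le_rfl, fun h => absurd hp h⟩
    · obtain ⟨K, hK, hK'⟩ := exists_holderBdd_radial_pd (hη.pd_weight p.2) hα hS0.le hp
      exact ⟨K, hK, fun _ => hK'⟩
  choose K2 hK2 hmix using mixed
  obtain ⟨K3, hK3, havg⟩ := exists_holderBdd_avg hn hα 0 φ h.weight'
  set K1 := ∑ j, ∫ z, |pd j η z| with hK1
  have hK1n : ∀ j, 0 ≤ ∫ z, |pd j η z| := fun j => integral_nonneg fun z => abs_nonneg _
  have hK10 : 0 ≤ K1 := Finset.sum_nonneg fun j _ => hK1n j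
  have hK20 : 0 ≤ ∑ p, K2 p := Finset.sum_nonneg fun p _ => hK2 p
  have hN : 0 ≤ ∫ z, |η z| := integral_nonneg fun z => abs_nonneg _
  set KK := S * (S * ∫ z, |η z|) + S * K1 + (1 + K3 + (n * ∑ p, K2 p)) + ∑ p, K2 p with hKK
  refine ⟨KK, by positivity, fun C f hC hf hf0 => ?_⟩
  have hF := bddMeas_oddExt hf hα.1 hC
  have hd1 := solOp_differentiableAt hη hF S
  have hle : ∀ p, K2 p ≤ ∑ p, K2 p := fun p =>
    Finset.single_le_sum (fun p _ => hK2 p) (Finset.mem_univ p)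
  have hb0 : ∀ x, |solOp ν η S f x| ≤ S * (S * ∫ z, |η z|) * C := fun x => by
    refine (abs_radial_le (b := fun _ => S * ((∫ z, |η z|) * C)) (integrableOn_const (by simp))
      fun s hs => ?_).trans (le_of_eq ?_)
    · rw [abs_mul, abs_of_pos hs.1]
      exact mul_le_mul hs.2 (abs_avg_le hη hF s x) (abs_nonneg _) (hs.1.le.trans hs.2)
    · simp [hS0.le]; ring
  have hb1 : ∀ x i, |pd i (solOp ν η S f) x| ≤ S * K1 * C := fun x i => by
    rw [(hd1 x).2 i]
    refine (abs_radial_le (b := fun _ => K1 * C) (integrableOn_const (by simp))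
      fun s hs => ?_).trans (le_of_eq ?_)
    · rw [mul_inv_cancel₀ hs.1.ne', one_mul]
      refine (abs_avg_le (hη.pd_weight i) hF s x).trans (mul_le_mul_of_nonneg_right ?_ hC)
      exact Finset.single_le_sum (fun j _ => hK1n j) (Finset.mem_univ i)
    · simp [hS0.le]; ring
  have hd2 := fun x hx i => solOp_pd_differentiableAt (x := x) hη hα hC hf hS0.le hx i
  have hmixed : ∀ i j, i ≠ ν ∨ j ≠ ν →
      HolderBdd α 0 ((∑ p, K2 p) * C) (upper ν) (pd j (pd i (solOp ν η S f))) := by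
    intro i j hij
    by_cases hj : j = ν
    · have hi : i ≠ ν := hij.resolve_right (not_not.mpr hj)
      refine (((hmix (i, j) hi C f hC hf).mono_const ?_).mono_set (subset_univ _)).congr
        isOpen_upper fun x hx => ?_
      · exact mul_le_mul_of_nonneg_right (hle _) hC
      · rw [(hd2 x hx i).2 j, pd_pd_comm_fun hη]
    · refine (((hmix (j, i) hj C f hC hf).mono_const ?_).mono_set (subset_univ _)).congr
        isOpen_upper fun x hx => ?_
      · exact mul_le_mul_of_nonneg_right (hle _) hC
      · rw [(hd2 x hx i).2 j]
  refine ⟨fun x _ => (hb0 x).trans ?_, fun x _ => (hd1 x).1, fun i =>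
    ⟨fun x _ => (hb1 x i).trans ?_, fun x hx => (hd2 x hx i).1, fun j => ?_⟩⟩
  · refine mul_le_mul_of_nonneg_right ?_ hC
    rw [hKK]
    have : 0 ≤ S * K1 + (1 + K3 + (n * ∑ p, K2 p)) + ∑ p, K2 p := by positivity
    linarith
  · refine mul_le_mul_of_nonneg_right ?_ hC
    rw [hKK]
    have : 0 ≤ S * (S * ∫ z, |η z|) + (1 + K3 + (n * ∑ p, K2 p)) + ∑ p, K2 p := by positivity
    linarith
  by_cases hij : i ≠ ν ∨ j ≠ ν
  · refine (hmixed i j hij).mono_const (mul_le_mul_of_nonneg_right ?_ hC)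
    rw [hKK]
    have : 0 ≤ S * (S * ∫ z, |η z|) + S * K1 + (1 + K3 + (n * ∑ p, K2 p)) := by positivity
    linarith
  · push Not at hij
    obtain ⟨hi, hj⟩ := hij
    subst hi
    subst hj
    have h1 := ((havg S C _ hS hF (fun x hx => oddExt_eq_zero hf0 hx)).mono_set
      (subset_univ (upper j)))
    have h2 := HolderBdd.sum (Finset.univ.erase j) isOpen_upper
      (fun i hi => hmixed i i (Or.inl (Finset.ne_of_mem_erase hi)))
    refine (((hf.sub h1 isOpen_upper).sub h2 isOpen_upper).congr isOpen_upper fun x hx => ?_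
      ).mono_const ?_
    · rw [← solOp_laplacian h hα hC hf hS0 hx, ← Finset.add_sum_erase _ _ (Finset.mem_univ j)]
      ring
    · have hc : ((Finset.univ.erase j).card : ℝ) ≤ n := by
        have := Finset.card_erase_le (s := Finset.univ) (a := j)
        rw [Finset.card_univ, Fintype.card_fin] at this
        exact_mod_cast this
      have hS1 : S⁻¹ ≤ 1 := inv_le_one_of_one_le₀ hS
      rw [Finset.sum_const, nsmul_eq_mul]
      have e1 : K3 * C * S⁻¹ ≤ K3 * C := mul_le_of_le_one_right (by positivity) hS1
      have e2 : ((Finset.univ.erase j).card : ℝ) * ((∑ p, K2 p) * C) ≤ n * ((∑ p, K2 p) * C) :=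
        mul_le_mul_of_nonneg_right hc (by positivity)
      have e3 : 0 ≤ (S * (S * ∫ z, |η z|) + S * K1 + ∑ p, K2 p) * C := by positivity
      rw [hKK]
      nlinarith

/-- Schauder estimate for the model operator. -/
lemma exists_holderBdd_solOp (hn : 1 ≤ n) (h : LaplaceKernel ν η φ)
    (hα : α ∈ Ioo (0 : ℝ) 1) (hS : 1 ≤ S) (m : ℕ) : ∃ K : ℝ, 0 ≤ K ∧ ∀ C f, 0 ≤ C →
      HolderBdd α m C (upper ν) f → (∀ x ∈ upper ν, 3 / 2 < ‖x‖ → f x = 0) →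
      HolderBdd α (m + 2) (K * C) (upper ν) (solOp ν η S f) := by
  have hS0 : 0 < S := by linarith
  have hη := h.weight
  induction m with
  | zero => exact exists_holderBdd_solOp_two hn h hα hS
  | succ m ih =>
    obtain ⟨K, hK, ihK⟩ := ih
    obtain ⟨K3, hK3, havg⟩ := exists_holderBdd_avg hn hα (m + 1) φ h.weight'
    refine ⟨K * (n + 2) + K + (1 + K3 + n * K), by positivity, fun C f hC hf hf0 => ?_⟩
    have hfm := hf.of_succ hα convex_upper hC
    have hf1 : ∃ C', 0 ≤ C' ∧ HolderBdd α 1 C' (upper ν) f := by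
      clear ihK havg hfm
      induction m generalizing C with
      | zero => exact ⟨C, hC, hf⟩
      | succ m ih =>
        have h' : (0 : ℝ) ≤ (n + 2) * C := by positivity
        exact ih _ h' (hf.of_succ hα convex_upper hC)
    obtain ⟨C1, hC1, hf1⟩ := hf1
    have hf00 := hf1.of_succ hα convex_upper hC1
    have hC2 : 0 ≤ (n + 2) * C1 := by positivity
    have hF : BddMeas C (oddExt ν f) := by
      refine ⟨(bddMeas_oddExt hf00 hα.1 hC2).meas, fun x => ?_⟩
      have := (bddMeas_oddExt (ν := ν) (f := f) (C := C) (α := α))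
      rcases lt_trichotomy (x ν) 0 with hx | hx | hx
      · rw [oddExt_of_neg hx, abs_neg]
        exact hf.bound _ (by simp only [upper, mem_ofPred_eq, reflect_self]; linarith)
      · rw [oddExt_of_zero hx]; simpa
      · rw [oddExt_of_pos hx]; exact hf.bound _ hx
    have hT := ihK _ f (by positivity) hfm hf0
    have hsupp : ∀ i, ∀ x ∈ upper ν, 3 / 2 < ‖x‖ → pd i f x = 0 := by
      intro i x hx hx2
      have : f =ᶠ[nhds x] fun _ => 0 := by
        filter_upwards [isOpen_upper.mem_nhds hx, (isOpen_lt continuous_const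
          continuous_norm).mem_nhds hx2] with y hy hy2 using hf0 y hy hy2
      rw [pd_congr i this, pd_const]
    have hTi : ∀ i, i ≠ ν → HolderBdd α (m + 2) (K * C) (upper ν) (pd i (solOp ν η S f)) := by
      intro i hi
      rw [pd_solOp hη hα hC1 hf1 hi]
      exact ihK C _ hC (hf.2.2 i) (hsupp i)
    set KK := K * (n + 2) + K + (1 + K3 + n * K) with hKK
    have l1 : K * ((n + 2) * C) ≤ KK * C := by
      rw [hKK]
      have : 0 ≤ (K + (1 + K3 + n * K)) * C := by positivity
      linarith
    have l2 : K * C ≤ KK * C := by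
      rw [hKK]
      have : 0 ≤ (K * (n + 2) + (1 + K3 + n * K)) * C := by positivity
      linarith
    refine ⟨fun x hx => (hT.1 x hx).trans l1, hT.2.1, fun i => ?_⟩
    by_cases hi : i = ν
    swap
    · exact (hTi i hi).mono_const l2
    subst hi
    refine ⟨fun x hx => (hT.pd_bound i x hx).trans l1, (hT.2.2 i).2.1, fun j => ?_⟩
    by_cases hj : j = i
    · subst hj
      have h1 := ((havg S C _ hS hF (fun x hx => oddExt_eq_zero hf0 hx)).mono_set
        (subset_univ (upper j)))
      have h2 := HolderBdd.sum (Finset.univ.erase j) isOpen_upper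
        (fun i hi => (hTi i (Finset.ne_of_mem_erase hi)).2.2 i)
      refine (((hf.sub h1 isOpen_upper).sub h2 isOpen_upper).congr isOpen_upper fun x hx => ?_
        ).mono_const ?_
      · rw [← solOp_laplacian h hα hC2 hf00 hS0 hx, ← Finset.add_sum_erase _ _ (Finset.mem_univ j)]
        ring
      · have hc : ((Finset.univ.erase j).card : ℝ) ≤ n := by
          have := Finset.card_erase_le (s := Finset.univ) (a := j)
          rw [Finset.card_univ, Fintype.card_fin] at this
          exact_mod_cast this
        have hS1 : S⁻¹ ≤ 1 := inv_le_one_of_one_le₀ hS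
        rw [Finset.sum_const, nsmul_eq_mul]
        have e1 : K3 * C * S⁻¹ ≤ K3 * C := mul_le_of_le_one_right (by positivity) hS1
        have e2 : ((Finset.univ.erase j).card : ℝ) * (K * C) ≤ n * (K * C) :=
          mul_le_mul_of_nonneg_right hc (by positivity)
        have e3 : 0 ≤ (K * (n + 2) + K) * C := by positivity
        rw [hKK]
        nlinarith
    · refine (((hTi j hj).2.2 i).mono_const l2).congr isOpen_upper fun x hx => ?_
      rw [(solOp_pd_differentiableAt hη hα hC2 hf00 hS0.le hx i).2 j,
        (solOp_pd_differentiableAt hη hα hC2 hf00 hS0.le hx j).2 i, pd_pd_comm_fun hη]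

end SolOp

section Neumann

open MeasureTheory

variable {n : ℕ} {ν : Fin n} {f g : Pt n → ℝ} {η φ : Pt n → ℝ} {α C M S : ℝ} {x : Pt n} {m : ℕ}

/-- Neumann series on a Hölder class of functions vanishing outside a fixed ball. -/
lemma exists_sub_eq_of_contraction {s : Set (Pt n)} (hs : IsOpen s) (hc : Convex ℝ s)
    (Q : (Pt n → ℝ) → Pt n → ℝ)
    (hQ : ∀ C f, 0 ≤ C → HolderBdd α m C s f → (∀ x ∈ s, 3 / 2 < ‖x‖ → f x = 0) →
      HolderBdd α m (C / 2) s (Q f) ∧ ∀ x ∈ s, 3 / 2 < ‖x‖ → Q f x = 0)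
    (hadd : ∀ C f g, 0 ≤ C → HolderBdd α m C s f → HolderBdd α m C s g →
      (∀ x ∈ s, 3 / 2 < ‖x‖ → f x = 0) → (∀ x ∈ s, 3 / 2 < ‖x‖ → g x = 0) →
      ∀ x ∈ s, Q (fun y => f y + g y) x = Q f x + Q g x)
    (hcongr : ∀ f g, EqOn f g s → EqOn (Q f) (Q g) s)
    {C : ℝ} (hC : 0 ≤ C) {f : Pt n → ℝ} (hf : HolderBdd α m C s f)
    (hf0 : ∀ x ∈ s, 3 / 2 < ‖x‖ → f x = 0) :
    ∃ h, HolderBdd α m (2 * C) s h ∧ (∀ x ∈ s, 3 / 2 < ‖x‖ → h x = 0) ∧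
      ∀ x ∈ s, h x - Q h x = f x := by
  set F : ℕ → Pt n → ℝ := fun j => Q^[j] f with hF
  have hFj : ∀ j, HolderBdd α m (C * (1 / 2) ^ j) s (F j) ∧
      ∀ x ∈ s, 3 / 2 < ‖x‖ → F j x = 0 := by
    intro j
    induction j with
    | zero => simpa [hF] using ⟨hf, hf0⟩
    | succ j ih =>
      have e : F (j + 1) = Q (F j) := Function.iterate_succ_apply' Q j f
      have := hQ _ _ (by positivity) ih.1 ih.2
      rw [e, pow_succ, ← mul_assoc, mul_one_div]
      exact this
  have hgeo : ∀ N : ℕ, HasSum (fun j : ℕ => C * (1 / 2 : ℝ) ^ (j + N)) (2 * C * (1 / 2) ^ N) := by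
    intro N
    have := hasSum_geometric_two.mul_left (C * (1 / 2 : ℝ) ^ N)
    have e : (fun j : ℕ => C * (1 / 2 : ℝ) ^ (j + N)) = fun j => C * (1 / 2) ^ N * (1 / 2) ^ j := by
      ext j; rw [pow_add]; ring
    rw [e, mul_comm 2 C, mul_right_comm]
    exact this
  set tail : ℕ → Pt n → ℝ := fun N x => ∑' j, F (j + N) x with htail
  have htailB : ∀ N, HolderBdd α m (2 * C * (1 / 2) ^ N) s (tail N) := by
    intro N
    have := HolderBdd.tsum hs hc (F := fun j => F (j + N)) (hgeo N).summable
      (fun j => by positivity) (fun j => (hFj (j + N)).1)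
    rwa [(hgeo N).tsum_eq] at this
  have htail0 : ∀ N, ∀ x ∈ s, 3 / 2 < ‖x‖ → tail N x = 0 := by
    intro N x hx hx2
    simp only [htail, (hFj _).2 x hx hx2, tsum_zero]
  have hsum : ∀ x ∈ s, Summable fun j => F j x := fun x hx =>
    Summable.of_norm_bounded (hgeo 0).summable fun j => (hFj j).1.bound x hx
  set part : ℕ → Pt n → ℝ := fun N x => ∑ j ∈ Finset.range N, F j x with hpart
  have hpartB : ∀ N, HolderBdd α m (∑ j ∈ Finset.range N, C * (1 / 2) ^ j) s (part N) :=
    fun N => HolderBdd.sum _ hs fun j _ => (hFj j).1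
  have hpart0 : ∀ N, ∀ x ∈ s, 3 / 2 < ‖x‖ → part N x = 0 := by
    intro N x hx hx2
    simp only [hpart, (hFj _).2 x hx hx2, Finset.sum_const_zero]
  have hQpart : ∀ N, ∀ x ∈ s, Q (part (N + 1)) x = part (N + 2) x - f x := by
    intro N
    induction N with
    | zero =>
      intro x hx
      have e : part (0 + 1) = F 0 := by ext y; simp [hpart]
      have e1 : Q (F 0) = F 1 := (Function.iterate_succ_apply' Q 0 f).symm
      rw [e, e1]
      simp [hpart, Finset.sum_range_succ, hF]
    | succ N ih =>
      intro x hx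
      have e : part (N + 1 + 1) = fun y => part (N + 1) y + F (N + 1) y := by
        ext y; simp [hpart, Finset.sum_range_succ]
      have e1 : Q (F (N + 1)) = F (N + 2) := (Function.iterate_succ_apply' Q (N + 1) f).symm
      have hp0 : (0 : ℝ) ≤ ∑ j ∈ Finset.range (N + 1), C * (1 / 2 : ℝ) ^ j :=
        Finset.sum_nonneg fun j _ => by positivity
      have hp1 : (0 : ℝ) ≤ C * (1 / 2 : ℝ) ^ (N + 1) := by positivity
      rw [e, hadd _ _ _ (add_nonneg hp0 hp1) ((hpartB (N + 1)).mono_const (by linarith))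
        ((hFj (N + 1)).1.mono_const (by linarith)) (hpart0 _) (hFj _).2 x hx, ih x hx, e1]
      simp only [hpart, Finset.sum_range_succ]
      ring
  refine ⟨tail 0, by simpa using htailB 0, htail0 0, fun x hx => ?_⟩
  have hsplit : ∀ N, ∀ y ∈ s, tail 0 y = part N y + tail N y := fun N y hy =>
    ((hsum y hy).sum_add_tsum_nat_add N).symm
  have hbound : ∀ N : ℕ, |tail 0 x - Q (tail 0) x - f x| ≤ 2 * (2 * C * (1 / 2) ^ (N + 1)) := by
    intro N
    have hp0 : (0 : ℝ) ≤ ∑ j ∈ Finset.range (N + 1), C * (1 / 2 : ℝ) ^ j :=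
      Finset.sum_nonneg fun j _ => by positivity
    have hp1 : (0 : ℝ) ≤ 2 * C * (1 / 2 : ℝ) ^ (N + 1) := by positivity
    have h1 : Q (tail 0) x = Q (part (N + 1)) x + Q (tail (N + 1)) x := by
      rw [← hadd _ _ _ (add_nonneg hp0 hp1) ((hpartB (N + 1)).mono_const (by linarith))
        ((htailB (N + 1)).mono_const (by linarith)) (hpart0 _) (htail0 _) x hx]
      exact hcongr _ _ (fun y hy => hsplit (N + 1) y hy) hx
    have h2 := (hQ _ _ hp1 (htailB (N + 1)) (htail0 _)).1.bound x hx
    have h3 := (htailB (N + 2)).bound x hx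
    rw [h1, hQpart N x hx, hsplit (N + 2) x hx]
    have e : part (N + 2) x + tail (N + 2) x - (part (N + 2) x - f x + Q (tail (N + 1)) x) - f x
        = tail (N + 2) x - Q (tail (N + 1)) x := by ring
    rw [e]
    refine (abs_sub _ _).trans ?_
    have : 2 * C * (1 / 2 : ℝ) ^ (N + 2) ≤ 2 * C * (1 / 2 : ℝ) ^ (N + 1) := by
      rw [pow_succ _ (N + 1)]; linarith
    linarith
  have hlim : Filter.Tendsto (fun N : ℕ => 2 * (2 * C * (1 / 2 : ℝ) ^ (N + 1))) Filter.atTop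
      (nhds 0) := by
    have := ((tendsto_pow_atTop_nhds_zero_of_lt_one (r := (1 / 2 : ℝ)) (by norm_num)
      (by norm_num)).comp (Filter.tendsto_add_atTop_nat 1)).const_mul (2 * (2 * C))
    simpa [mul_assoc] using this
  have := ge_of_tendsto' hlim hbound
  have := abs_nonpos_iff.mp this
  linarith

/-- The lower order and perturbation part of a second order operator. -/
def lowOp (p : Fin n → Fin n → Pt n → ℝ) (b : Fin n → Pt n → ℝ) (c u : Pt n → ℝ) (x : Pt n) : ℝ :=
  ∑ i, ∑ j, p i j x * pd i (pd j u) x + ∑ i, b i x * pd i u x + c x * u x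

lemma oddExt_congr (h : EqOn f g (upper ν)) : oddExt ν f = oddExt ν g := by
  ext x
  rcases lt_trichotomy (x ν) 0 with hx | hx | hx
  · rw [oddExt_of_neg hx, oddExt_of_neg hx,
      h (by simp only [upper, mem_ofPred_eq, reflect_self]; linarith)]
  · rw [oddExt_of_zero hx, oddExt_of_zero hx]
  · rw [oddExt_of_pos hx, oddExt_of_pos hx, h hx]

lemma oddExt_add : oddExt ν (fun x => f x + g x) = fun x => oddExt ν f x + oddExt ν g x := by
  ext x
  rcases lt_trichotomy (x ν) 0 with hx | hx | hx
  · simp only [oddExt_of_neg hx]; ring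
  · simp only [oddExt_of_zero hx]; ring
  · simp only [oddExt_of_pos hx]

lemma avg_add (hψ : IsWeight φ) (hf : BddMeas C f) (hg : BddMeas M g) (S : ℝ) (x : Pt n) :
    avg φ S (fun y => f y + g y) x = avg φ S f x + avg φ S g x := by
  have h1 := hψ.integrable_mul (hf.comp (e := fun z => x - S • z) (by fun_prop))
  have h2 := hψ.integrable_mul (hg.comp (e := fun z => x - S • z) (by fun_prop))
  rw [avg, avg, avg, ← integral_add h1 h2]
  simp only [mul_add]

lemma solOp_add (hη : IsWeight η) (hf : BddMeas C (oddExt ν f)) (hg : BddMeas C (oddExt ν g)) :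
    solOp ν η S (fun x => f x + g x) = fun x => solOp ν η S f x + solOp ν η S g x := by
  ext x
  have h_int : ∀ {F : Pt n → ℝ}, BddMeas C F →
      IntegrableOn (fun s => s * avg η s F x) (Ioc 0 S) := fun {F} hF =>
    integrableOn_radial (w := fun s => s) (b := fun _ => S * ((∫ z, |η z|) * C)) measurable_id hη hF
      (integrableOn_const (by simp)) fun s hs => by
        rw [abs_mul, abs_of_pos hs.1]
        exact mul_le_mul hs.2 (abs_avg_le hη hF s x) (abs_nonneg _) (hs.1.le.trans hs.2)
  rw [solOp, solOp, solOp, radial, radial, radial, ← integral_add (h_int hf) (h_int hg), oddExt_add]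
  refine setIntegral_congr_fun measurableSet_Ioc fun s hs => ?_
  simp only [avg_add hη hf hg, mul_add]

lemma lowOp_add {p : Fin n → Fin n → Pt n → ℝ} {b : Fin n → Pt n → ℝ} {c u v : Pt n → ℝ}
    {s : Set (Pt n)} (hs : IsOpen s) (hu : ∀ x ∈ s, DifferentiableAt ℝ u x)
    (hv : ∀ x ∈ s, DifferentiableAt ℝ v x) (hu2 : ∀ x ∈ s, ∀ i, DifferentiableAt ℝ (pd i u) x)
    (hv2 : ∀ x ∈ s, ∀ i, DifferentiableAt ℝ (pd i v) x) (hx : x ∈ s) :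
    lowOp p b c (fun y => u y + v y) x = lowOp p b c u x + lowOp p b c v x := by
  have h1 : ∀ i, ∀ y ∈ s, pd i (fun y => u y + v y) y = pd i u y + pd i v y :=
    fun i y hy => pd_add i (hu y hy) (hv y hy)
  have h2 : ∀ i j, pd i (pd j (fun y => u y + v y)) x = pd i (pd j u) x + pd i (pd j v) x := by
    intro i j
    have e : pd j (fun y => u y + v y) =ᶠ[nhds x] fun y => pd j u y + pd j v y := by
      filter_upwards [hs.mem_nhds hx] with y hy using h1 j y hy
    rw [pd_congr i e, pd_add i (hu2 x hx j) (hv2 x hx j)]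
  simp only [lowOp, h2, h1 _ x hx, mul_add, Finset.sum_add_distrib]
  ring

/-- Multiplying by coefficients of size `δ`. -/
lemma exists_holderBdd_lowOp (n : ℕ) {α : ℝ} (hα : α ∈ Ioo (0 : ℝ) 1) (m : ℕ) : ∃ K : ℝ, 0 ≤ K ∧
    ∀ (s : Set (Pt n)), IsOpen s → Convex ℝ s → ∀ (δ C : ℝ) (p : Fin n → Fin n → Pt n → ℝ)
      (b : Fin n → Pt n → ℝ) (c u : Pt n → ℝ), 0 ≤ δ → 0 ≤ C →
      (∀ i j, HolderBdd α m δ s (p i j)) → (∀ i, HolderBdd α m δ s (b i)) → HolderBdd α m δ s c →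
      HolderBdd α (m + 2) C s u → HolderBdd α m (K * δ * C) s (lowOp p b c u) := by
  obtain ⟨K, hK, hmul⟩ := HolderBdd.exists_mul n hα m
  refine ⟨(n * (n * (K * (n + 2) ^ 2)) + n * (K * (n + 2) ^ 2)) + K * (n + 2) ^ 2, by positivity,
    fun s hs hcv δ C p b c u hδ hC hp hb hc hu => ?_⟩
  have hn1 : (1 : ℝ) ≤ n + 2 := by have : (0 : ℝ) ≤ n := n.cast_nonneg; linarith
  have h0 : HolderBdd α m ((n + 2) ^ 2 * C) s u := by
    have := (hu.of_succ hα hcv hC).of_succ hα hcv (by positivity)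
    rwa [← mul_assoc, ← sq] at this
  have h1 : ∀ i, HolderBdd α m ((n + 2) ^ 2 * C) s (pd i u) := fun i =>
    ((hu.2.2 i).of_succ hα hcv hC).mono_const (mul_le_mul_of_nonneg_right (by nlinarith) hC)
  have h2 : ∀ i j, HolderBdd α m ((n + 2) ^ 2 * C) s (pd i (pd j u)) := fun i j =>
    ((hu.2.2 j).2.2 i).mono_const (le_mul_of_one_le_left hC (by nlinarith))
  have hC' : 0 ≤ ((n : ℝ) + 2) ^ 2 * C := by positivity
  have := ((HolderBdd.sum Finset.univ hs fun i _ => HolderBdd.sum Finset.univ hs fun j _ =>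
    hmul s hs hcv δ _ _ _ hδ hC' (hp i j) (h2 i j)).add (HolderBdd.sum Finset.univ hs fun i _ =>
    hmul s hs hcv δ _ _ _ hδ hC' (hb i) (h1 i)) hs).add
    (hmul s hs hcv δ _ _ _ hδ hC' hc h0) hs
  refine HolderBdd.mono_const this (le_of_eq ?_)
  simp only [Finset.sum_const, Finset.card_univ, Fintype.card_fin, nsmul_eq_mul]
  ring

/-- Solvability of small perturbations of the Laplace equation in a half ball. -/
lemma exists_perturbed_solution (hn : 1 ≤ n) (ν : Fin n) (hα : α ∈ Ioo (0 : ℝ) 1) (m : ℕ) :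
    ∃ δ > 0, ∀ (p : Fin n → Fin n → Pt n → ℝ) (b : Fin n → Pt n → ℝ) (c e : Pt n → ℝ),
      (∀ i j, HolderBdd α m δ (upper ν ∩ Metric.ball 0 2) (p i j)) →
      (∀ i, HolderBdd α m δ (upper ν ∩ Metric.ball 0 2) (b i)) →
      HolderBdd α m δ (upper ν ∩ Metric.ball 0 2) c →
      HolderBdd α m δ (upper ν ∩ Metric.ball 0 2) e →
      ∃ w, HolderBdd α (m + 2) (1 / 2) (upper ν) w ∧ Continuous w ∧ (∀ x, x ν = 0 → w x = 0) ∧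
        ∀ x ∈ upper ν ∩ Metric.ball 0 1,
          ∑ i, pd i (pd i w) x + lowOp p b c w x = -e x := by
  obtain ⟨η, φ, hη, hφ, hη', hφ', hpd, heven, h_int⟩ := exists_laplace_kernel ν
  have hL : LaplaceKernel ν η φ := ⟨⟨hη, hη'⟩, ⟨hφ, hφ'⟩, hpd, heven, h_int⟩
  let χ : ContDiffBump (0 : Pt n) := ⟨1, 3 / 2, by norm_num, by norm_num⟩
  have hχ0 : ∀ x, 3 / 2 < ‖x‖ → χ x = 0 := fun x hx =>
    χ.zero_of_le_dist (by rw [dist_zero_right]; exact hx.le)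
  have hχ1 : ∀ x ∈ Metric.ball (0 : Pt n) 1, χ x = 1 := fun x hx =>
    χ.one_of_mem_closedBall (Metric.ball_subset_closedBall hx)
  obtain ⟨Kχ, hKχ, hcut⟩ := HolderBdd.exists_cutoff hα m (fun x => χ x) χ.contDiff
    χ.tsupport_eq.subset
  obtain ⟨K3, hK3, havg⟩ := exists_holderBdd_avg hn hα m φ hL.weight'
  obtain ⟨Kl, hKl, hlow⟩ := exists_holderBdd_lowOp n hα m
  set S := 1 + 4 * (Kχ * K3) with hS
  have hS1 : 1 ≤ S := by rw [hS]; have : 0 ≤ Kχ * K3 := by positivity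
                         linarith
  have hS0 : 0 < S := by linarith
  obtain ⟨KT, hKT, hT⟩ := exists_holderBdd_solOp hn hL hα hS1 m
  set B := Kχ * Kl * KT + KT * Kχ with hB
  have hB0 : 0 ≤ B := by positivity
  set δ := 1 / (4 * (1 + B)) with hδ
  have hδ0 : 0 < δ := by positivity
  have hδB : B * δ ≤ 1 / 4 := by
    rw [hδ, mul_one_div, div_le_div_iff₀ (by positivity) (by norm_num)]; linarith
  refine ⟨δ, hδ0, fun p b c e hp hb hc he => ?_⟩
  have hball : IsOpen (upper ν ∩ Metric.ball (0 : Pt n) 2) := isOpen_upper.inter Metric.isOpen_ball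
  have hballc : Convex ℝ (upper ν ∩ Metric.ball (0 : Pt n) 2) :=
    convex_upper.inter (convex_ball 0 2)
  have hF : ∀ C f, 0 ≤ C → HolderBdd α m C (upper ν) f →
      (∃ C', 0 ≤ C' ∧ HolderBdd α 0 C' (upper ν) f) ∧ BddMeas C (oddExt ν f) := by
    intro C f hC hf
    have h0 : ∃ C', 0 ≤ C' ∧ HolderBdd α 0 C' (upper ν) f := by
      clear * - hC hf hα
      induction m generalizing C with
      | zero => exact ⟨C, hC, hf⟩
      | succ m ih =>
        have h' : (0 : ℝ) ≤ (n + 2) * C := by positivity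
        exact ih _ h' (hf.of_succ hα convex_upper hC)
    refine ⟨h0, ?_⟩
    obtain ⟨C', hC', h0⟩ := h0
    refine ⟨(bddMeas_oddExt h0 hα.1 hC').meas, fun x => ?_⟩
    rcases lt_trichotomy (x ν) 0 with hx | hx | hx
    · rw [oddExt_of_neg hx, abs_neg]
      exact hf.bound _ (by simp only [upper, mem_ofPred_eq, reflect_self]; linarith)
    · rw [oddExt_of_zero hx]; simpa
    · rw [oddExt_of_pos hx]; exact hf.bound _ hx
  let Q : (Pt n → ℝ) → Pt n → ℝ := fun f x =>
    χ x * (avg φ S (oddExt ν f) x - lowOp p b c (solOp ν η S f) x)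
  have hQ : ∀ C f, 0 ≤ C → HolderBdd α m C (upper ν) f →
      (∀ x ∈ upper ν, 3 / 2 < ‖x‖ → f x = 0) →
      HolderBdd α m (C / 2) (upper ν) (Q f) ∧ ∀ x ∈ upper ν, 3 / 2 < ‖x‖ → Q f x = 0 := by
    intro C f hC hf hf0
    refine ⟨?_, fun x _ hx => by simp only [Q, hχ0 x hx, zero_mul]⟩
    have h1 := (havg S C _ hS1 (hF C f hC hf).2 (fun x hx => oddExt_eq_zero hf0 hx)).mono_set
      (subset_univ (upper ν ∩ Metric.ball 0 2))
    have h2 := hlow _ hball hballc δ (KT * C) p b c _ hδ0.le (by positivity) hp hb hc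
      ((hT C f hC hf hf0).mono_set inter_subset_left)
    refine (hcut (upper ν) isOpen_upper convex_upper _ _ (by positivity)
      (h1.sub h2 hball)).mono_const ?_
    have e1 : Kχ * (K3 * C * S⁻¹) ≤ 1 / 4 * C := by
      rw [← mul_assoc, mul_inv_le_iff₀ hS0, hS]
      have : 0 ≤ Kχ * K3 * C := by positivity
      linarith
    have e2 : Kχ * (Kl * δ * (KT * C)) ≤ 1 / 4 * C := by
      have : Kχ * Kl * KT * δ ≤ 1 / 4 := le_trans
        (mul_le_mul_of_nonneg_right (by rw [hB]; have : 0 ≤ KT * Kχ := by positivity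
                                        linarith) hδ0.le) hδB
      calc _ = Kχ * Kl * KT * δ * C := by ring
        _ ≤ _ := mul_le_mul_of_nonneg_right this hC
    linarith
  have hTd : ∀ C f, 0 ≤ C → HolderBdd α m C (upper ν) f → ∀ x ∈ upper ν,
      DifferentiableAt ℝ (solOp ν η S f) x ∧ ∀ i, DifferentiableAt ℝ (pd i (solOp ν η S f)) x := by
    intro C f hC hf x hx
    obtain ⟨⟨C', hC', h0⟩, hb⟩ := hF C f hC hf
    exact ⟨(solOp_differentiableAt hL.weight hb S x).1, fun i =>
      (solOp_pd_differentiableAt hL.weight hα hC' h0 hS0.le hx i).1⟩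
  have hadd : ∀ C f g, 0 ≤ C → HolderBdd α m C (upper ν) f → HolderBdd α m C (upper ν) g →
      (∀ x ∈ upper ν, 3 / 2 < ‖x‖ → f x = 0) → (∀ x ∈ upper ν, 3 / 2 < ‖x‖ → g x = 0) →
      ∀ x ∈ upper ν, Q (fun y => f y + g y) x = Q f x + Q g x := by
    intro C f g hC hf hg _ _ x hx
    have hfb := (hF C f hC hf).2
    have hgb := (hF C g hC hg).2
    simp only [Q]
    rw [oddExt_add, avg_add hL.weight' hfb hgb, solOp_add hL.weight hfb hgb,
      lowOp_add isOpen_upper (fun y hy => (hTd C f hC hf y hy).1)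
      (fun y hy => (hTd C g hC hg y hy).1) (fun y hy => (hTd C f hC hf y hy).2)
      (fun y hy => (hTd C g hC hg y hy).2) hx]
    ring
  have hcongr : ∀ f g, EqOn f g (upper ν) → EqOn (Q f) (Q g) (upper ν) := by
    intro f g h x _
    simp only [Q, solOp, oddExt_congr h]
  have hf0 : HolderBdd α m (Kχ * δ) (upper ν) fun x => χ x * (-e x) :=
    hcut _ isOpen_upper convex_upper _ _ hδ0.le (he.neg hball)
  obtain ⟨h, hh, hh0, heq⟩ :=
    exists_sub_eq_of_contraction isOpen_upper convex_upper Q hQ hadd hcongr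
    (by positivity) hf0 (fun x _ hx => by rw [hχ0 x hx, zero_mul])
  have hpos : 0 ≤ 2 * (Kχ * δ) := by positivity
  obtain ⟨⟨C', hC', h0⟩, hbm⟩ := hF _ h hpos hh
  refine ⟨solOp ν η S h, (hT _ h hpos hh hh0).mono_const ?_, ?_, fun x hx => solOp_of_zero hL hx,
    fun x hx => ?_⟩
  · have : KT * Kχ * δ ≤ 1 / 4 := le_trans
        (mul_le_mul_of_nonneg_right (by rw [hB]; have : 0 ≤ Kχ * Kl * KT := by positivity
                                        linarith) hδ0.le) hδB
    linarith
  · exact continuous_iff_continuousAt.mpr fun x =>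
      (solOp_differentiableAt hL.weight hbm S x).1.continuousAt
  · rw [solOp_laplacian hL hα hC' h0 hS0 hx.1]
    have := heq x hx.1
    simp only [Q, hχ1 x hx.2] at this
    linarith

end Neumann

section Extension

open Filter

variable {n N : ℕ} {ν : Fin n} {v : Pt n → ℝ} {α C : ℝ} {x : Pt n} {c l : Fin N → ℝ}

lemma holderOnWith_of_norm_le {F : Type*} [NormedAddCommGroup F] {v : Pt n → F}
    {s : Set (Pt n)} (hα : 0 < α) (hC : 0 ≤ C)
    (h : ∀ x ∈ s, ∀ y ∈ s, ‖v x - v y‖ ≤ C * ‖x - y‖ ^ α) :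
    HolderOnWith C.toNNReal α.toNNReal v s := by
  intro x hx y hy
  rw [edist_dist, edist_dist, dist_eq_norm, dist_eq_norm, Real.coe_toNNReal α hα.le,
    ENNReal.ofReal_rpow_of_nonneg (norm_nonneg _) hα.le]
  change _ ≤ ENNReal.ofReal C * _
  rw [← ENNReal.ofReal_mul hC]
  exact ENNReal.ofReal_le_ofReal (h x hx y hy)

/-- Boundary values of a function on the half-space. -/
def bdryLim {n : ℕ} (ν : Fin n) (v : Pt n → ℝ) (x : Pt n) : ℝ :=
  limUnder atTop fun k : ℕ => v (x + Pi.single ν (1 / ((k : ℝ) + 1)))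

lemma add_single_mem_upper (hx : 0 ≤ x ν) (k : ℕ) :
    x + Pi.single ν (1 / ((k : ℝ) + 1)) ∈ upper ν := by
  have : (0 : ℝ) < 1 / ((k : ℝ) + 1) := by positivity
  simp only [upper, mem_ofPred_eq, Pi.add_apply, Pi.single_eq_same]
  linarith

lemma tendsto_add_single (x : Pt n) (ν : Fin n) :
    Tendsto (fun k : ℕ => x + Pi.single ν (1 / ((k : ℝ) + 1))) atTop (nhds x) := by
  have h1 : Tendsto (fun k : ℕ => 1 / ((k : ℝ) + 1)) atTop (nhds 0) :=
    tendsto_one_div_add_atTop_nhds_zero_nat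
  have h2 : Continuous fun t : ℝ => x + Pi.single ν t := by
    have : Continuous fun t : ℝ => (Pi.single ν t : Pt n) :=
      continuous_single (A := fun _ : Fin n => ℝ) ν
    fun_prop
  simpa [Function.comp_def] using (h2.tendsto 0).comp h1

lemma tendsto_bdryLim (hv : HolderBdd α 0 C (upper ν) v) (hα : 0 < α) (hC : 0 ≤ C)
    (hx : 0 ≤ x ν) : Tendsto (fun k : ℕ => v (x + Pi.single ν (1 / ((k : ℝ) + 1)))) atTop
      (nhds (bdryLim ν v x)) := by
  have hu := (holderOnWith_of_norm_le (v := v) hα hC hv.2).uniformContinuousOn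
    (Real.toNNReal_pos.mpr hα)
  have hc : Cauchy (map (fun k : ℕ => x + Pi.single ν (1 / ((k : ℝ) + 1))) atTop) :=
    (tendsto_add_single x ν).cauchySeq
  have : CauchySeq fun k : ℕ => v (x + Pi.single ν (1 / ((k : ℝ) + 1))) :=
    hc.map_of_le hu (le_principal_iff.mpr (mem_map.mpr (Eventually.of_forall fun k =>
      add_single_mem_upper hx k)))
  exact CauchySeq.tendsto_limUnder this

lemma bdryLim_eq (hv : HolderBdd α 0 C (upper ν) v) (hα : 0 < α) (hx : x ∈ upper ν) :
    bdryLim ν v x = v x := by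
  have hc := ((hv.continuousOn hα).continuousAt (isOpen_upper.mem_nhds hx)).tendsto.comp
    (tendsto_add_single x ν)
  exact hc.limUnder_eq

/-- Fold the lower half-space onto the upper one, scaling by `a` in the normal direction. -/
def fold {n : ℕ} (ν : Fin n) (a : ℝ) (x : Pt n) : Pt n :=
  Function.update x ν (max (x ν) (-(a * x ν)))

lemma fold_nonneg {a : ℝ} (ha : 0 ≤ a) : 0 ≤ fold ν a x ν := by
  simp only [fold, Function.update_self, le_max_iff]
  rcases le_total 0 (x ν) with h | h
  · exact Or.inl h
  · exact Or.inr (by have := mul_nonpos_of_nonneg_of_nonpos ha h; linarith)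

lemma norm_fold_sub_le {a : ℝ} (ha : 0 ≤ a) (x y : Pt n) :
    ‖fold ν a x - fold ν a y‖ ≤ (1 + a) * ‖x - y‖ := by
  refine (pi_norm_le_iff_of_nonneg (by positivity)).mpr fun i => ?_
  have hi := norm_le_pi_norm (x - y) i
  rw [Pi.sub_apply, Real.norm_eq_abs] at *
  by_cases h : i = ν
  · subst h
    simp only [fold, Function.update_self]
    refine (abs_max_sub_max_le_max _ _ _ _).trans (max_le ?_ ?_)
    · nlinarith [norm_nonneg (x - y)]
    · rw [show -(a * x i) - -(a * y i) = -(a * (x i - y i)) by ring, abs_neg, abs_mul,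
        abs_of_nonneg ha]
      nlinarith [norm_nonneg (x - y)]
  · simp only [fold, Function.update_of_ne h]
    nlinarith [norm_nonneg (x - y)]

/-- Hestenes reflection with weights `c` and slopes `l`. -/
def hestenes {n N : ℕ} (ν : Fin n) (c l : Fin N → ℝ) (v : Pt n → ℝ) (x : Pt n) : ℝ :=
  ∑ j, c j * bdryLim ν v (fold ν (l j) x)

lemma hestenes_holder (hv : HolderBdd α 0 C (upper ν) v) (hα : α ∈ Ioo (0 : ℝ) 1) (hC : 0 ≤ C)
    (hl : ∀ j, 0 ≤ l j) :
    HolderBdd α 0 (∑ j, |c j| * ((1 + l j) * C)) univ (hestenes ν c l v) := by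
  refine HolderBdd.sum _ isOpen_univ fun j _ => HolderBdd.const_mul ?_ isOpen_univ _
  have hlj := hl j
  refine ⟨fun x _ => ?_, fun x _ y _ => ?_⟩
  · refine (le_of_tendsto' (tendsto_bdryLim hv hα.1 hC (fold_nonneg hlj)).abs fun k =>
      hv.bound _ (add_single_mem_upper (fold_nonneg hlj) k)).trans ?_
    nlinarith
  · have h1 := ((tendsto_bdryLim hv hα.1 hC (fold_nonneg (x := x) hlj)).sub
      (tendsto_bdryLim hv hα.1 hC (fold_nonneg (x := y) hlj))).abs
    refine (le_of_tendsto' (b := C * ‖fold ν (l j) x - fold ν (l j) y‖ ^ α) h1 fun k => ?_).trans ?_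
    · have := hv.2 _ (add_single_mem_upper (fold_nonneg (x := x) hlj) k)
        _ (add_single_mem_upper (fold_nonneg (x := y) hlj) k)
      rwa [add_sub_add_right_eq_sub] at this
    have h2 : ‖fold ν (l j) x - fold ν (l j) y‖ ^ α ≤ (1 + l j) * ‖x - y‖ ^ α := by
      refine (Real.rpow_le_rpow (norm_nonneg _) (norm_fold_sub_le hlj x y) hα.1.le).trans ?_
      rw [Real.mul_rpow (by positivity) (norm_nonneg _)]
      refine mul_le_mul_of_nonneg_right ?_ (Real.rpow_nonneg (norm_nonneg _) _)
      exact Real.rpow_le_self_of_one_le (by linarith) hα.2.le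
    calc _ ≤ C * ((1 + l j) * ‖x - y‖ ^ α) := mul_le_mul_of_nonneg_left h2 hC
      _ = _ := by ring

lemma hestenes_of_mem (hv : HolderBdd α 0 C (upper ν) v) (hα : 0 < α) (hl : ∀ j, 0 ≤ l j)
    (hx : x ∈ upper ν) : hestenes ν c l v x = (∑ j, c j) * v x := by
  have : ∀ j, fold ν (l j) x = x := by
    intro j
    have h1 : 0 < x ν := hx
    have := mul_nonneg (hl j) h1.le
    rw [fold, max_eq_left (by linarith), Function.update_eq_self]
  simp only [hestenes, this, bdryLim_eq hv hα hx, Finset.sum_mul]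

/-- The linear map multiplying the normal coordinate by `a`. -/
def stretch {n : ℕ} (ν : Fin n) (a : ℝ) : Pt n →L[ℝ] Pt n :=
  ContinuousLinearMap.pi fun i => (if i = ν then a else 1) • ContinuousLinearMap.proj i

lemma stretch_apply (a : ℝ) (x : Pt n) (i : Fin n) :
    stretch ν a x i = (if i = ν then a else 1) * x i := by
  rw [stretch, ContinuousLinearMap.pi_apply]
  rfl

lemma pd_comp_clm {f : Pt n → ℝ} (A : Pt n →L[ℝ] Pt n) (hf : DifferentiableAt ℝ f (A x)) :
    DifferentiableAt ℝ (fun y => f (A y)) x ∧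
      ∀ i, pd i (fun y => f (A y)) x = ∑ k, A (Pi.single i 1) k * pd k f (A x) := by
  have h : HasFDerivAt (fun y => f (A y)) ((fderiv ℝ f (A x)).comp A) x :=
    hf.hasFDerivAt.comp x A.hasFDerivAt
  refine ⟨h.differentiableAt, fun i => ?_⟩
  rw [pd, h.fderiv, ContinuousLinearMap.comp_apply, fderiv_apply_eq_sum_pd]

lemma hestenes_of_neg (hv : HolderBdd α 0 C (upper ν) v) (hα : 0 < α) (hl : ∀ j, 0 < l j)
    (hx : x ν < 0) : hestenes ν c l v x = ∑ j, c j * v (stretch ν (-l j) x) := by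
  refine Finset.sum_congr rfl fun j _ => ?_
  have h1 : x ν ≤ -(l j * x ν) := by nlinarith [hl j]
  have e : fold ν (l j) x = stretch ν (-l j) x := by
    ext i
    rw [fold, max_eq_right h1, stretch_apply]
    by_cases h : i = ν
    · subst h; simp
    · simp [h]
  rw [e, bdryLim_eq hv hα]
  simp only [upper, mem_ofPred_eq, stretch_apply]
  simp only [if_true]
  nlinarith [hl j]

lemma closure_upper_of_nonneg (hx : 0 ≤ x ν) : x ∈ closure (upper ν) :=
  mem_closure_of_tendsto (tendsto_add_single x ν) (Eventually.of_forall (add_single_mem_upper hx))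

/-- A continuous function whose partial derivatives off a hyperplane extend continuously is
differentiable. -/
lemma differentiableAt_of_off_hyperplane {f : Pt n → ℝ} {G : Fin n → Pt n → ℝ}
    (hf : Continuous f) (hG : ∀ i, Continuous (G i))
    (h : ∀ x, x ν ≠ 0 → DifferentiableAt ℝ f x ∧ ∀ i, pd i f x = G i x) (x : Pt n) :
    DifferentiableAt ℝ f x ∧ ∀ i, pd i f x = G i x := by
  set L : Pt n → Pt n →L[ℝ] ℝ := fun y => ∑ j, G j y • ContinuousLinearMap.proj (R := ℝ)
        (φ := fun _ : Fin n => ℝ) j with hL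
  have hLc : Continuous L := by
    rw [hL]
    exact continuous_finsetSum _ fun j _ => (hG j).smul continuous_const
  have key : ∀ s : Set (Pt n), IsOpen s → Convex ℝ s → (∀ y ∈ s, y ν ≠ 0) →
      HasFDerivWithinAt f (L x) (closure s) x := by
    intro s hs hc hne
    refine hasFDerivWithinAt_closure_of_tendsto_fderiv
      (fun y hy => (h y (hne y hy)).1.differentiableWithinAt) hc hs
      (fun y _ => hf.continuousWithinAt) ?_
    refine (hLc.continuousWithinAt (s := s) (x := x)).tendsto.congr' ?_
    filter_upwards [self_mem_nhdsWithin] with y hy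
    have := (h y (hne y hy)).1.hasFDerivAt_sum_proj.fderiv
    simp only [(h y (hne y hy)).2] at this
    exact this.symm
  have h1 := key (upper ν) isOpen_upper convex_upper fun y hy => (ne_of_gt hy)
  have h2 := key {y | y ν < 0} (isOpen_lt (continuous_apply ν) continuous_const)
    (convex_halfSpace_lt ⟨fun _ _ => rfl, fun _ _ => rfl⟩ 0) fun y hy => ne_of_lt hy
  have huniv : closure (upper ν) ∪ closure {y : Pt n | y ν < 0} = univ := by
    refine eq_univ_of_forall fun y => ?_
    rcases le_or_gt 0 (y ν) with hy | hy
    · exact Or.inl (closure_upper_of_nonneg hy)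
    · exact Or.inr (subset_closure hy)
  have h3 := h1.union h2
  rw [huniv, hasFDerivWithinAt_univ] at h3
  exact ⟨h3.differentiableAt, fun i => pd_eq_of_hasFDerivAt_sum_proj h3 i⟩

lemma hestenes_holderBdd (hα : α ∈ Ioo (0 : ℝ) 1) (m : ℕ) (hl : ∀ j, 0 < l j) :
    ∀ (c : Fin N → ℝ) (C : ℝ) (v : Pt n → ℝ), (∀ i ≤ m, ∑ j, c j * (-l j) ^ i = 1) → 0 ≤ C →
      HolderBdd α m C (upper ν) v →
      ∃ C', 0 ≤ C' ∧ HolderBdd α m C' univ (hestenes ν c l v) := by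
  have hl' : ∀ j, 0 ≤ l j := fun j => (hl j).le
  induction m with
  | zero =>
    intro c C v _ hC hv
    exact ⟨_, Finset.sum_nonneg fun j _ => by have := hl' j; positivity,
      hestenes_holder hv hα hC hl'⟩
  | succ m ih =>
    intro c C v hc hC hv
    have low : ∀ (m : ℕ) (C : ℝ) (u : Pt n → ℝ), 0 ≤ C → HolderBdd α m C (upper ν) u →
        ∃ C', 0 ≤ C' ∧ HolderBdd α 0 C' (upper ν) u := by
      intro m
      induction m with
      | zero => exact fun C u hC hu => ⟨C, hC, hu⟩
      | succ m ih => exact fun C u hC hu => ih _ _ (by positivity) (hu.of_succ hα convex_upper hC)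
    obtain ⟨C0, hC0, hv0⟩ := low _ _ _ hC hv
    set d : Fin n → Fin N → ℝ := fun i j => (if i = ν then -l j else 1) * c j with hd
    have hdm : ∀ i, ∀ k ≤ m, ∑ j, d i j * (-l j) ^ k = 1 := by
      intro i k hk
      by_cases h : i = ν
      · rw [← hc (k + 1) (by omega)]
        refine Finset.sum_congr rfl fun j _ => ?_
        simp only [hd, if_pos h]; ring
      · rw [← hc k (by omega)]
        simp only [hd, if_neg h, one_mul]
    have hpdv : ∀ i, HolderBdd α m C (upper ν) (pd i v) := hv.2.2
    choose D hD hE using fun i => ih (d i) C (pd i v) (hdm i) hC (hpdv i)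
    have hpd0 := fun i => low _ _ _ hC (hpdv i)
    choose D0 hD0 hE0 using hpd0
    have hcont : ∀ (c : Fin N → ℝ) (u : Pt n → ℝ) (C : ℝ), 0 ≤ C → HolderBdd α 0 C (upper ν) u →
        Continuous (hestenes ν c l u) := fun c u C hC hu =>
      continuousOn_univ.mp ((hestenes_holder hu hα hC hl').continuousOn hα.1)
    have hsum1 : ∀ {c : Fin N → ℝ}, ∑ j, c j * (-l j) ^ 0 = 1 → ∑ j, c j = 1 := by
      intro c h; simpa using h
    have hder : ∀ x, DifferentiableAt ℝ (hestenes ν c l v) x ∧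
        ∀ i, pd i (hestenes ν c l v) x = hestenes ν (d i) l (pd i v) x := by
      refine differentiableAt_of_off_hyperplane (ν := ν) (hcont c v C0 hC0 hv0)
        (fun i => hcont _ _ _ (hD0 i) (hE0 i)) fun x hx => ?_
      rcases lt_or_gt_of_ne hx with hx | hx
      · have hmem : ∀ j, stretch ν (-l j) x ∈ upper ν := by
          intro j
          simp only [upper, mem_ofPred_eq, stretch_apply]
          simp only [if_true]
          nlinarith [hl j]
        have e : hestenes ν c l v =ᶠ[nhds x] fun y => ∑ j, c j * v (stretch ν (-l j) y) := by
          filter_upwards [(isOpen_lt (continuous_apply ν) continuous_const).mem_nhds hx] with y hy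
            using hestenes_of_neg hv0 hα.1 hl hy
        have hj := fun j => pd_comp_clm (stretch ν (-l j)) (hv.2.1 _ (hmem j))
        refine ⟨(DifferentiableAt.fun_sum fun j _ =>
          ((hj j).1.const_mul (c j))).congr_of_eventuallyEq
          e, fun i => ?_⟩
        rw [pd_congr i e, pd_sum _ fun j _ => (hj j).1.const_mul (c j),
          hestenes_of_neg (hE0 i) hα.1 hl hx]
        refine Finset.sum_congr rfl fun j _ => ?_
        rw [pd_const_mul i _ (hj j).1, (hj j).2 i, Finset.sum_eq_single i]
        · simp only [stretch_apply, Pi.single_eq_same, hd]; ring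
        · intro k _ hk
          simp [stretch_apply, hk]
        · simp
      · have e : hestenes ν c l v =ᶠ[nhds x] v := by
          filter_upwards [isOpen_upper.mem_nhds hx] with y hy
          rw [hestenes_of_mem hv0 hα.1 hl' hy, hsum1 (hc 0 (by omega)), one_mul]
        refine ⟨(hv.2.1 x hx).congr_of_eventuallyEq e, fun i => ?_⟩
        rw [pd_congr i e, hestenes_of_mem (hE0 i) hα.1 hl' hx, hsum1 (hdm i 0 (by omega)), one_mul]
    have hb := hestenes_holder (c := c) hv0 hα hC0 hl'
    have hb0 : 0 ≤ ∑ j, |c j| * ((1 + l j) * C0) :=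
      Finset.sum_nonneg fun j _ => by have := hl' j; positivity
    refine ⟨∑ j, |c j| * ((1 + l j) * C0) + ∑ i, D i, add_nonneg hb0 (Finset.sum_nonneg fun i _ =>
      hD i), fun x hx => (hb.1 x hx).trans ?_, fun x _ => (hder x).1, fun i => ?_⟩
    · have := Finset.sum_nonneg fun i (_ : i ∈ Finset.univ) => hD i
      linarith
    · rw [show pd i (hestenes ν c l v) = _ from funext fun x => (hder x).2 i]
      refine (hE i).mono_const ?_
      have := Finset.single_le_sum (fun i _ => hD i) (Finset.mem_univ i)
      linarith

/-- Extension of Hölder functions from the half-space. -/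
lemma HolderBdd.exists_extension (hα : α ∈ Ioo (0 : ℝ) 1) (m : ℕ) (hC : 0 ≤ C)
    (hv : HolderBdd α m C (upper ν) v) :
    ∃ C' u, 0 ≤ C' ∧ HolderBdd α m C' univ u ∧ EqOn u v (upper ν) := by
  set l : Fin (m + 1) → ℝ := fun j => (j : ℝ) + 1 with hl
  have hlpos : ∀ j, 0 < l j := fun j => by positivity
  have hdet : IsUnit (Matrix.vandermonde fun j => -l j) := by
    rw [Matrix.isUnit_iff_isUnit_det, isUnit_iff_ne_zero, Matrix.det_vandermonde_ne_zero_iff]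
    intro i j h
    simpa [hl, Fin.val_inj] using h
  obtain ⟨c, hc⟩ := (Matrix.vecMul_surjective_iff_isUnit.mpr hdet) fun _ => 1
  have hcm : ∀ i ≤ m, ∑ j, c j * (-l j) ^ i = 1 := by
    intro i hi
    have := congrFun hc ⟨i, by omega⟩
    simpa [Matrix.vecMul, dotProduct, Matrix.vandermonde_apply] using this
  obtain ⟨C', hC', h⟩ := hestenes_holderBdd hα m hlpos c C v hcm hC hv
  refine ⟨C', hestenes ν c l v, hC', h, fun x hx => ?_⟩
  obtain ⟨C0, hC0, hv0⟩ : ∃ C', 0 ≤ C' ∧ HolderBdd α 0 C' (upper ν) v := by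
    clear * - hC hv hα
    induction m generalizing C with
    | zero => exact ⟨C, hC, hv⟩
    | succ m ih =>
      have h' : (0 : ℝ) ≤ (n + 2) * C := by positivity
      exact ih h' (hv.of_succ hα convex_upper hC)
  have : ∑ j, c j = 1 := by simpa using hcm 0 (by omega)
  rw [hestenes_of_mem hv0 hα.1 (fun j => (hlpos j).le) hx, this, one_mul]

end Extension

/-! ### Hölder regularity near the origin -/

/-- `f` is of class `C^{m+α}` near the origin. -/
def LocHolder {n : ℕ} (α : ℝ) (m : ℕ) (f : Pt n → ℝ) : Prop :=
  ∃ r > 0, ∃ C, HolderBdd α m C (Metric.ball 0 r) f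

namespace LocHolder

variable {n : ℕ} {α : ℝ} {m : ℕ} {f g : Pt n → ℝ}

lemma exists_forall_le (h : LocHolder α m f) : ∃ C, 0 ≤ C ∧ ∃ r > 0, ∀ s, s ≤ r →
    HolderBdd α m C (Metric.ball 0 s) f := by
  obtain ⟨r, hr, C, hC⟩ := h
  exact ⟨C, hC.const_nonneg (Metric.mem_ball_self hr), r, hr,
    fun s hs => hC.mono_set (Metric.ball_subset_ball hs)⟩

lemma congr (h : LocHolder α m f) (hfg : g =ᶠ[nhds 0] f) : LocHolder α m g := by
  obtain ⟨C, -, r, hr, hC⟩ := h.exists_forall_le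
  obtain ⟨s, hs, hfg⟩ := Metric.eventually_nhds_iff_ball.mp hfg
  exact ⟨min r s, lt_min hr hs, C, (hC _ (min_le_left _ _)).congr Metric.isOpen_ball
    fun x hx => hfg x (Metric.ball_subset_ball (min_le_right _ _) hx)⟩

lemma of_succ (h : LocHolder α (m + 1) f) (hα : α ∈ Ioo (0 : ℝ) 1) : LocHolder α m f := by
  obtain ⟨r, hr, C, hC⟩ := h
  exact ⟨r, hr, _, hC.of_succ hα (convex_ball _ _) (hC.const_nonneg (Metric.mem_ball_self hr))⟩

lemma of_le (hα : α ∈ Ioo (0 : ℝ) 1) {m' : ℕ} (h : LocHolder α m f) (hm : m' ≤ m) :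
    LocHolder α m' f := by
  induction hm with
  | refl => exact h
  | step _ ih => exact ih (h.of_succ hα)

lemma partialDeriv (h : LocHolder α (m + 1) f) (i : Fin n) : LocHolder α m (pd i f) := by
  obtain ⟨r, hr, C, hC⟩ := h
  exact ⟨r, hr, C, hC.2.2 i⟩

lemma eventually_differentiableAt (h : LocHolder α (m + 1) f) :
    ∀ᶠ x in nhds 0, DifferentiableAt ℝ f x := by
  obtain ⟨r, hr, C, hC⟩ := h
  exact Filter.eventually_of_mem (Metric.ball_mem_nhds 0 hr) hC.2.1

lemma continuousAt (h : LocHolder α m f) (hα : 0 < α) : ContinuousAt f 0 := by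
  obtain ⟨r, hr, C, hC⟩ := h
  exact (hC.continuousOn hα).continuousAt (Metric.ball_mem_nhds 0 hr)

lemma const (a : ℝ) : LocHolder (n := n) α m (fun _ => a) :=
  ⟨1, one_pos, |a|, HolderBdd.const a le_rfl⟩

lemma add (h : LocHolder α m f) (h' : LocHolder α m g) : LocHolder α m (fun x => f x + g x) := by
  obtain ⟨C, -, r, hr, hC⟩ := h.exists_forall_le
  obtain ⟨C', -, r', hr', hC'⟩ := h'.exists_forall_le
  exact ⟨min r r', lt_min hr hr', _,
    (hC _ (min_le_left _ _)).add (hC' _ (min_le_right _ _)) Metric.isOpen_ball⟩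

lemma mul (hα : α ∈ Ioo (0 : ℝ) 1) (h : LocHolder α m f) (h' : LocHolder α m g) :
    LocHolder α m (fun x => f x * g x) := by
  obtain ⟨C, h0, r, hr, hC⟩ := h.exists_forall_le
  obtain ⟨C', h0', r', hr', hC'⟩ := h'.exists_forall_le
  obtain ⟨K, -, hK⟩ := HolderBdd.exists_mul n hα m
  exact ⟨min r r', lt_min hr hr', _, hK _ Metric.isOpen_ball (convex_ball _ _) _ _ _ _ h0 h0'
    (hC _ (min_le_left _ _)) (hC' _ (min_le_right _ _))⟩

lemma const_mul (h : LocHolder α m f) (a : ℝ) : LocHolder α m (fun x => a * f x) := by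
  obtain ⟨r, hr, C, hC⟩ := h
  exact ⟨r, hr, _, hC.const_mul Metric.isOpen_ball a⟩

lemma neg (h : LocHolder α m f) : LocHolder α m (fun x => - f x) := by
  simpa using h.const_mul (-1)

lemma sub (h : LocHolder α m f) (h' : LocHolder α m g) : LocHolder α m (fun x => f x - g x) := by
  simpa [sub_eq_add_neg] using h.add h'.neg

lemma sum {ι : Type*} (T : Finset ι) {F : ι → Pt n → ℝ} (h : ∀ i ∈ T, LocHolder α m (F i)) :
    LocHolder α m (fun x => ∑ i ∈ T, F i x) := by
  classical
  induction T using Finset.induction_on with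
  | empty => simpa using const 0
  | insert a T ha ih =>
    simp only [Finset.sum_insert ha]
    exact (h a (by simp)).add (ih fun i hi => h i (by simp [hi]))

lemma prod (hα : α ∈ Ioo (0 : ℝ) 1) {ι : Type*} (T : Finset ι) {F : ι → Pt n → ℝ}
    (h : ∀ i ∈ T, LocHolder α m (F i)) : LocHolder α m (fun x => ∏ i ∈ T, F i x) := by
  classical
  induction T using Finset.induction_on with
  | empty => simpa using const 1
  | insert a T ha ih =>
    simp only [Finset.prod_insert ha]
    exact (h a (by simp)).mul hα (ih fun i hi => h i (by simp [hi]))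

lemma succ_of_pd (h : LocHolder α 0 f) (hd : ∀ᶠ x in nhds 0, DifferentiableAt ℝ f x)
    (hp : ∀ i, LocHolder α m (pd i f)) : LocHolder α (m + 1) f := by
  obtain ⟨C, h0, r, hr, hC⟩ := h.exists_forall_le
  obtain ⟨s, hs, hd⟩ := Metric.eventually_nhds_iff_ball.mp hd
  choose C' h0' r' hr' hC' using fun i => (hp i).exists_forall_le
  obtain ⟨ρ, hρ, hle⟩ : ∃ ρ > 0, ∀ i, ρ ≤ r' i := by
    have : ∀ᶠ ρ in nhdsWithin (0 : ℝ) (Ioi 0), ∀ i, ρ ≤ r' i := by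
      rw [Filter.eventually_all]
      exact fun i => mem_nhdsWithin_of_mem_nhds (Iic_mem_nhds (hr' i))
    obtain ⟨ρ, h1, h2⟩ := (this.and self_mem_nhdsWithin).exists
    exact ⟨ρ, h2, h1⟩
  refine ⟨min r (min s ρ), lt_min hr (lt_min hs hρ), C + ∑ i, C' i, ?_, ?_, fun i => ?_⟩
  · intro x hx
    have := (hC _ (min_le_left r (min s ρ))).bound x hx
    linarith [Finset.sum_nonneg fun i (_ : i ∈ Finset.univ) => h0' i]
  · exact fun x hx => hd x (Metric.ball_subset_ball
      ((min_le_right _ _).trans (min_le_left _ _)) hx)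
  · refine (hC' i _ ((min_le_right _ _).trans ((min_le_right _ _).trans (hle i)))).mono_const ?_
    linarith [Finset.single_le_sum (fun i _ => h0' i) (Finset.mem_univ i)]

lemma comp (hα : α ∈ Ioo (0 : ℝ) 1) {φ : ℝ → ℝ} (h : LocHolder α m f)
    (hφ : ContDiffAt ℝ (⊤ : ℕ∞) φ (f 0)) : LocHolder α m (fun x => φ (f x)) := by
  have base : ∀ {f : Pt n → ℝ} {φ : ℝ → ℝ}, LocHolder α 0 f →
      ContDiffAt ℝ (⊤ : ℕ∞) φ (f 0) → LocHolder α 0 (fun x => φ (f x)) := by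
    intro f φ h hφ
    obtain ⟨K, t, ht, hK⟩ := (hφ.of_le (m := 1) (by simp)).exists_lipschitzOnWith
    have hc := h.continuousAt hα.1
    obtain ⟨C, h0, r, hr, hC⟩ := h.exists_forall_le
    have h1 : ∀ᶠ x in nhds (0 : Pt n), f x ∈ t := hc ht
    have h2 : ∀ᶠ x in nhds (0 : Pt n), |φ (f x)| < |φ (f 0)| + 1 :=
      (hφ.continuousAt.comp hc).abs.eventually (gt_mem_nhds (lt_add_one _))
    obtain ⟨s, hs, h3⟩ := Metric.eventually_nhds_iff_ball.mp (h1.and h2)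
    refine ⟨min r s, lt_min hr hs, (|φ (f 0)| + 1) + K * C, fun x hx => ?_, fun x hx y hy => ?_⟩
    · have := (h3 x (Metric.ball_subset_ball (min_le_right _ _) hx)).2
      have : 0 ≤ (K : ℝ) * C := by positivity
      linarith
    · have hx' := (h3 x (Metric.ball_subset_ball (min_le_right _ _) hx)).1
      have hy' := (h3 y (Metric.ball_subset_ball (min_le_right _ _) hy)).1
      have h4 := hK.dist_le_mul _ hx' _ hy'
      rw [Real.dist_eq, Real.dist_eq] at h4
      have h5 := (hC _ (min_le_left r s)).2 x hx y hy
      have h6 : 0 ≤ ‖x - y‖ ^ α := Real.rpow_nonneg (norm_nonneg _) _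
      have h7 : 0 ≤ |φ (f 0)| := abs_nonneg _
      have h8 := mul_le_mul_of_nonneg_left h5 K.coe_nonneg
      nlinarith
  induction m generalizing φ with
  | zero => exact base h hφ
  | succ m ih =>
    have hev : ∀ᶠ x in nhds (0 : Pt n), DifferentiableAt ℝ φ (f x) := by
      have h1 : ∀ᶠ y in nhds (f 0), ContDiffAt ℝ 1 φ y :=
        (hφ.of_le (m := 1) (by simp)).eventually (by simp)
      filter_upwards [(h.continuousAt hα.1).eventually h1] with x hx
      exact hx.differentiableAt (by simp)
    have hφ' : ContDiffAt ℝ (⊤ : ℕ∞) (deriv φ) (f 0) := by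
      have h1 : ContDiffAt ℝ (⊤ : ℕ∞) (fderiv ℝ φ) (f 0) := hφ.fderiv_right (by simp)
      exact h1.clm_apply contDiffAt_const
    refine succ_of_pd (base (h.of_le hα (Nat.zero_le _)) hφ) ?_ fun i => ?_
    · filter_upwards [hev, h.eventually_differentiableAt] with x h1 h2
      exact h1.comp x h2
    · refine ((ih (h.of_succ hα) hφ').mul hα (h.partialDeriv i)).congr ?_
      filter_upwards [hev, h.eventually_differentiableAt] with x h1 h2
      have := (h1.hasDerivAt.comp_hasFDerivAt x h2.hasFDerivAt).fderiv
      simp only [pd]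
      rw [show (fun y => φ (f y)) = φ ∘ f from rfl, this]
      simp

end LocHolder

/-! ### Comparison with `CHolderOn` -/

lemma LocHolder.of_contDiffAt {n : ℕ} {α : ℝ} (hα : α ∈ Ioo (0 : ℝ) 1) {f : Pt n → ℝ}
    (hf : ContDiffAt ℝ 1 f 0) : LocHolder α 0 f := by
  obtain ⟨K, t, ht, hK⟩ := hf.exists_lipschitzOnWith
  have h2 : ∀ᶠ x in nhds (0 : Pt n), |f x| < |f 0| + 1 :=
    hf.continuousAt.abs.eventually (gt_mem_nhds (lt_add_one _))
  obtain ⟨r, hr, h3⟩ := Metric.eventually_nhds_iff_ball.mp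
    ((Filter.eventually_mem_set.mpr ht).and h2)
  have hC : 0 ≤ |f 0| := abs_nonneg _
  refine ⟨r, hr, 2 * (|f 0| + 1) + K, fun x hx => ?_, fun x hx y hy => ?_⟩
  · have := (h3 x hx).2
    have := K.coe_nonneg
    linarith
  · have h4 := hK.dist_le_mul _ (h3 x hx).1 _ (h3 y hy).1
    rw [Real.dist_eq, dist_eq_norm] at h4
    have h5 : |f x - f y| ≤ 2 * (|f 0| + 1) := by
      have := abs_sub (f x) (f y)
      linarith [(h3 x hx).2, (h3 y hy).2]
    exact holder_of_bounded_of_lipschitz hα (norm_nonneg _) (by positivity) K.coe_nonneg h5 h4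

/-- The pointwise partial derivative as a continuous linear functional of the differential. -/
def evalDir {n : ℕ} (i : Fin n) : (Pt n →L[ℝ] ℝ) →L[ℝ] ℝ :=
  ContinuousLinearMap.apply ℝ ℝ (Pi.single i 1)

lemma norm_compCMM_sub_le {n k : ℕ} {E F : Type*} [NormedAddCommGroup E] [NormedSpace ℝ E]
    [NormedAddCommGroup F] [NormedSpace ℝ F] (L : E →L[ℝ] F)
    (p q : ContinuousMultilinearMap ℝ (fun _ : Fin k => Pt n) E) :
    ‖L.compContinuousMultilinearMap p - L.compContinuousMultilinearMap q‖ ≤ ‖L‖ * ‖p - q‖ := by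
  have : L.compContinuousMultilinearMap p - L.compContinuousMultilinearMap q =
      L.compContinuousMultilinearMap (p - q) := by
    ext v; simp
  rw [this]
  exact L.norm_compContinuousMultilinearMap_le _

lemma norm_iteratedFDerivWithin_succ_sub {n k : ℕ} {f : Pt n → ℝ} {s : Set (Pt n)}
    (hs : UniqueDiffOn ℝ s) {x y : Pt n} (hx : x ∈ s) (hy : y ∈ s) :
    ‖iteratedFDerivWithin ℝ (k + 1) f s x - iteratedFDerivWithin ℝ (k + 1) f s y‖ =
      ‖iteratedFDerivWithin ℝ k (fderivWithin ℝ f s) s x -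
        iteratedFDerivWithin ℝ k (fderivWithin ℝ f s) s y‖ := by
  rw [← dist_eq_norm, ← dist_eq_norm, iteratedFDerivWithin_succ_eq_comp_right hs hx,
    iteratedFDerivWithin_succ_eq_comp_right hs hy]
  exact LinearIsometryEquiv.dist_map _ _ _

lemma LocHolder.of_iteratedFDerivWithin {n : ℕ} {α : ℝ} (hα : α ∈ Ioo (0 : ℝ) 1)
    {Ω : Set (Pt n)} (hΩ : IsOpen Ω) (h0 : (0 : Pt n) ∈ Ω) (k : ℕ) {f : Pt n → ℝ}
    (hf : ContDiffOn ℝ k f Ω) {C : ℝ} (hC : 0 ≤ C) {t : Set (Pt n)} (ht : t ∈ nhds 0)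
    (htΩ : t ⊆ Ω)
    (h : ∀ x ∈ t, ∀ y ∈ t, ‖iteratedFDerivWithin ℝ k f Ω x - iteratedFDerivWithin ℝ k f Ω y‖ ≤
      C * ‖x - y‖ ^ α) : LocHolder α k f := by
  induction k generalizing f C with
  | zero =>
    have hc : ContinuousAt f 0 := hf.continuousOn.continuousAt (hΩ.mem_nhds h0)
    have h2 : ∀ᶠ x in nhds (0 : Pt n), |f x| < |f 0| + 1 :=
      hc.abs.eventually (gt_mem_nhds (lt_add_one _))
    obtain ⟨r, hr, h3⟩ := Metric.eventually_nhds_iff_ball.mp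
      ((Filter.eventually_mem_set.mpr ht).and h2)
    refine ⟨r, hr, |f 0| + 1 + C, fun x hx => ?_, fun x hx y hy => ?_⟩
    · linarith [(h3 x hx).2]
    · have h4 := h x (h3 x hx).1 y (h3 y hy).1
      rw [iteratedFDerivWithin_zero_eq_comp, Function.comp_apply, Function.comp_apply,
        ← map_sub, LinearIsometryEquiv.norm_map, Real.norm_eq_abs] at h4
      have h6 : 0 ≤ ‖x - y‖ ^ α := Real.rpow_nonneg (norm_nonneg _) _
      nlinarith [abs_nonneg (f 0)]
  | succ k ih =>
    have hu : UniqueDiffOn ℝ Ω := hΩ.uniqueDiffOn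
    have hf1 : ContDiffOn ℝ k (fderivWithin ℝ f Ω) Ω :=
      hf.fderivWithin hu (by norm_cast)
    have hat : ContDiffAt ℝ 1 f 0 :=
      (hf.contDiffAt (hΩ.mem_nhds h0)).of_le (by norm_cast; omega)
    refine LocHolder.succ_of_pd (LocHolder.of_contDiffAt hα hat) ?_ fun i => ?_
    · filter_upwards [hΩ.mem_nhds h0] with x hx
      exact (hf.contDiffAt (hΩ.mem_nhds hx)).differentiableAt (by simp)
    · have heq : EqOn (pd i f) (evalDir i ∘ fderivWithin ℝ f Ω) Ω := fun x hx => by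
        simp [pd, evalDir, fderivWithin_of_isOpen hΩ hx]
      refine ih (C := ‖evalDir i‖ * C) (((evalDir i).contDiff.comp_contDiffOn hf1).congr heq)
        (by positivity) fun x hx y hy => ?_
      have e : ∀ x ∈ Ω, iteratedFDerivWithin ℝ k (pd i f) Ω x =
          (evalDir i).compContinuousMultilinearMap
            (iteratedFDerivWithin ℝ k (fderivWithin ℝ f Ω) Ω x) := fun x hx => by
        rw [iteratedFDerivWithin_congr heq hx,
          (evalDir i).iteratedFDerivWithin_comp_left (hf1 x hx) hu hx le_rfl]
      have h4 := h x hx y hy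
      rw [norm_iteratedFDerivWithin_succ_sub hu (htΩ hx) (htΩ hy)] at h4
      rw [e x (htΩ hx), e y (htΩ hy), mul_assoc]
      exact (norm_compCMM_sub_le _ _ _).trans (mul_le_mul_of_nonneg_left h4 (norm_nonneg _))

lemma LocHolder.of_cHolderOn {n : ℕ} {α : ℝ} (hα : α ∈ Ioo (0 : ℝ) 1)
    {Ω : Set (Pt n)} (hΩ : IsOpen Ω) (h0 : (0 : Pt n) ∈ Ω) {k : ℕ} {f : Pt n → ℝ}
    (hf : CHolderOn k α Ω f) : LocHolder α k f := by
  obtain ⟨C, t, ht, hC⟩ := hf.2 0 h0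
  rw [hΩ.nhdsWithin_eq h0] at ht
  refine LocHolder.of_iteratedFDerivWithin hα hΩ h0 k hf.1 C.coe_nonneg
    (Filter.inter_mem ht (hΩ.mem_nhds h0)) inter_subset_right fun x hx y hy => ?_
  have := hC.dist_le hx.1 hy.1
  rwa [dist_eq_norm, dist_eq_norm, Real.coe_toNNReal α hα.1.le] at this

lemma HolderBdd.contDiff_and_iteratedFDeriv {n : ℕ} {α : ℝ} (hα : α ∈ Ioo (0 : ℝ) 1) (k : ℕ)
    {C : ℝ} (hC : 0 ≤ C) {f : Pt n → ℝ} (h : HolderBdd α k C univ f) :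
    ContDiff ℝ k f ∧ ∃ C' : ℝ, 0 ≤ C' ∧ ∀ x y,
      ‖iteratedFDeriv ℝ k f x - iteratedFDeriv ℝ k f y‖ ≤ C' * ‖x - y‖ ^ α := by
  induction k generalizing f with
  | zero =>
    refine ⟨?_, C, hC, fun x y => ?_⟩
    · have := h.continuousOn hα.1
      rw [continuousOn_univ] at this
      exact contDiff_zero.mpr this
    · rw [iteratedFDeriv_zero_eq_comp, Function.comp_apply, Function.comp_apply,
        ← map_sub, LinearIsometryEquiv.norm_map, Real.norm_eq_abs]
      exact h.2 x (mem_univ _) y (mem_univ _)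
  | succ k ih =>
    choose hcd C' hC' hH using fun i => ih (h.2.2 i)
    let L : Fin n → ℝ →L[ℝ] (Pt n →L[ℝ] ℝ) := fun i =>
      (ContinuousLinearMap.id ℝ ℝ).smulRight (ContinuousLinearMap.proj i)
    have hfd : fderiv ℝ f = fun x => ∑ i, (L i ∘ pd i f) x := by
      funext x; ext v
      rw [fderiv_apply_eq_sum_pd]
      simp [L, mul_comm]
    have hcdi : ∀ i, ContDiff ℝ k (L i ∘ pd i f) := fun i => (L i).contDiff.comp (hcd i)
    constructor
    · push_cast
      rw [contDiff_succ_iff_fderiv]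
      refine ⟨fun x => h.2.1 x (mem_univ _), by simp, ?_⟩
      rw [hfd]
      exact ContDiff.sum fun i _ => hcdi i
    · refine ⟨∑ i, ‖L i‖ * C' i,
        Finset.sum_nonneg fun i _ => mul_nonneg (norm_nonneg (L i)) (hC' i),
        fun x y => ?_⟩
      have e : ∀ x, iteratedFDeriv ℝ k (fderiv ℝ f) x =
          ∑ i, (L i).compContinuousMultilinearMap (iteratedFDeriv ℝ k (pd i f) x) := fun x => by
        rw [hfd, iteratedFDeriv_fun_sum_apply fun i _ => (hcdi i).contDiffAt]
        exact Finset.sum_congr rfl fun i _ =>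
          (L i).iteratedFDeriv_comp_left (hcd i).contDiffAt le_rfl
      rw [← iteratedFDerivWithin_univ,
        norm_iteratedFDerivWithin_succ_sub uniqueDiffOn_univ (mem_univ x) (mem_univ y),
        fderivWithin_univ, iteratedFDerivWithin_univ, e, e,
        ← Finset.sum_sub_distrib, Finset.sum_mul]
      refine (norm_sum_le _ _).trans ?_
      refine Finset.sum_le_sum fun i _ => ?_
      rw [mul_assoc]
      exact (norm_compCMM_sub_le _ _ _).trans
        (mul_le_mul_of_nonneg_left (hH i x y) (norm_nonneg _))

lemma HolderBdd.cHolderOn_univ {n : ℕ} {α : ℝ} (hα : α ∈ Ioo (0 : ℝ) 1) {k : ℕ}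
    {C : ℝ} (hC : 0 ≤ C) {f : Pt n → ℝ} (h : HolderBdd α k C univ f) :
    CHolderOn k α univ f := by
  obtain ⟨h1, C', hC', h2⟩ := h.contDiff_and_iteratedFDeriv hα k hC
  refine ⟨h1.contDiffOn, fun x _ => ⟨C'.toNNReal, univ, Filter.univ_mem,
    holderOnWith_of_norm_le hα.1 hC' fun x _ y _ => ?_⟩⟩
  rw [iteratedFDerivWithin_univ]
  exact h2 x y

/-! ### Regularity of the coefficients of the conformal Laplacian -/

section Geometry

variable {n m : ℕ} {α : ℝ}

lemma LocHolder.det (hα : α ∈ Ioo (0 : ℝ) 1) {A : Met n}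
    (h : ∀ a b, LocHolder α m (fun x => A x a b)) : LocHolder α m (fun x => (A x).det) := by
  simp only [Matrix.det_apply']
  exact LocHolder.sum _ fun σ _ => (LocHolder.prod hα _ fun i _ => h _ _).const_mul _

lemma LocHolder.inv_apply (hα : α ∈ Ioo (0 : ℝ) 1) {A : Met n}
    (h : ∀ a b, LocHolder α m (fun x => A x a b)) (h0 : (A 0).det ≠ 0) (a b : Fin n) :
    LocHolder α m (fun x => (A x)⁻¹ a b) := by
  have hd : LocHolder α m (fun x => ((A x).det)⁻¹) :=
    (LocHolder.det hα h).comp hα (contDiffAt_inv ℝ h0)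
  have hadj : LocHolder α m (fun x => (A x).adjugate a b) := by
    simp only [Matrix.adjugate_apply]
    refine LocHolder.det hα (A := fun x => (A x).updateRow b (Pi.single a 1)) fun i j => ?_
    by_cases hi : i = b
    · simpa [Matrix.updateRow_apply, hi] using LocHolder.const _
    · simpa [Matrix.updateRow_apply, hi] using h i j
  simpa [Matrix.inv_def, Ring.inverse_eq_inv'] using hd.mul hα hadj

lemma LocHolder.sqrt_det (hα : α ∈ Ioo (0 : ℝ) 1) {A : Met n}
    (h : ∀ a b, LocHolder α m (fun x => A x a b)) (h0 : 0 < (A 0).det) :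
    LocHolder α m (fun x => √(A x).det) :=
  (LocHolder.det hα h).comp hα (Real.contDiffAt_sqrt h0.ne')

lemma locHolder_christoffel (hα : α ∈ Ioo (0 : ℝ) 1) {g : Met n}
    (h : ∀ a b, LocHolder α (m + 1) (fun x => g x a b)) (h0 : (g 0).det ≠ 0) (c a b : Fin n) :
    LocHolder α m (christoffel g c a b) := by
  unfold christoffel
  refine (LocHolder.sum _ fun d _ => LocHolder.mul hα ?_ ?_).const_mul _
  · exact (LocHolder.inv_apply hα h h0 c d).of_succ hα
  · exact (((h b d).partialDeriv a).add ((h a d).partialDeriv b)).sub ((h a b).partialDeriv d)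

lemma locHolder_scalarCurv (hα : α ∈ Ioo (0 : ℝ) 1) {g : Met n}
    (h : ∀ a b, LocHolder α (m + 2) (fun x => g x a b)) (h0 : (g 0).det ≠ 0) :
    LocHolder α m (scalarCurv g) := by
  have hc : ∀ c a b, LocHolder α (m + 1) (christoffel g c a b) :=
    locHolder_christoffel hα h h0
  have hc' : ∀ c a b, LocHolder α m (christoffel g c a b) := fun c a b => (hc c a b).of_succ hα
  unfold scalarCurv ricci
  refine LocHolder.sum _ fun a _ => LocHolder.sum _ fun b _ => LocHolder.mul hα
    ((LocHolder.inv_apply hα h h0 a b).of_le hα (Nat.le_add_right m 2)) ?_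
  refine LocHolder.sub (LocHolder.add (LocHolder.sub ?_ ?_) ?_) ?_
  · exact LocHolder.sum _ fun c _ => (hc _ _ _).partialDeriv _
  · exact LocHolder.sum _ fun c _ => (hc _ _ _).partialDeriv _
  · exact LocHolder.sum _ fun c _ => LocHolder.sum _ fun d _ => (hc' _ _ _).mul hα (hc' _ _ _)
  · exact LocHolder.sum _ fun c _ => LocHolder.sum _ fun d _ => (hc' _ _ _).mul hα (hc' _ _ _)

/-- The conformal Laplacian in nondivergence form. -/
lemma exists_confLap_eq_lowOp (hα : α ∈ Ioo (0 : ℝ) 1) {g : Met n}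
    (h : ∀ a b, LocHolder α (m + 2) (fun x => g x a b)) (h0 : 0 < (g 0).det) :
    ∃ b c, (∀ i, LocHolder α m (b i)) ∧ LocHolder α m c ∧
      ∀ᶠ x in nhds 0, ∀ u : Pt n → ℝ, (∀ i, DifferentiableAt ℝ (pd i u) x) →
        confLap g u x = -lowOp (fun i j y => (g y)⁻¹ i j) b c u x := by
  have h1 : ∀ a b, LocHolder α (m + 1) (fun x => g x a b) := fun a b => (h a b).of_succ hα
  have hinv := LocHolder.inv_apply hα h1 h0.ne'
  have hdet := LocHolder.sqrt_det hα h1 h0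
  have hs0 : √(g 0).det ≠ 0 := (Real.sqrt_pos.mpr h0).ne'
  have hA : ∀ a b, LocHolder α (m + 1) (fun x => √(g x).det * (g x)⁻¹ a b) :=
    fun a b => hdet.mul hα (hinv a b)
  have hdi : LocHolder α m (fun x => (√(g x).det)⁻¹) :=
    (hdet.of_succ hα).comp hα (contDiffAt_inv ℝ hs0)
  refine ⟨fun b x => (√(g x).det)⁻¹ * ∑ a, pd a (fun y => √(g y).det * (g y)⁻¹ a b) x,
    fun x => -(((n : ℝ) - 2) / (4 * ((n : ℝ) - 1)) * scalarCurv g x),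
    fun b => hdi.mul hα (LocHolder.sum _ fun a _ => (hA a b).partialDeriv a),
    ((locHolder_scalarCurv hα h h0.ne').const_mul _).neg, ?_⟩
  have hne : ∀ᶠ x in nhds (0 : Pt n), √(g x).det ≠ 0 :=
    (hdet.continuousAt hα.1).eventually_ne hs0
  have hdiff : ∀ᶠ x in nhds (0 : Pt n), ∀ a b,
      DifferentiableAt ℝ (fun x => √(g x).det * (g x)⁻¹ a b) x := by
    simp only [Filter.eventually_all]
    exact fun a b => (hA a b).eventually_differentiableAt
  filter_upwards [hne, hdiff] with x hx hd u hu
  have e : ∀ a, pd a (fun y => √(g y).det * ∑ b, (g y)⁻¹ a b * pd b u y) x =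
      ∑ b, (pd a (fun y => √(g y).det * (g y)⁻¹ a b) x * pd b u x +
        √(g x).det * (g x)⁻¹ a b * pd a (pd b u) x) := fun a => by
    have : (fun y => √(g y).det * ∑ b, (g y)⁻¹ a b * pd b u y) =
        fun y => ∑ b, (√(g y).det * (g y)⁻¹ a b) * pd b u y := by
      funext y; rw [Finset.mul_sum]; exact Finset.sum_congr rfl fun b _ => by ring
    rw [this, pd_sum a fun b _ => (hd a b).fun_mul (hu b)]
    exact Finset.sum_congr rfl fun b _ => pd_mul a (hd a b) (hu b)
  have e2 : (√(g x).det)⁻¹ * ∑ a, ∑ b, √(g x).det * (g x)⁻¹ a b * pd a (pd b u) x =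
      ∑ a, ∑ b, (g x)⁻¹ a b * pd a (pd b u) x := by
    simp only [Finset.mul_sum]
    refine Finset.sum_congr rfl fun a _ => Finset.sum_congr rfl fun b _ => ?_
    field_simp
  have e3 : ∑ b, (√(g x).det)⁻¹ * (∑ a, pd a (fun y => √(g y).det * (g y)⁻¹ a b) x) * pd b u x =
      (√(g x).det)⁻¹ * ∑ a, ∑ b, pd a (fun y => √(g y).det * (g y)⁻¹ a b) x * pd b u x := by
    rw [Finset.sum_comm, Finset.mul_sum]
    exact Finset.sum_congr rfl fun b _ => by rw [mul_assoc, Finset.sum_mul]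
  unfold confLap laplaceBeltrami lowOp
  simp only [e, Finset.sum_add_distrib]
  rw [e3, ← e2]
  ring

end Geometry

/-! ### Linear changes of coordinates -/

section Normalization

open scoped MatrixOrder in
lemma exists_transpose_mul_self {n : ℕ} {Q : Matrix (Fin n) (Fin n) ℝ} (hQ : Q.PosDef) :
    ∃ T : Matrix (Fin n) (Fin n) ℝ, Q = Tᵀ * T := by
  obtain ⟨T, hT⟩ := CStarAlgebra.nonneg_iff_eq_star_mul_self.mp hQ.posSemidef.nonneg
  exact ⟨T, by rw [hT, Matrix.star_eq_conjTranspose, Matrix.conjTranspose_eq_transpose_of_trivial]⟩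

/-- A positive definite matrix is normalized by a coordinate change preserving the half-space. -/
lemma exists_normalizing_matrix {n : ℕ} {Q : Matrix (Fin n) (Fin n) ℝ} (hQ : Q.PosDef)
    (ν : Fin n) : ∃ M : Matrix (Fin n) (Fin n) ℝ, M * Q * Mᵀ = 1 ∧
      ∃ c > 0, M ν = Pi.single ν c := by
  obtain ⟨T, hT⟩ := exists_transpose_mul_self hQ
  have hdet : IsUnit T.det := by
    have := hQ.det_pos
    rw [hT, Matrix.det_mul, Matrix.det_transpose] at this
    exact isUnit_iff_ne_zero.mpr fun h => by simp [h] at this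
  have hT1 : T * T⁻¹ = 1 := Matrix.mul_nonsing_inv T hdet
  have hT2 : T⁻¹ * T = 1 := Matrix.nonsing_inv_mul T hdet
  have hνν : 0 < Q ν ν := hQ.diag_pos
  set c : ℝ := (√(Q ν ν))⁻¹ with hc
  have hcpos : 0 < c := inv_pos.mpr (Real.sqrt_pos.mpr hνν)
  let w : EuclideanSpace ℝ (Fin n) := WithLp.toLp 2 (c • (T *ᵥ Pi.single ν 1))
  have hw : ‖w‖ = 1 := by
    have h1 : ‖w‖ ^ 2 = 1 := by
      rw [EuclideanSpace.norm_sq_eq]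
      have h2 : Q ν ν = ∑ i, T i ν * T i ν := by
        conv_lhs => rw [hT]
        simp [Matrix.mul_apply]
      have h3 : c ^ 2 * Q ν ν = 1 := by
        rw [hc, inv_pow, Real.sq_sqrt hνν.le, inv_mul_cancel₀ hνν.ne']
      rw [← h3, h2, Finset.mul_sum]
      refine Finset.sum_congr rfl fun i _ => ?_
      have h4 : w i = c * T i ν := by simp [w]
      rw [h4, Real.norm_eq_abs, sq_abs]
      ring
    exact (pow_eq_one_iff_of_nonneg (norm_nonneg w) two_ne_zero).mp h1
  obtain ⟨b, hb⟩ := Orthonormal.exists_orthonormalBasis_extension_of_card_eq (𝕜 := ℝ)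
    (E := EuclideanSpace ℝ (Fin n)) (by simp) (v := fun _ : Fin n => w) (s := {ν})
    ⟨fun _ => hw, fun i j hij => absurd (Subsingleton.elim i j) hij⟩
  have hbν : b ν = w := hb ν rfl
  let O : Matrix (Fin n) (Fin n) ℝ := Matrix.of fun i j => b i j
  have hO : O * Oᵀ = 1 := by
    ext i j
    have := orthonormal_iff_ite.mp b.orthonormal j i
    rw [PiLp.inner_apply] at this
    simp only [O, Matrix.mul_apply, Matrix.transpose_apply, Matrix.of_apply, Matrix.one_apply]
    simp only [RCLike.inner_apply, conj_trivial] at this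
    rw [this]
    simp [eq_comm]
  refine ⟨O * (T⁻¹)ᵀ, ?_, c, hcpos, ?_⟩
  · have e : T * T⁻¹ = 1 := hT1
    have e' : (T⁻¹)ᵀ * Tᵀ = 1 := by rw [← Matrix.transpose_mul, e, Matrix.transpose_one]
    calc O * (T⁻¹)ᵀ * Q * (O * (T⁻¹)ᵀ)ᵀ = O * ((T⁻¹)ᵀ * Tᵀ) * (T * T⁻¹) * Oᵀ := by
          rw [hT, Matrix.transpose_mul, Matrix.transpose_transpose]
          simp only [Matrix.mul_assoc]
      _ = 1 := by rw [e, e', Matrix.mul_one, Matrix.mul_one, hO]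
  · have e : (O * (T⁻¹)ᵀ) ν = T⁻¹ *ᵥ (c • (T *ᵥ Pi.single ν 1)) := by
      funext j
      simp only [Matrix.mul_apply, Matrix.transpose_apply, Matrix.mulVec, dotProduct, O,
        Matrix.of_apply, hbν, w]
      exact Finset.sum_congr rfl fun k _ => mul_comm _ _
    rw [e, Matrix.mulVec_smul, Matrix.mulVec_mulVec, hT2, Matrix.one_mulVec]
    funext j
    simp [Pi.single_apply]

variable {n m : ℕ} {α C : ℝ} {s : Set (Pt n)} {v : Pt n → ℝ}

lemma HolderBdd.exists_comp_clm (hα : α ∈ Ioo (0 : ℝ) 1) (A : Pt n →L[ℝ] Pt n) (hs : IsOpen s)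
    (hC : 0 ≤ C) (hv : HolderBdd α m C s v) :
    ∃ C', 0 ≤ C' ∧ HolderBdd α m C' (A ⁻¹' s) (fun x => v (A x)) := by
  have hs' : IsOpen (A ⁻¹' s) := hs.preimage A.continuous
  induction m generalizing v with
  | zero =>
    have hA : 0 ≤ C * ‖A‖ ^ α := mul_nonneg hC (Real.rpow_nonneg (norm_nonneg _) _)
    refine ⟨C + C * ‖A‖ ^ α, by positivity, fun x hx => ?_, fun x hx y hy => ?_⟩
    · linarith [hv.1 _ hx]
    · refine (hv.2 _ hx _ hy).trans ?_
      have h1 : ‖A x - A y‖ ^ α ≤ ‖A‖ ^ α * ‖x - y‖ ^ α := by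
        rw [← Real.mul_rpow (norm_nonneg _) (norm_nonneg _), ← map_sub]
        exact Real.rpow_le_rpow (norm_nonneg _) (A.le_opNorm _) hα.1.le
      have h2 : 0 ≤ C * ‖x - y‖ ^ α := mul_nonneg hC (Real.rpow_nonneg (norm_nonneg _) _)
      nlinarith [mul_le_mul_of_nonneg_left h1 hC]
  | succ m ih =>
    choose K hK hH using fun i => ih (hv.2.2 i)
    have hS : ∀ i, 0 ≤ ∑ k, |A (Pi.single i 1) k| * K k := fun i =>
      Finset.sum_nonneg fun k _ => mul_nonneg (abs_nonneg _) (hK k)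
    refine ⟨C + ∑ i, ∑ k, |A (Pi.single i 1) k| * K k,
      add_nonneg hC (Finset.sum_nonneg fun i _ => hS i), fun x hx => ?_,
      fun x hx => (pd_comp_clm A (hv.2.1 _ hx)).1, fun i => ?_⟩
    · linarith [hv.1 _ hx, Finset.sum_nonneg fun i (_ : i ∈ Finset.univ) => hS i]
    · refine ((HolderBdd.sum Finset.univ hs' fun k _ =>
        (hH k).const_mul hs' (A (Pi.single i 1) k)).mono_const ?_).congr hs'
          fun x hx => (pd_comp_clm A (hv.2.1 _ hx)).2 i
      linarith [Finset.single_le_sum (fun i _ => hS i) (Finset.mem_univ i)]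

lemma LocHolder.comp_clm (hα : α ∈ Ioo (0 : ℝ) 1) (A : Pt n →L[ℝ] Pt n)
    (hv : LocHolder α m v) : LocHolder α m (fun x => v (A x)) := by
  obtain ⟨r, hr, C, hC⟩ := hv
  obtain ⟨C', -, h⟩ := hC.exists_comp_clm hα A Metric.isOpen_ball
    (hC.const_nonneg (Metric.mem_ball_self hr))
  have : A ⁻¹' Metric.ball 0 r ∈ nhds (0 : Pt n) :=
    A.continuous.continuousAt.preimage_mem_nhds (by simpa using Metric.ball_mem_nhds 0 hr)
  obtain ⟨t, ht, hts⟩ := Metric.mem_nhds_iff.mp this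
  exact ⟨t, ht, C', h.mono_set hts⟩

/-- Second-order operators under a linear change of variables. -/
lemma lowOp_comp_clm (p : Fin n → Fin n → Pt n → ℝ) (b : Fin n → Pt n → ℝ) (c : Pt n → ℝ)
    (A : Pt n →L[ℝ] Pt n) (hv : ∀ x, DifferentiableAt ℝ v x)
    (hv2 : ∀ k x, DifferentiableAt ℝ (pd k v) x) (x : Pt n) :
    lowOp p b c (fun y => v (A y)) x =
      ∑ k, ∑ l, (∑ i, ∑ j, A (Pi.single i 1) k * p i j x * A (Pi.single j 1) l) *
        pd k (pd l v) (A x) +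
      ∑ k, (∑ i, A (Pi.single i 1) k * b i x) * pd k v (A x) + c x * v (A x) := by
  have h1 : ∀ j, pd j (fun y => v (A y)) = fun y => ∑ l, A (Pi.single j 1) l * pd l v (A y) :=
    fun j => funext fun y => (pd_comp_clm A (hv _)).2 j
  have h2 : ∀ i j, pd i (pd j (fun y => v (A y))) x =
      ∑ l, ∑ k, A (Pi.single j 1) l * (A (Pi.single i 1) k * pd k (pd l v) (A x)) := fun i j => by
    rw [h1, pd_sum _ fun l _ => ((pd_comp_clm A (hv2 l _)).1.const_mul _)]
    refine Finset.sum_congr rfl fun l _ => ?_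
    rw [pd_const_mul _ _ (pd_comp_clm A (hv2 l _)).1, (pd_comp_clm A (hv2 l _)).2 i,
      Finset.mul_sum]
  unfold lowOp
  simp only [h2]
  congr 2
  · simp only [Finset.mul_sum, Finset.sum_mul]
    calc _ = ∑ i, ∑ j, ∑ k, ∑ l, p i j x *
        (A (Pi.single j 1) l * (A (Pi.single i 1) k * pd k (pd l v) (A x))) :=
          Finset.sum_congr rfl fun i _ => Finset.sum_congr rfl fun j _ => Finset.sum_comm
      _ = ∑ i, ∑ k, ∑ l, ∑ j, p i j x *
        (A (Pi.single j 1) l * (A (Pi.single i 1) k * pd k (pd l v) (A x))) := by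
          refine Finset.sum_congr rfl fun i _ => ?_
          rw [Finset.sum_comm]
          exact Finset.sum_congr rfl fun k _ => Finset.sum_comm
      _ = ∑ k, ∑ l, ∑ i, ∑ j, p i j x *
        (A (Pi.single j 1) l * (A (Pi.single i 1) k * pd k (pd l v) (A x))) := by
          rw [Finset.sum_comm]
          exact Finset.sum_congr rfl fun k _ => Finset.sum_comm
      _ = _ := by
          refine Finset.sum_congr rfl fun k _ => Finset.sum_congr rfl fun l _ =>
            Finset.sum_congr rfl fun i _ => Finset.sum_congr rfl fun j _ => by ring
  · simp only [h1, Finset.mul_sum, Finset.sum_mul]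
    rw [Finset.sum_comm]
    exact Finset.sum_congr rfl fun k _ => Finset.sum_congr rfl fun i _ => by ring

end Normalization

/-! ### Dilations -/

section Dilation

variable {n m : ℕ} {α C r ε : ℝ} {a : Pt n → ℝ}

lemma pd_comp_smul (ε : ℝ) {x : Pt n} (ha : DifferentiableAt ℝ a (ε • x)) :
    DifferentiableAt ℝ (fun y => a (ε • y)) x ∧
      ∀ i, pd i (fun y => a (ε • y)) x = ε * pd i a (ε • x) := by
  obtain ⟨h1, h2⟩ := pd_comp_clm (ε • ContinuousLinearMap.id ℝ (Pt n)) (f := a) (x := x)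
    (by simpa using ha)
  refine ⟨by simpa using h1, fun i => ?_⟩
  simpa [Pi.single_apply] using h2 i

lemma smul_mem_ball_of_two_mul_le (hε : 0 < ε) (hr : 2 * ε ≤ r) {x : Pt n}
    (hx : x ∈ Metric.ball (0 : Pt n) 2) : ε • x ∈ Metric.ball (0 : Pt n) r := by
  rw [mem_ball_zero_iff] at hx ⊢
  rw [norm_smul, Real.norm_of_nonneg hε.le]
  nlinarith

lemma HolderBdd.comp_smul (hα : α ∈ Ioo (0 : ℝ) 1) (hC : 0 ≤ C) (hε : 0 < ε) (hε1 : ε ≤ 1)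
    (hr : 2 * ε ≤ r) (ha : HolderBdd α m C (Metric.ball 0 r) a) :
    HolderBdd α m C (Metric.ball 0 2) (fun x => a (ε • x)) := by
  induction m generalizing a with
  | zero =>
    refine ⟨fun x hx => ha.1 _ (smul_mem_ball_of_two_mul_le hε hr hx), fun x hx y hy => ?_⟩
    refine (ha.2 _ (smul_mem_ball_of_two_mul_le hε hr hx) _
      (smul_mem_ball_of_two_mul_le hε hr hy)).trans ?_
    refine mul_le_mul_of_nonneg_left (Real.rpow_le_rpow (norm_nonneg _) ?_ hα.1.le) hC
    rw [← smul_sub, norm_smul, Real.norm_of_nonneg hε.le]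
    exact mul_le_of_le_one_left (norm_nonneg _) hε1
  | succ m ih =>
    refine ⟨fun x hx => ha.1 _ (smul_mem_ball_of_two_mul_le hε hr hx), fun x hx =>
      (pd_comp_smul ε (ha.2.1 _ (smul_mem_ball_of_two_mul_le hε hr hx))).1, fun i => ?_⟩
    refine (((ih (ha.2.2 i)).const_mul Metric.isOpen_ball ε).mono_const ?_).congr
      Metric.isOpen_ball fun x hx =>
        (pd_comp_smul ε (ha.2.1 _ (smul_mem_ball_of_two_mul_le hε hr hx))).2 i
    rw [abs_of_pos hε]
    exact mul_le_of_le_one_left hC hε1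

lemma LocHolder.exists_comp_smul (hα : α ∈ Ioo (0 : ℝ) 1) (ha : LocHolder α m a) :
    ∃ C, 0 ≤ C ∧ ∀ᶠ ε in nhdsWithin (0 : ℝ) (Ioi 0),
      HolderBdd α m C (Metric.ball 0 2) (fun x => a (ε • x)) := by
  obtain ⟨C, h0, r, hr, hC⟩ := ha.exists_forall_le
  refine ⟨C, h0, ?_⟩
  have h1 : ∀ᶠ ε in nhdsWithin (0 : ℝ) (Ioi 0), ε ≤ min 1 (r / 2) :=
    mem_nhdsWithin_of_mem_nhds (Iic_mem_nhds (by positivity))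
  filter_upwards [h1, self_mem_nhdsWithin] with ε hε hε0
  have := (le_min_iff.mp hε).2
  exact (hC r le_rfl).comp_smul hα h0 hε0 (le_min_iff.mp hε).1 (by linarith)

lemma LocHolder.eventually_smul_comp_smul (hα : α ∈ Ioo (0 : ℝ) 1) (ha : LocHolder α m a) {η : ℝ}
    (hη : 0 < η) : ∀ᶠ ε in nhdsWithin (0 : ℝ) (Ioi 0),
      HolderBdd α m η (Metric.ball 0 2) (fun x => ε * a (ε • x)) := by
  obtain ⟨C, h0, h⟩ := ha.exists_comp_smul hα
  have h1 : ∀ᶠ ε in nhdsWithin (0 : ℝ) (Ioi 0), ε ≤ η / (C + 1) :=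
    mem_nhdsWithin_of_mem_nhds (Iic_mem_nhds (by positivity))
  filter_upwards [h, h1, self_mem_nhdsWithin] with ε hε hle hε0
  refine (hε.const_mul Metric.isOpen_ball ε).mono_const ?_
  rw [abs_of_pos hε0]
  rw [le_div_iff₀ (by positivity)] at hle
  have : (0 : ℝ) < ε := hε0
  nlinarith

lemma LocHolder.eventually_comp_smul (hα : α ∈ Ioo (0 : ℝ) 1) (ha : LocHolder α m a)
    (ha0 : a 0 = 0) {η : ℝ} (hη : 0 < η) : ∀ᶠ ε in nhdsWithin (0 : ℝ) (Ioi 0),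
      HolderBdd α m η (Metric.ball 0 2) (fun x => a (ε • x)) := by
  have hsup : ∀ᶠ ε in nhdsWithin (0 : ℝ) (Ioi 0), ∀ x ∈ Metric.ball (0 : Pt n) 2,
      |a (ε • x)| ≤ η := by
    have hc := ha.continuousAt hα.1
    obtain ⟨r, hr, h⟩ := Metric.continuousAt_iff.mp hc η hη
    have h1 : ∀ᶠ ε in nhdsWithin (0 : ℝ) (Ioi 0), ε ≤ r / 2 :=
      mem_nhdsWithin_of_mem_nhds (Iic_mem_nhds (by positivity))
    filter_upwards [h1, self_mem_nhdsWithin] with ε hε hε0 x hx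
    have := h (smul_mem_ball_of_two_mul_le (r := r) hε0 (by linarith) hx)
    rw [ha0, dist_zero_right] at this
    exact this.le
  cases m with
  | zero =>
    obtain ⟨C, h0, r, hr, hC⟩ := ha.exists_forall_le
    have h1 : ∀ᶠ ε in nhdsWithin (0 : ℝ) (Ioi 0), ε ≤ r / 2 :=
      mem_nhdsWithin_of_mem_nhds (Iic_mem_nhds (by positivity))
    have h2 : ∀ᶠ ε in nhdsWithin (0 : ℝ) (Ioi 0), C * ε ^ α < η := by
      have : ContinuousAt (fun ε : ℝ => C * ε ^ α) 0 :=
        continuousAt_const.mul (Real.continuousAt_rpow_const _ _ (Or.inr hα.1.le))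
      refine mem_nhdsWithin_of_mem_nhds (this.eventually (gt_mem_nhds ?_))
      simpa [Real.zero_rpow hα.1.ne'] using hη
    filter_upwards [hsup, h1, h2, self_mem_nhdsWithin] with ε hs hr' hη' hε0
    have hε0' : (0 : ℝ) < ε := hε0
    refine ⟨hs, fun x hx y hy => ?_⟩
    refine ((hC r le_rfl).2 _ (smul_mem_ball_of_two_mul_le hε0 (by linarith) hx) _
      (smul_mem_ball_of_two_mul_le hε0 (by linarith) hy)).trans ?_
    rw [← smul_sub, norm_smul, Real.norm_of_nonneg hε0'.le,
      Real.mul_rpow hε0'.le (norm_nonneg _), ← mul_assoc]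
    exact mul_le_mul_of_nonneg_right hη'.le (Real.rpow_nonneg (norm_nonneg _) _)
  | succ m =>
    obtain ⟨r, hr, C, hC⟩ := ha
    have h1 : ∀ᶠ ε in nhdsWithin (0 : ℝ) (Ioi 0), ε ≤ r / 2 :=
      mem_nhdsWithin_of_mem_nhds (Iic_mem_nhds (by positivity))
    have h2 := Filter.eventually_all.mpr fun i =>
      LocHolder.eventually_smul_comp_smul hα ⟨r, hr, C, hC.2.2 i⟩ hη
    filter_upwards [hsup, h1, h2, self_mem_nhdsWithin] with ε hs hr' h hε0
    have hd : ∀ x ∈ Metric.ball (0 : Pt n) 2, DifferentiableAt ℝ a (ε • x) := fun x hx =>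
      hC.2.1 _ (smul_mem_ball_of_two_mul_le hε0 (by linarith) hx)
    exact ⟨hs, fun x hx => (pd_comp_smul ε (hd x hx)).1, fun i =>
      (h i).congr Metric.isOpen_ball fun x hx => (pd_comp_smul ε (hd x hx)).2 i⟩

end Dilation

/-! ### Solutions near the origin of normalized equations -/

section LocalSolutions

variable {n : ℕ} {α : ℝ} {ν : Fin n}

lemma nhdsWithin_upper_neBot {x : Pt n} (hx : 0 ≤ x ν) : (nhdsWithin x (upper ν)).NeBot :=
  mem_closure_iff_nhdsWithin_neBot.mp (closure_upper_of_nonneg hx)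

lemma eq_of_eqOn_upper {F G : Pt n → ℝ} {x : Pt n} (hx : 0 ≤ x ν) (hF : ContinuousAt F x)
    (hG : ContinuousAt G x) {U : Set (Pt n)} (hU : U ∈ nhds x) (h : EqOn F G (upper ν ∩ U)) :
    F x = G x := by
  have := nhdsWithin_upper_neBot (ν := ν) hx
  refine tendsto_nhds_unique (l := nhdsWithin x (upper ν)) (hF.tendsto.mono_left nhdsWithin_le_nhds)
    ((hG.tendsto.mono_left nhdsWithin_le_nhds).congr' ?_)
  filter_upwards [self_mem_nhdsWithin, mem_nhdsWithin_of_mem_nhds hU] with y h1 h2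
  exact (h ⟨h1, h2⟩).symm

lemma abs_le_of_abs_le_upper {F : Pt n → ℝ} {x : Pt n} {C : ℝ} (hx : 0 ≤ x ν)
    (hF : ContinuousAt F x) (h : ∀ y ∈ upper ν, |F y| ≤ C) : |F x| ≤ C := by
  have := nhdsWithin_upper_neBot (ν := ν) hx
  exact le_of_tendsto (hF.abs.tendsto.mono_left nhdsWithin_le_nhds)
    (Filter.eventually_of_mem self_mem_nhdsWithin h)

lemma lowOp_congr {p : Fin n → Fin n → Pt n → ℝ} {b : Fin n → Pt n → ℝ} {c u v : Pt n → ℝ}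
    {x : Pt n} (h : u =ᶠ[nhds x] v) : lowOp p b c u x = lowOp p b c v x := by
  have h1 : ∀ j, pd j u =ᶠ[nhds x] pd j v := fun j => by
    filter_upwards [h.eventuallyEq_nhds] with y hy using pd_congr j hy
  have h2 : ∀ i j, pd i (pd j u) x = pd i (pd j v) x := fun i j => pd_congr i (h1 j)
  simp only [lowOp, h2, (h1 _).eq_of_nhds, h.eq_of_nhds]

lemma sum_pd_congr {u v : Pt n → ℝ} {x : Pt n} (h : u =ᶠ[nhds x] v) :
    ∑ i, pd i (pd i u) x = ∑ i, pd i (pd i v) x := by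
  refine Finset.sum_congr rfl fun i _ => pd_congr i ?_
  filter_upwards [h.eventuallyEq_nhds] with y hy using pd_congr i hy

lemma HolderBdd.continuous_univ {m : ℕ} {C : ℝ} {f : Pt n → ℝ} (hα : 0 < α)
    (h : HolderBdd α m C univ f) : Continuous f :=
  continuousOn_univ.mp (h.continuousOn hα)

lemma continuousAt_lowOp {m : ℕ} {C : ℝ} {p : Fin n → Fin n → Pt n → ℝ} {b : Fin n → Pt n → ℝ}
    {c u : Pt n → ℝ} {x : Pt n} (hα : 0 < α) (hp : ∀ i j, ContinuousAt (p i j) x)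
    (hb : ∀ i, ContinuousAt (b i) x) (hc : ContinuousAt c x)
    (hu : HolderBdd α (m + 2) C univ u) : ContinuousAt (lowOp p b c u) x := by
  have h0 := (hu.continuous_univ hα).continuousAt (x := x)
  have h1 := fun i => ((hu.2.2 i).continuous_univ hα).continuousAt (x := x)
  have h2 := fun i j => (((hu.2.2 j).2.2 i).continuous_univ hα).continuousAt (x := x)
  unfold lowOp
  refine ((tendsto_finsetSum _ fun i _ => tendsto_finsetSum _ fun j _ =>
    (hp i j).mul (h2 i j)).add (tendsto_finsetSum _ fun i _ => (hb i).mul (h1 i))).add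
    (hc.mul h0)

/-- Extension across the boundary of the solution of a small perturbation of the Laplace
equation. -/
lemma exists_extended_solution (hn : 1 ≤ n) (ν : Fin n) (hα : α ∈ Ioo (0 : ℝ) 1) (m : ℕ) :
    ∃ δ > 0, ∀ (p : Fin n → Fin n → Pt n → ℝ) (b : Fin n → Pt n → ℝ) (c e : Pt n → ℝ),
      (∀ i j, HolderBdd α m δ (Metric.ball 0 2) (p i j)) →
      (∀ i, HolderBdd α m δ (Metric.ball 0 2) (b i)) →
      HolderBdd α m δ (Metric.ball 0 2) c → HolderBdd α m δ (Metric.ball 0 2) e →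
      ∃ C w, 0 ≤ C ∧ HolderBdd α (m + 2) C univ w ∧ (∀ x, x ν = 0 → w x = 0) ∧
        (∀ x, 0 ≤ x ν → |w x| ≤ 1 / 2) ∧ (∀ x, 0 ≤ x ν → |pd ν w x| ≤ 1 / 2) ∧
        ∀ x ∈ Metric.ball 0 1, 0 ≤ x ν →
          ∑ i, pd i (pd i w) x + lowOp p b c w x = -e x := by
  obtain ⟨δ, hδ, H⟩ := exists_perturbed_solution hn ν hα m
  refine ⟨δ, hδ, fun p b c e hp hb hc he => ?_⟩
  obtain ⟨w, hw, hwc, hw0, hweq⟩ := H p b c e (fun i j => (hp i j).mono_set inter_subset_right)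
    (fun i => (hb i).mono_set inter_subset_right) (hc.mono_set inter_subset_right)
    (he.mono_set inter_subset_right)
  obtain ⟨C, u, hC, hu, huw⟩ := hw.exists_extension hα (m + 2) (by norm_num)
  have hev : ∀ x ∈ upper ν, u =ᶠ[nhds x] w := fun x hx =>
    Filter.eventually_of_mem (isOpen_upper.mem_nhds hx) huw
  have hc0 := hu.continuous_univ hα.1
  have hc1 := fun i => (hu.2.2 i).continuous_univ hα.1
  have hc2 := fun i => ((hu.2.2 i).2.2 i).continuous_univ hα.1
  refine ⟨C, u, hC, hu, fun x hx => ?_, fun x hx => ?_, fun x hx => ?_, fun x hx hxν => ?_⟩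
  · rw [← hw0 x hx]
    exact eq_of_eqOn_upper hx.ge hc0.continuousAt hwc.continuousAt Filter.univ_mem
      fun y hy => huw hy.1
  · exact abs_le_of_abs_le_upper hx hc0.continuousAt fun y hy => by
      rw [huw hy]; exact hw.bound y hy
  · exact abs_le_of_abs_le_upper hx (hc1 ν).continuousAt fun y hy => by
      rw [pd_congr ν (hev y hy)]; exact hw.pd_bound ν y hy
  · have hx2 : Metric.ball (0 : Pt n) 2 ∈ nhds x :=
      Metric.isOpen_ball.mem_nhds (Metric.ball_subset_ball one_le_two hx)
    have hcont : ∀ {f : Pt n → ℝ}, HolderBdd α m δ (Metric.ball 0 2) f → ContinuousAt f x :=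
      fun hf => (hf.continuousOn hα.1).continuousAt hx2
    refine eq_of_eqOn_upper (F := fun x => ∑ i, pd i (pd i u) x + lowOp p b c u x)
      (G := fun x => -e x) hxν ?_ (hcont he).neg (Metric.isOpen_ball.mem_nhds hx) fun y hy => ?_
    · exact ContinuousAt.add (tendsto_finsetSum _ fun i _ => (hc2 i).continuousAt)
        (continuousAt_lowOp hα.1 (fun i j => hcont (hp i j)) (fun i => hcont (hb i))
          (hcont hc) hu)
    · simp only [sum_pd_congr (hev y hy.1), lowOp_congr (hev y hy.1)]
      exact hweq y hy

lemma pd_affine (ν i : Fin n) (a b : ℝ) :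
    pd i (fun y : Pt n => a * y ν + b) = fun _ => a * (Pi.single i 1 : Pt n) ν := by
  funext x
  have h : HasFDerivAt (fun y : Pt n => a * y ν + b)
      (a • ContinuousLinearMap.proj (R := ℝ) (φ := fun _ : Fin n => ℝ) ν) x :=
    (((ContinuousLinearMap.proj (R := ℝ) (φ := fun _ : Fin n => ℝ) ν).hasFDerivAt).const_mul
      a).add_const b
  simp [pd, h.fderiv]

lemma lowOp_comp_smul (p : Fin n → Fin n → Pt n → ℝ) (b : Fin n → Pt n → ℝ) (c : Pt n → ℝ)
    {v : Pt n → ℝ} (t : ℝ) (hv : ∀ x, DifferentiableAt ℝ v x)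
    (hv2 : ∀ k x, DifferentiableAt ℝ (pd k v) x) (x : Pt n) :
    lowOp p b c (fun y => v (t • y)) x =
      t ^ 2 * (∑ i, ∑ j, p i j x * pd i (pd j v) (t • x)) +
        t * (∑ i, b i x * pd i v (t • x)) + c x * v (t • x) := by
  have h1 : ∀ j, pd j (fun y => v (t • y)) = fun y => t * pd j v (t • y) :=
    fun j => funext fun y => (pd_comp_smul t (hv _)).2 j
  have h2 : ∀ i j, pd i (pd j (fun y => v (t • y))) x = t * (t * pd i (pd j v) (t • x)) :=
    fun i j => by rw [h1, pd_const_mul _ _ (pd_comp_smul t (hv2 j _)).1,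
      (pd_comp_smul t (hv2 j _)).2 i]
  simp only [lowOp, h2, (fun j => congrFun (h1 j) x : ∀ j, pd j (fun y => v (t • y)) x = _),
    Finset.mul_sum]
  congr 2
  · exact Finset.sum_congr rfl fun i _ => Finset.sum_congr rfl fun j _ => by ring
  · exact Finset.sum_congr rfl fun i _ => by ring

/-- Local solutions with affine boundary data of an equation in normal form at the origin. -/
lemma exists_local_solution_of_normalized (hn : 1 ≤ n) (ν : Fin n) (hα : α ∈ Ioo (0 : ℝ) 1)
    (m : ℕ) {q : Fin n → Fin n → Pt n → ℝ} {B : Fin n → Pt n → ℝ} {c : Pt n → ℝ}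
    (hq : ∀ i j, LocHolder α m (q i j)) (hB : ∀ i, LocHolder α m (B i)) (hc : LocHolder α m c)
    (hq0 : ∀ i j, q i j 0 = (1 : Matrix (Fin n) (Fin n) ℝ) i j) (a b : ℝ) :
    ∃ ρ > 0, ∃ C v, 0 ≤ C ∧ HolderBdd α (m + 2) C univ v ∧
      (∀ y ∈ Metric.ball 0 ρ, y ν = 0 → v y = b) ∧
      (∀ y ∈ Metric.ball 0 ρ, 0 ≤ y ν → lowOp q B c v y = 0) ∧
      (a = 0 → b = 1 → ∀ y ∈ Metric.ball 0 ρ, 0 ≤ y ν → 0 < v y) ∧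
      (a = 1 → 0 < pd ν v 0) := by
  obtain ⟨δ, hδ, H⟩ := exists_extended_solution hn ν hα m
  have hcoord : LocHolder α m (fun y : Pt n => y ν) := by
    obtain ⟨C, -, h⟩ := HolderBdd.exists_of_contDiff hα m
      (contDiff_apply ℝ ℝ ν : ContDiff ℝ (⊤ : ℕ∞) fun y : Pt n => y ν) 1
    exact ⟨1, one_pos, C, h⟩
  have hp : ∀ i j, LocHolder α m (fun y => q i j y - (1 : Matrix (Fin n) (Fin n) ℝ) i j) :=
    fun i j => (hq i j).sub (LocHolder.const _)
  have he1 : LocHolder α m (fun y => a * B ν y + a * (c y * y ν)) :=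
    ((hB ν).const_mul a).add ((hc.mul hα hcoord).const_mul a)
  have he2 : LocHolder α m (fun y => b * c y) := hc.const_mul b
  have hle : ∀ᶠ ε in nhdsWithin (0 : ℝ) (Ioi 0), ε ≤ 1 :=
    mem_nhdsWithin_of_mem_nhds (Iic_mem_nhds one_pos)
  have hp' := Filter.eventually_all.mpr fun i => Filter.eventually_all.mpr fun j =>
    (hp i j).eventually_comp_smul hα (sub_eq_zero.mpr (hq0 i j)) hδ
  have hB' := Filter.eventually_all.mpr fun i => (hB i).eventually_smul_comp_smul hα hδ
  have hev := hle.and (hp'.and (hB'.and ((hc.eventually_smul_comp_smul hα hδ).and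
    ((he1.eventually_smul_comp_smul hα (half_pos hδ)).and
      (he2.eventually_smul_comp_smul hα (half_pos hδ))))))
  obtain ⟨ε, ⟨hε1, hp', hB', hc', he1', he2'⟩, hε⟩ := (hev.and self_mem_nhdsWithin).exists
  clear hev
  have hε : 0 < ε := hε
  have hshrink : ∀ {η : ℝ} {f : Pt n → ℝ}, 0 ≤ η → HolderBdd α m η (Metric.ball 0 2) f →
      HolderBdd α m η (Metric.ball 0 2) (fun x => ε * f x) := fun hη hf =>
    (hf.const_mul Metric.isOpen_ball ε).mono_const (by
      rw [abs_of_pos hε]; exact mul_le_of_le_one_left hη hε1)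
  obtain ⟨C, w, hC, hw, hw0, hwb, hwd, hweq⟩ := H _ _ _ _ hp' hB' (hshrink hδ.le hc')
    (((he1'.add (hshrink (half_pos hδ).le he2') Metric.isOpen_ball)).mono_const (by linarith))
  let χ : ContDiffBump (0 : Pt n) := ⟨1, 3 / 2, by norm_num, by norm_num⟩
  have hχ1 : ∀ x ∈ Metric.ball (0 : Pt n) 1, χ x = 1 := fun x hx =>
    χ.one_of_mem_closedBall (Metric.ball_subset_closedBall hx)
  set u₀ : Pt n → ℝ := fun x => χ x * (a * x ν + b) with hu₀
  obtain ⟨K, hK, hu₀H⟩ := HolderBdd.exists_of_compactSupport hα (m + 2) (f := u₀)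
    (χ.contDiff.mul ((contDiff_const.mul (contDiff_apply ℝ ℝ ν)).add contDiff_const))
    χ.hasCompactSupport.mul_right
  have hev : ∀ x ∈ Metric.ball (0 : Pt n) 1, u₀ =ᶠ[nhds x] fun y => a * y ν + b := fun x hx =>
    Filter.eventually_of_mem (Metric.isOpen_ball.mem_nhds hx) fun y hy => by
      simp [hu₀, hχ1 y hy]
  set v₁ : Pt n → ℝ := fun x => u₀ x + w x with hv₁
  have hv₁H : HolderBdd α (m + 2) (K + C) univ v₁ := hu₀H.add hw isOpen_univ
  have hv₁e : ∀ x ∈ Metric.ball (0 : Pt n) 1, v₁ x = a * x ν + b + w x := fun x hx => by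
    rw [hv₁, ← (hev x hx).eq_of_nhds]
  obtain ⟨C', hC', hvH⟩ := hv₁H.exists_comp_clm hα (ε⁻¹ • ContinuousLinearMap.id ℝ (Pt n))
    isOpen_univ (add_nonneg hK hC)
  have hball : ∀ y ∈ Metric.ball (0 : Pt n) ε, ε⁻¹ • y ∈ Metric.ball (0 : Pt n) 1 := fun y hy => by
    rw [mem_ball_zero_iff] at hy ⊢
    rw [norm_smul, norm_inv, Real.norm_of_nonneg hε.le]
    exact (inv_mul_lt_one₀ hε).mpr hy
  have hpd : pd ν v₁ 0 = a + pd ν w 0 := by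
    rw [hv₁, pd_add ν (hu₀H.2.1 _ (mem_univ _)) (hw.2.1 _ (mem_univ _)),
      pd_congr ν (hev 0 (Metric.mem_ball_self one_pos)), pd_affine]
    simp
  refine ⟨ε, hε, C', fun y => v₁ (ε⁻¹ • y), hC', by simpa using hvH, fun y hy hyν => ?_,
    fun y hy hyν => ?_, fun ha hb y hy hyν => ?_, fun ha => ?_⟩
  · have h1 : (ε⁻¹ • y) ν = 0 := by simp [hyν]
    simp only [hv₁e _ (hball y hy), hw0 _ h1, h1]
    simp
  · have hz : 0 ≤ (ε⁻¹ • y) ν := by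
      simp only [Pi.smul_apply, smul_eq_mul]
      positivity
    have hzb := hball y hy
    rw [lowOp_comp_smul q B c ε⁻¹ (fun x => hv₁H.2.1 x (mem_univ _))
      (fun k x => (hv₁H.2.2 k).2.1 x (mem_univ _))]
    have h2 := hweq _ hzb hz
    have hy' : y = ε • ε⁻¹ • y := (smul_inv_smul₀ hε.ne' y).symm
    have hzy : (ε⁻¹ • y) ν = ε⁻¹ * y ν := rfl
    simp only [lowOp, ← hy'] at h2
    have d1 : ∀ i x, pd i v₁ x = pd i u₀ x + pd i w x := fun i x =>
      pd_add i (hu₀H.2.1 _ (mem_univ _)) (hw.2.1 _ (mem_univ _))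
    have d2 : ∀ i j x, pd i (pd j v₁) x = pd i (pd j u₀) x + pd i (pd j w) x := fun i j x => by
      rw [funext (d1 j)]
      exact pd_add i ((hu₀H.2.2 j).2.1 _ (mem_univ _)) ((hw.2.2 j).2.1 _ (mem_univ _))
    have e1 : ∀ i, ∀ x ∈ Metric.ball (0 : Pt n) 1, pd i u₀ x = a * (Pi.single i 1 : Pt n) ν :=
      fun i x hx => by rw [pd_congr i (hev x hx), pd_affine]
    have e2 : ∀ i j, pd i (pd j u₀) (ε⁻¹ • y) = 0 := fun i j => by
      rw [pd_congr i (Filter.eventually_of_mem (Metric.isOpen_ball.mem_nhds hzb) (e1 j)),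
        pd_const]
    set z := ε⁻¹ • y
    have s1 : ∑ i, ∑ j, q i j y * pd i (pd j v₁) z = ∑ i, pd i (pd i w) z +
        ∑ i, ∑ j, (q i j y - (1 : Matrix (Fin n) (Fin n) ℝ) i j) * pd i (pd j w) z := by
      simp only [d2, e2, zero_add, sub_mul, Finset.sum_sub_distrib, Matrix.one_apply, ite_mul,
        one_mul, zero_mul, Finset.sum_ite_eq, Finset.mem_univ, if_true]
      ring
    have s2 : ∑ i, B i y * pd i v₁ z = a * B ν y + ∑ i, B i y * pd i w z := by
      simp only [d1, e1 _ z hzb, mul_add, Finset.sum_add_distrib, Pi.single_apply]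
      simp [mul_comm]
    have s3 : ∑ i, ε * B i y * pd i w z = ε * ∑ i, B i y * pd i w z := by
      rw [Finset.mul_sum]
      exact Finset.sum_congr rfl fun i _ => by ring
    rw [s3] at h2
    rw [s1, s2, hv₁e z hzb, hzy]
    have hne := hε.ne'
    have h3 : ∑ i, pd i (pd i w) z +
        ∑ i, ∑ j, (q i j y - (1 : Matrix (Fin n) (Fin n) ℝ) i j) * pd i (pd j w) z =
        -(ε * (a * B ν y + a * (c y * y ν)) + ε * (ε * (b * c y))) -
          ε * ∑ i, B i y * pd i w z - ε * (ε * c y) * w z := by linarith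
    rw [h3]
    field_simp
    ring
  · have h1 := abs_le.mp (hwb (ε⁻¹ • y) (by
      simp only [Pi.smul_apply, smul_eq_mul]
      positivity))
    simp only [hv₁e _ (hball y hy), ha, hb]
    linarith
  · have h1 := abs_le.mp (hwd 0 le_rfl)
    rw [(pd_comp_smul ε⁻¹ (a := v₁) (x := 0) (hv₁H.2.1 _ (mem_univ _))).2 ν, smul_zero, hpd, ha]
    have : 0 < ε⁻¹ := inv_pos.mpr hε
    nlinarith

end LocalSolutions

/-! ### Local solutions of the conformal Laplace equation -/

section ConformalSolutions

variable {n : ℕ} {α : ℝ} {ν : Fin n}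

lemma pd_eq_zero_of_const_on_hyperplane {v : Pt n → ℝ} {ρ b : ℝ} (hρ : 0 < ρ)
    (hv : DifferentiableAt ℝ v 0) (h : ∀ y ∈ Metric.ball 0 ρ, y ν = 0 → v y = b) {k : Fin n}
    (hk : k ≠ ν) : pd k v 0 = 0 := by
  have h0 : HasDerivAt (fun t : ℝ => t • (Pi.single k 1 : Pt n)) (Pi.single k 1) 0 := by
    simpa using (hasDerivAt_id (0 : ℝ)).smul_const (Pi.single k 1 : Pt n)
  have h1 : HasDerivAt (fun t : ℝ => v (t • (Pi.single k 1 : Pt n))) (pd k v 0) 0 := by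
    have hv' : HasFDerivAt v (fderiv ℝ v 0) ((0 : ℝ) • (Pi.single k 1 : Pt n)) := by
      simpa using hv.hasFDerivAt
    exact hv'.comp_hasDerivAt (0 : ℝ) h0
  have h2 : (fun t : ℝ => v (t • (Pi.single k 1 : Pt n))) =ᶠ[nhds 0] fun _ => b := by
    have hc : ContinuousAt (fun t : ℝ => t • (Pi.single k 1 : Pt n)) 0 := h0.continuousAt
    filter_upwards [hc (by simpa using Metric.ball_mem_nhds (0 : Pt n) hρ :
      Metric.ball (0 : Pt n) ρ ∈ nhds ((0 : ℝ) • (Pi.single k 1 : Pt n)))] with t ht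
    exact h _ ht (by simp [hk.symm])
  exact (h1.congr_of_eventuallyEq h2.symm).unique (hasDerivAt_const _ _)

/-- Near a boundary point of a half-space, the conformal Laplace equation has solutions with
constant boundary values. -/
lemma exists_conformal_solution (hn : 1 ≤ n) (ν : Fin n) (hα : α ∈ Ioo (0 : ℝ) 1) (m : ℕ)
    {g : Met n} (hg : ∀ a b, LocHolder α (m + 2) (fun x => g x a b)) (hg0 : (g 0).PosDef)
    (a b : ℝ) : ∃ ρ > 0, ∃ C u, 0 ≤ C ∧ HolderBdd α (m + 2) C univ u ∧
      (∀ x ∈ Metric.ball 0 ρ, x ν = 0 → u x = b) ∧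
      (∀ x ∈ Metric.ball 0 ρ, 0 ≤ x ν → confLap g u x = 0) ∧
      (a = 0 → b = 1 → ∀ x ∈ Metric.ball 0 ρ, 0 ≤ x ν → 0 < u x) ∧
      (a = 1 → 0 < pd ν u 0) := by
  obtain ⟨B, c, hB, hc, hconf⟩ := exists_confLap_eq_lowOp hα hg hg0.det_pos
  obtain ⟨M, hM, κ, hκ, hMν⟩ := exists_normalizing_matrix hg0.inv ν
  have hMS : ((g 0)⁻¹ * Mᵀ) * M = 1 := by
    rw [Matrix.mul_assoc] at hM
    exact mul_eq_one_comm.mp hM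
  let A : Pt n →L[ℝ] Pt n := LinearMap.toContinuousLinearMap (Matrix.toLin' M)
  let S : Pt n →L[ℝ] Pt n := LinearMap.toContinuousLinearMap (Matrix.toLin' ((g 0)⁻¹ * Mᵀ))
  have hSA : ∀ x, S (A x) = x := fun x => by
    change ((g 0)⁻¹ * Mᵀ) *ᵥ (M *ᵥ x) = x
    rw [Matrix.mulVec_mulVec, hMS, Matrix.one_mulVec]
  have hAe : ∀ i k, A (Pi.single i 1) k = M k i := fun i k => by
    change (M *ᵥ Pi.single i 1) k = M k i
    simp
  have hAν : ∀ x, A x ν = κ * x ν := fun x => by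
    change (M *ᵥ x) ν = κ * x ν
    rw [Matrix.mulVec, hMν]
    simp
  have hq : ∀ i j, LocHolder α m (fun y => (g y)⁻¹ i j) := fun i j =>
    (LocHolder.inv_apply hα hg hg0.det_pos.ne' i j).of_le hα (by omega)
  obtain ⟨ρ, hρ, C, v, hC, hv, hvb, hveq, hvpos, hvd⟩ :=
    exists_local_solution_of_normalized hn ν hα m
      (q := fun k l y => ∑ i, ∑ j, M k i * (g (S y))⁻¹ i j * M l j)
      (B := fun k y => ∑ i, M k i * B i (S y)) (c := fun y => c (S y))
      (fun k l => LocHolder.sum _ fun i _ => LocHolder.sum _ fun j _ =>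
        (((hq i j).comp_clm hα S).const_mul (M k i)).mul hα (LocHolder.const (M l j)))
      (fun k => LocHolder.sum _ fun i _ => ((hB i).comp_clm hα S).const_mul (M k i))
      (hc.comp_clm hα S) (fun k l => by
        rw [← hM, map_zero, Matrix.mul_apply]
        simp only [Matrix.mul_apply, Finset.sum_mul, Matrix.transpose_apply]
        exact Finset.sum_comm) a b
  obtain ⟨K, hK, hu⟩ := hv.exists_comp_clm hα A isOpen_univ hC
  have hA0 : ∀ᶠ x in nhds (0 : Pt n), A x ∈ Metric.ball (0 : Pt n) ρ :=
    A.continuous.continuousAt.eventually (by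
      rw [map_zero]; exact Metric.isOpen_ball.mem_nhds (Metric.mem_ball_self hρ))
  obtain ⟨r, hr, hball⟩ := Metric.eventually_nhds_iff_ball.mp (hA0.and hconf)
  have hpos : ∀ x : Pt n, 0 ≤ x ν → 0 ≤ A x ν := fun x hx => by rw [hAν]; positivity
  have hd : ∀ x, DifferentiableAt ℝ v x := fun x => hv.2.1 x (mem_univ _)
  refine ⟨r, hr, K, fun x => v (A x), hK, by simpa using hu, fun x hx hxν => ?_,
    fun x hx hxν => ?_, fun ha hb x hx hxν => hvpos ha hb _ (hball x hx).1 (hpos x hxν),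
    fun ha => ?_⟩
  · exact hvb _ (hball x hx).1 (by rw [hAν, hxν, mul_zero])
  · rw [(hball x hx).2 _ fun i => (hu.2.2 i).2.1 x (mem_univ _), lowOp_comp_clm _ _ _ A hd
      fun k x => (hv.2.2 k).2.1 x (mem_univ _)]
    have := hveq _ (hball x hx).1 (hpos x hxν)
    simp only [lowOp, hSA] at this
    simp only [hAe, this, neg_zero]
  · have h1 := (pd_comp_clm A (x := 0) (hd _)).2 ν
    rw [h1, map_zero, Finset.sum_eq_single ν (fun k _ hk => by
      rw [pd_eq_zero_of_const_on_hyperplane hρ (hd 0) hvb hk, mul_zero]) (by simp), hAe, hMν,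
      Pi.single_eq_same]
    exact mul_pos hκ (hvd ha)

lemma pd_const_mul_field (a : Fin n) (t : ℝ) (f : Pt n → ℝ) :
    pd a (fun y => t * f y) = fun y => t * pd a f y := by
  funext x
  have := fderiv_const_smul_field (𝕜 := ℝ) (f := f) t
  change fderiv ℝ (t • f) x (Pi.single a 1) = _
  rw [this]
  rfl

lemma confLap_const_mul (g : Met n) (u : Pt n → ℝ) (t : ℝ) (x : Pt n) :
    confLap g (fun y => t * u y) x = t * confLap g u x := by
  have h : ∀ a, (fun y => √(g y).det * ∑ b, (g y)⁻¹ a b * (t * pd b u y)) =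
      fun y => t * (√(g y).det * ∑ b, (g y)⁻¹ a b * pd b u y) := fun a => by
    funext y
    simp only [Finset.mul_sum]
    exact Finset.sum_congr rfl fun b _ => by ring
  simp only [confLap, laplaceBeltrami, pd_const_mul_field, h, ← Finset.mul_sum]
  ring

end ConformalSolutions

/-- Lemma B.1, part 2: local solutions of the conformal Laplace equation near a
boundary point, with prescribed boundary values. -/
theorem conformal_laplace_local_solutions_boundary
    (n k : ℕ) (hn : 3 ≤ n) (hk : 2 ≤ k) (α : ℝ) (hα : α ∈ Set.Ioo (0 : ℝ) 1)
    (Ω : Set (Pt n)) (hΩ : IsOpen Ω) (h0 : (0 : Pt n) ∈ Ω)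
    (g : Met n) (hgm : IsMetricOn g Ω) (hgr : MetCHolderOn k α Ω g)
    (lastIdx : Fin n) (hlast : (lastIdx : ℕ) = n - 1)
    (D : ℝ → Set (Pt n))
    (hD : ∀ ε, D ε = Metric.closedBall (0 : Pt n) ε ∩ {x : Pt n | 0 ≤ x lastIdx})
    (Γ : ℝ → Set (Pt n))
    (hΓ : ∀ ε, Γ ε = D ε ∩ {x : Pt n | x lastIdx = 0}) :
    (∃ ε > (0 : ℝ), D ε ⊆ Ω ∧
      ∃ (W : Set (Pt n)) (fn : Pt n → ℝ), IsOpen W ∧ D ε ⊆ W ∧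
        CHolderOn k α W fn ∧
        (∀ x ∈ D ε, confLap g fn x = 0) ∧
        (∀ x ∈ Γ ε, fn x = 0) ∧
        (∀ a : Fin n, pd a fn 0 = (Pi.single lastIdx (1 : ℝ) : Pt n) a)) ∧
    (∃ ε > (0 : ℝ), D ε ⊆ Ω ∧
      ∃ (W : Set (Pt n)) (f : Pt n → ℝ), IsOpen W ∧ D ε ⊆ W ∧
        CHolderOn k α W f ∧
        (∀ x ∈ D ε, confLap g f x = 0) ∧
        (∀ x ∈ D ε, 0 < f x) ∧
        (∀ x ∈ Γ ε, f x = 1)) := by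
  obtain ⟨m, rfl⟩ : ∃ m, k = m + 2 := ⟨k - 2, by omega⟩
  have hg : ∀ a b, LocHolder α (m + 2) (fun x => g x a b) := fun a b =>
    LocHolder.of_cHolderOn hα hΩ h0 (hgr a b)
  have hsol := exists_conformal_solution (by omega : 1 ≤ n) lastIdx hα m hg (hgm 0 h0).2
  have hsmall : ∀ ρ > 0, ∃ ε > 0, D ε ⊆ Ω ∧ D ε ⊆ Metric.ball 0 ρ ∩ {x | 0 ≤ x lastIdx} := by
    intro ρ hρ
    obtain ⟨ε, hε, h⟩ := Metric.nhds_basis_closedBall.mem_iff.mp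
      (Filter.inter_mem (hΩ.mem_nhds h0) (Metric.ball_mem_nhds (0 : Pt n) hρ))
    exact ⟨ε, hε, fun x hx => (h (by rw [hD] at hx; exact hx.1)).1,
      fun x hx => by rw [hD] at hx; exact ⟨(h hx.1).2, hx.2⟩⟩
  constructor
  · obtain ⟨ρ, hρ, C, u, hC, hu, hub, hueq, -, hud⟩ := hsol 1 0
    obtain ⟨ε, hε, hΩε, hsub⟩ := hsmall ρ hρ
    have hpos : 0 < pd lastIdx u 0 := hud rfl
    set t := (pd lastIdx u 0)⁻¹ with ht
    have hu' : HolderBdd α (m + 2) (|t| * C) univ (fun x => t * u x) :=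
      hu.const_mul isOpen_univ t
    refine ⟨ε, hε, hΩε, univ, fun x => t * u x, isOpen_univ, subset_univ _,
      hu'.cHolderOn_univ hα (mul_nonneg (abs_nonneg _) hC), fun x hx => ?_, fun x hx => ?_,
      fun a => ?_⟩
    · rw [confLap_const_mul, hueq x (hsub hx).1 (hsub hx).2, mul_zero]
    · rw [hΓ] at hx
      simp only [hub x (hsub hx.1).1 hx.2, mul_zero]
    · rw [pd_const_mul_field]
      rcases eq_or_ne a lastIdx with rfl | ha
      · beta_reduce
        rw [Pi.single_eq_same, ht, inv_mul_cancel₀ hpos.ne']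
      · beta_reduce
        rw [Pi.single_eq_of_ne ha,
          pd_eq_zero_of_const_on_hyperplane hρ (hu.2.1 _ (mem_univ _)) hub ha, mul_zero]
  · obtain ⟨ρ, hρ, C, u, hC, hu, hub, hueq, hupos, -⟩ := hsol 0 1
    obtain ⟨ε, hε, hΩε, hsub⟩ := hsmall ρ hρ
    refine ⟨ε, hε, hΩε, univ, u, isOpen_univ, subset_univ _, hu.cHolderOn_univ hα hC,
      fun x hx => hueq x (hsub hx).1 (hsub hx).2,
      fun x hx => hupos rfl rfl x (hsub hx).1 (hsub hx).2, fun x hx => ?_⟩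
    rw [hΓ] at hx
    exact hub x (hsub hx.1).1 hx.2
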